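/- Continuous vector-valued maximal theorem for Radon averages: for every p ∈ (1, ∞), every k, d₀ ∈ ℕ and every degree bound D ∈ ℕ, there is a constant C_p > 0 (depending only on p, k, d₀ and D, and in particular independent of the coefficients of the polynomial mapping) such that for every polynomial mapping P : ℝ^k → ℝ^{d₀} whose components have degree at most D and every sequence (f_t)_{t∈ℕ} of measurable functions on ℝ^{d₀} with ‖(Σ_{t∈ℕ}|f_t|²)^{1/2}‖_{L^p} < ∞, one has ‖ ( Σ_{t∈ℕ} sup_{r>0} |M_r^P f_t|² )^{1/2} ‖_{L^p(ℝ^{d₀})} ≤ C_p ‖ ( Σ_{t∈ℕ} |f_t|² )^{1/2} ‖_{L^p(ℝ^{d₀})}. -/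

import Mathlib

open scoped ENNReal

noncomputable section

/-- The continuous Radon averaging operator
`M_r^P f(x) = |B_r|^{−1} ∫_{B_r} f(x − P(y)) dy`, for a polynomial mapping `P : ℝ^k → ℝ^{d₀}`
with components given by the real polynomials `P j`. -/
def contRadonAvg (k d₀ : ℕ) (P : Fin d₀ → MvPolynomial (Fin k) ℝ) (r : ℝ)
    (f : EuclideanSpace ℝ (Fin d₀) → ℂ) (x : EuclideanSpace ℝ (Fin d₀)) : ℂ :=
  ((MeasureTheory.volume (Metric.closedBall (0 : EuclideanSpace ℝ (Fin k)) r)).toReal : ℂ)⁻¹ *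
    ∫ y in Metric.closedBall (0 : EuclideanSpace ℝ (Fin k)) r,
      f (WithLp.toLp 2 fun j => x j - MvPolynomial.eval (fun i => y i) (P j))

namespace Radon
open MeasureTheory FourierTransform SchwartzMap

theorem plancherel {V : Type*} [NormedAddCommGroup V] [InnerProductSpace ℝ V]
    [FiniteDimensional ℝ V] [MeasurableSpace V] [BorelSpace V] (f : V → ℂ)
    (hf : Integrable f) (hf2 : MemLp f 2 volume) :
    eLpNorm (𝓕 f) 2 volume = eLpNorm f 2 volume := by
  set F : Lp ℂ 2 (volume : Measure V) := hf2.toLp f with hF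
  have hcont : Continuous (𝓕 f) :=
    VectorFourier.fourierIntegral_continuous Real.continuous_fourierChar
      (by exact continuous_inner) hf
  have key : ∀ᵐ x ∂(volume : Measure V), (𝓕 F : Lp ℂ 2 (volume : Measure V)) x = 𝓕 f x := by
    apply ae_eq_of_integral_contDiff_smul_eq
    · exact (Lp.memLp _).locallyIntegrable (by norm_num)
    · exact hcont.locallyIntegrable
    intro g g_smooth g_cpt
    have hg₁ : HasCompactSupport (Complex.ofRealCLM ∘ g) := g_cpt.comp_left rfl
    have hg₂ : ContDiff ℝ ((⊤ : ℕ∞) : WithTop ℕ∞) (Complex.ofRealCLM ∘ g) := by fun_prop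
    set G := hg₁.toSchwartzMap hg₂ with hG
    have h1 : (Lp.toTemperedDistribution (𝓕 F : Lp ℂ 2 (volume : Measure V))) G =
        Lp.toTemperedDistribution F (𝓕 G) := by
      rw [← Lp.fourier_toTemperedDistribution_eq]; rfl
    rw [Lp.toTemperedDistribution_apply, Lp.toTemperedDistribution_apply] at h1
    have h2 : ∫ x, g x • (𝓕 F : Lp ℂ 2 (volume : Measure V)) x = ∫ x, (𝓕 G) x • F x := by
      rw [← h1]; rfl
    rw [h2]
    have h3 : ∫ x, (𝓕 G) x • F x = ∫ x, (𝓕 G) x • f x := by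
      apply integral_congr_ae
      filter_upwards [hf2.coeFn_toLp] with x hx
      rw [hF, hx]
    rw [h3]
    have h4 := VectorFourier.integral_fourierIntegral_smul_eq_flip (μ := (volume : Measure V))
      (ν := (volume : Measure V)) (L := innerₗ V) (f := (G : V → ℂ)) (g := f) Real.continuous_fourierChar
      (by exact continuous_inner) G.integrable hf
    rw [flip_innerₗ] at h4
    have h5 : ∀ x, (𝓕 G) x = VectorFourier.fourierIntegral Real.fourierChar volume (innerₗ V) (G : V → ℂ) x := by
      intro x; rw [SchwartzMap.fourier_coe]; rfl
    simp_rw [h5]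
    rw [h4]
    rfl
  rw [← eLpNorm_congr_ae key, ← eLpNorm_congr_ae hf2.coeFn_toLp]
  have := Lp.norm_fourier_eq F
  rw [Lp.norm_def, Lp.norm_def] at this
  rwa [ENNReal.toReal_eq_toReal_iff' (Lp.eLpNorm_ne_top _) (Lp.eLpNorm_ne_top _)] at this

end Radon

namespace Radon
open MeasureTheory Polynomial

theorem sublevel (m : ℕ) : ∃ C : ℝ, 0 < C ∧ ∀ q : ℝ[X], q.natDegree ≤ m →
    ∀ E : Set ℝ, E ⊆ Set.Icc 0 1 → ∀ ε μ : ℝ, 0 < μ → μ ≤ 1 → ENNReal.ofReal μ ≤ volume E →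
    (∀ h ∈ E, |q.eval h| ≤ ε) → ∀ i, |q.coeff i| ≤ C * ε / μ ^ m := by
  induction m with
  | zero =>
    refine ⟨1, one_pos, fun q hq E hE ε μ hμ hμ1 hv hb i => ?_⟩
    have hne : E.Nonempty := by
      rw [Set.nonempty_iff_ne_empty]; rintro rfl
      simp at hv; linarith
    obtain ⟨h0, hh0⟩ := hne
    have hq' := eq_C_of_natDegree_le_zero hq
    have h1 := hb h0 hh0
    rw [hq'] at h1 ⊢
    simp only [eval_C] at h1
    have hε : 0 ≤ ε := (abs_nonneg _).trans h1
    rw [coeff_C]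
    split_ifs <;> simp [h1, hε]
  | succ m ih =>
    obtain ⟨C, hC, ih⟩ := ih
    refine ⟨16 * 2 ^ m * C + 1, by positivity, fun q hq E hE ε μ hμ hμ1 hv hb i => ?_⟩
    have hne : E.Nonempty := by
      rw [Set.nonempty_iff_ne_empty]; rintro rfl
      simp at hv; linarith
    obtain ⟨h0, hh0⟩ := hne
    have hε : 0 ≤ ε := (abs_nonneg _).trans (hb h0 hh0)
    obtain ⟨r, hr⟩ : ∃ r, r = q /ₘ (X - Polynomial.C h0) := ⟨_, rfl⟩
    have hdecomp : q = Polynomial.C (q.eval h0) + (X - Polynomial.C h0) * r := by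
      have := modByMonic_add_div q (X - Polynomial.C h0)
      rw [modByMonic_X_sub_C_eq_C_eval] at this
      rw [hr]; exact this.symm
    have hrdeg : r.natDegree ≤ m := by
      rw [hr, natDegree_divByMonic _ (monic_X_sub_C h0), natDegree_X_sub_C]; omega
    have hE' := ih r hrdeg (E \ Metric.ball h0 (μ / 4)) (Set.sdiff_subset.trans hE) (8 * ε / μ) (μ / 2)
      (by linarith) (by linarith) ?_ ?_
    · have hb' : ∀ k, |r.coeff k| ≤ 8 * 2 ^ m * C * (ε / μ ^ (m + 1)) := by
        intro k
        refine (hE' k).trans (le_of_eq ?_)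
        rw [div_pow]; field_simp; ring
      have h0abs : |h0| ≤ 1 := by
        have := hE hh0; rw [abs_le]; constructor <;> linarith [this.1, this.2]
      have hεμ : ε ≤ ε / μ ^ (m + 1) := by
        rw [le_div_iff₀ (by positivity)]
        have : μ ^ (m + 1) ≤ 1 := pow_le_one₀ hμ.le hμ1
        nlinarith
      have hK : 0 ≤ ε / μ ^ (m + 1) := by positivity
      rw [hdecomp]
      have e1 : |(Polynomial.C (q.eval h0)).coeff i| ≤ ε := by
        rw [coeff_C]; split_ifs
        · exact hb h0 hh0
        · simpa using hε
      have e2 : |(X * r).coeff i| ≤ 8 * 2 ^ m * C * (ε / μ ^ (m + 1)) := by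
        cases i with
        | zero => simp; positivity
        | succ i => rw [coeff_X_mul]; exact hb' i
      have e3 : |(Polynomial.C h0 * r).coeff i| ≤ 8 * 2 ^ m * C * (ε / μ ^ (m + 1)) := by
        rw [coeff_C_mul, abs_mul]
        calc _ ≤ 1 * |r.coeff i| := by gcongr
          _ ≤ _ := by rw [one_mul]; exact hb' i
      rw [coeff_add, sub_mul, coeff_sub]
      calc _ ≤ |(Polynomial.C (q.eval h0)).coeff i| + (|(X * r).coeff i| + |(Polynomial.C h0 * r).coeff i|) :=
            (abs_add_le _ _).trans (by gcongr; exact abs_sub _ _)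
        _ ≤ ε / μ ^ (m + 1) + (8 * 2 ^ m * C * (ε / μ ^ (m + 1)) + 8 * 2 ^ m * C * (ε / μ ^ (m + 1))) := by
            gcongr; exact e1.trans hεμ
        _ = _ := by ring
    · have h1 : volume E ≤ volume (E \ Metric.ball h0 (μ / 4)) + volume (Metric.ball h0 (μ / 4)) := by
        refine (measure_mono ?_).trans (measure_union_le _ _)
        intro x hx; by_cases h : x ∈ Metric.ball h0 (μ/4)
        · exact Or.inr h
        · exact Or.inl ⟨hx, h⟩
      rw [Real.volume_ball] at h1
      have h2 : ENNReal.ofReal (μ / 2) + ENNReal.ofReal (2 * (μ / 4)) ≤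
          volume (E \ Metric.ball h0 (μ / 4)) + ENNReal.ofReal (2 * (μ / 4)) := by
        rw [← ENNReal.ofReal_add (by linarith) (by linarith)]
        refine le_trans (le_of_eq ?_) (hv.trans h1)
        congr 1; ring
      exact (ENNReal.add_le_add_iff_right ENNReal.ofReal_ne_top).1 h2
    · intro h hh
      have hd : μ / 4 ≤ |h - h0| := by
        have := hh.2; rw [Metric.mem_ball, not_lt, Real.dist_eq] at this; exact this
      have h1 : q.eval h - q.eval h0 = (h - h0) * r.eval h := by
        conv_lhs => rw [hdecomp]
        simp
      have h2 : |h - h0| * |r.eval h| ≤ 2 * ε := by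
        rw [← abs_mul, ← h1]
        calc _ ≤ |q.eval h| + |q.eval h0| := abs_sub _ _
          _ ≤ 2 * ε := by linarith [hb h hh.1, hb h0 hh0]
      rw [le_div_iff₀ hμ]
      nlinarith [abs_nonneg (r.eval h)]

theorem good_interval (φ : ℝ[X]) (a b M R : ℝ) (hab : a ≤ b) (hM : 0 < M)
    (h1 : ∀ s ∈ Set.Icc a b, M ≤ |φ.derivative.eval s|)
    (h2 : ∀ s ∈ Set.Icc a b, |φ.derivative.derivative.eval s| ≤ R) :
    ‖∫ s in a..b, Complex.exp (Complex.I * (φ.eval s : ℝ))‖ ≤ 2 / M + (b - a) * R / M ^ 2 := by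
  set ψ := φ.derivative
  set χ := ψ.derivative
  have hne : ∀ s ∈ Set.Icc a b, ((ψ.eval s : ℝ) : ℂ) ≠ 0 := by
    intro s hs h
    have : ψ.eval s = 0 := by exact_mod_cast h
    have := h1 s hs; simp_all; linarith
  have hR : 0 ≤ R := (abs_nonneg _).trans (h2 a ⟨le_rfl, hab⟩)
  let G : ℝ → ℂ := fun s => Complex.exp (Complex.I * (φ.eval s : ℝ)) / (Complex.I * (ψ.eval s : ℝ))
  let H : ℝ → ℂ := fun s => Complex.exp (Complex.I * (φ.eval s : ℝ)) * (χ.eval s : ℝ) / (Complex.I * (ψ.eval s : ℝ) ^ 2)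
  have hcφ : Continuous fun s : ℝ => Complex.exp (Complex.I * (φ.eval s : ℝ)) := by
    have := φ.continuous
    fun_prop
  have hcψ : Continuous fun s : ℝ => ((ψ.eval s : ℝ) : ℂ) := by
    have := ψ.continuous; fun_prop
  have hcχ : Continuous fun s : ℝ => ((χ.eval s : ℝ) : ℂ) := by
    have := χ.continuous; fun_prop
  have hderiv : ∀ s ∈ Set.uIcc a b, HasDerivAt G (Complex.exp (Complex.I * (φ.eval s : ℝ)) - H s) s := by
    intro s hs
    rw [Set.uIcc_of_le hab] at hs
    have e1 : HasDerivAt (fun s : ℝ => ((φ.eval s : ℝ) : ℂ)) (ψ.eval s : ℝ) s := (φ.hasDerivAt s).ofReal_comp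
    have e2 : HasDerivAt (fun s : ℝ => ((ψ.eval s : ℝ) : ℂ)) (χ.eval s : ℝ) s := (ψ.hasDerivAt s).ofReal_comp
    have e3 := (e1.const_mul Complex.I).cexp
    have e4 := e3.div (e2.const_mul Complex.I) (mul_ne_zero Complex.I_ne_zero (hne s hs))
    change HasDerivAt G _ s at e4
    convert e4 using 1
    have := hne s hs
    have hI := Complex.I_ne_zero
    simp only [H]
    field_simp
  have hHc : ContinuousOn H (Set.Icc a b) := by
    apply ContinuousOn.div
    · exact (hcφ.mul hcχ).continuousOn
    · exact (continuous_const.mul (hcψ.pow 2)).continuousOn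
    · intro s hs; exact mul_ne_zero Complex.I_ne_zero (pow_ne_zero _ (hne s hs))
  have hHi : IntervalIntegrable H volume a b := by
    apply ContinuousOn.intervalIntegrable; rwa [Set.uIcc_of_le hab]
  have hh_intg := intervalIntegral.integral_eq_sub_of_hasDerivAt hderiv
    ((hcφ.intervalIntegrable a b).sub hHi)
  rw [intervalIntegral.integral_sub (hcφ.intervalIntegrable a b) hHi] at hh_intg
  have hEn : ∀ s : ℝ, ‖Complex.exp (Complex.I * (φ.eval s : ℝ))‖ = 1 := by
    intro s; rw [mul_comm]; exact Complex.norm_exp_ofReal_mul_I _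
  have hG : ∀ s ∈ Set.Icc a b, ‖G s‖ ≤ 1 / M := by
    intro s hs
    simp only [G, norm_div, hEn, norm_mul, Complex.norm_I, one_mul, Complex.norm_real, Real.norm_eq_abs]
    exact one_div_le_one_div_of_le hM (h1 s hs)
  have hH : ∀ s ∈ Set.Icc a b, ‖H s‖ ≤ R / M ^ 2 := by
    intro s hs
    simp only [H, norm_div, hEn, norm_mul, norm_pow, Complex.norm_I, one_mul, Complex.norm_real, Real.norm_eq_abs]
    have := h1 s hs; have := h2 s hs
    gcongr
  have hIH : ‖∫ s in a..b, H s‖ ≤ R / M ^ 2 * |b - a| := by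
    apply intervalIntegral.norm_integral_le_of_norm_le_const
    intro s hs
    rw [Set.uIoc_of_le hab] at hs
    exact hH s ⟨hs.1.le, hs.2⟩
  rw [abs_of_nonneg (by linarith)] at hIH
  have : ∫ s in a..b, Complex.exp (Complex.I * (φ.eval s : ℝ)) = G b - G a + ∫ s in a..b, H s := by
    rw [← hh_intg]; ring
  rw [this]
  calc _ ≤ ‖G b‖ + ‖G a‖ + ‖∫ s in a..b, H s‖ := (norm_add_le _ _).trans (by gcongr; exact norm_sub_le _ _)
    _ ≤ 1 / M + 1 / M + R / M ^ 2 * (b - a) := by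
      gcongr
      · exact hG b ⟨hab, le_rfl⟩
      · exact hG a ⟨le_rfl, hab⟩
    _ = _ := by ring

theorem eval_le_sum (q : ℝ[X]) (d : ℕ) (hq : q.natDegree ≤ d) (s : ℝ) (hs : s ∈ Set.Icc (0:ℝ) 1) :
    |q.eval s| ≤ ∑ i ∈ Finset.range (d + 1), |q.coeff i| := by
  rw [eval_eq_sum_range' (Nat.lt_succ_of_le hq)]
  refine (Finset.abs_sum_le_sum_abs _ _).trans (Finset.sum_le_sum fun i _ => ?_)
  rw [abs_mul, abs_of_nonneg (pow_nonneg hs.1 i)]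
  exact mul_le_of_le_one_right (abs_nonneg _) (pow_le_one₀ hs.1 hs.2)

theorem sum_derivative_le (q : ℝ[X]) (d : ℕ) (hq : q.natDegree ≤ d) :
    ∑ i ∈ Finset.range (d + 1), |q.derivative.coeff i| ≤ d * ∑ i ∈ Finset.range d, |q.coeff (i + 1)| := by
  rw [Finset.sum_range_succ, coeff_derivative,
    coeff_eq_zero_of_natDegree_lt (Nat.lt_succ_of_le hq), zero_mul, abs_zero, add_zero, Finset.mul_sum]
  refine Finset.sum_le_sum fun i hi => ?_
  rw [coeff_derivative, abs_mul, mul_comm]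
  gcongr
  have : i + 1 ≤ d := Finset.mem_range.1 hi
  rw [abs_of_nonneg (by positivity)]
  exact_mod_cast this

theorem vdc (d : ℕ) (hd : 1 ≤ d) : ∃ C : ℝ, 0 < C ∧ ∀ φ : ℝ[X], φ.natDegree ≤ d →
    0 < ∑ i ∈ Finset.range d, |φ.coeff (i + 1)| →
    ‖∫ s in (0:ℝ)..1, Complex.exp (Complex.I * (φ.eval s : ℝ))‖ ≤
      C * (∑ i ∈ Finset.range d, |φ.coeff (i + 1)|) ^ (-(1 / (4 * d) : ℝ)) := by
  obtain ⟨C₁, hC₁, hsub⟩ := sublevel d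
  set K : ℝ := C₁ * d * (1 + d ^ 2) with hK
  have hd0 : (0:ℝ) < d := by exact_mod_cast hd
  have hd1 : (1:ℝ) ≤ d := by exact_mod_cast hd
  have hKpos : 0 < K := by positivity
  refine ⟨K ^ (1 / d : ℝ) + 4 + d ^ 2, by positivity, fun φ hφ hΛ => ?_⟩
  set Λ := ∑ i ∈ Finset.range d, |φ.coeff (i + 1)| with hΛdef
  have hEn : ∀ s : ℝ, ‖Complex.exp (Complex.I * (φ.eval s : ℝ))‖ = 1 := by
    intro s; rw [mul_comm]; exact Complex.norm_exp_ofReal_mul_I _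
  have hshort : ∀ a b : ℝ, a ≤ b → ‖∫ s in a..b, Complex.exp (Complex.I * (φ.eval s : ℝ))‖ ≤ b - a := by
    intro a b hab
    have := intervalIntegral.norm_integral_le_of_norm_le_const (a := a) (b := b) (C := 1)
      (f := fun s => Complex.exp (Complex.I * (φ.eval s : ℝ))) (fun s _ => (hEn s).le)
    rwa [one_mul, abs_of_nonneg (by linarith)] at this
  have hKd : 0 < K ^ (1 / d : ℝ) := by positivity
  rcases lt_or_ge Λ 1 with hΛ1 | hΛ1
  · have h1 := hshort 0 1 zero_le_one
    have h2 : 1 ≤ Λ ^ (-(1 / (4 * d) : ℝ)) :=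
      Real.one_le_rpow_of_pos_of_le_one_of_nonpos hΛ hΛ1.le (by simp)
    calc _ ≤ (1:ℝ) := by simpa using h1
      _ ≤ 4 * 1 := by norm_num
      _ ≤ _ := by gcongr; nlinarith
  set ψ := φ.derivative with hψ
  set R : ℝ := d ^ 2 * Λ with hR
  have hψsum : ∑ i ∈ Finset.range (d + 1), |ψ.coeff i| ≤ d * Λ := sum_derivative_le φ d hφ
  have hψdeg : ψ.natDegree ≤ d := (natDegree_derivative_le φ).trans (by omega)
  have hχdeg : ψ.derivative.natDegree ≤ d := (natDegree_derivative_le ψ).trans (by omega)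
  have hχ : ∀ s ∈ Set.Icc (0:ℝ) 1, |ψ.derivative.eval s| ≤ R := by
    intro s hs
    refine (eval_le_sum _ d hχdeg s hs).trans ((sum_derivative_le ψ d hψdeg).trans ?_)
    have : ∑ i ∈ Finset.range d, |ψ.coeff (i + 1)| ≤ ∑ i ∈ Finset.range (d + 1), |ψ.coeff i| := by
      rw [Finset.sum_range_succ']; linarith [abs_nonneg (ψ.coeff 0)]
    calc (d:ℝ) * ∑ i ∈ Finset.range d, |ψ.coeff (i + 1)| ≤ d * (d * Λ) := by
          gcongr; exact this.trans hψsum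
      _ = R := by rw [hR]; ring
  set M : ℝ := Λ ^ (3 / 4 : ℝ) with hM
  have hMpos : 0 < M := by positivity
  set N : ℕ := ⌈Λ ^ (1 / 2 : ℝ)⌉₊ with hN
  have hh1 : 1 ≤ Λ ^ (1 / 2 : ℝ) := Real.one_le_rpow hΛ1 (by norm_num)
  have hN1 : Λ ^ (1 / 2 : ℝ) ≤ N := Nat.le_ceil _
  have hN2 : (N:ℝ) ≤ 2 * Λ ^ (1 / 2 : ℝ) := by
    have := Nat.ceil_lt_add_one (a := Λ ^ (1 / 2 : ℝ)) (by positivity)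
    linarith
  have hNpos : (0:ℝ) < N := by linarith
  let p : ℕ → ℝ := fun k => k / N
  have hpstep : ∀ k, p (k + 1) - p k = 1 / N := by intro k; simp only [p]; push_cast; ring
  have hple : ∀ k, p k ≤ p (k + 1) := by
    intro k; have := hpstep k; have : 0 < 1 / (N:ℝ) := by positivity
    linarith
  have hp0 : ∀ k, 0 ≤ p k := fun k => by positivity
  have hp1 : ∀ k < N, p (k + 1) ≤ 1 := by
    intro k hk; simp only [p]; rw [div_le_one hNpos]; exact_mod_cast hk
  have hsum : ∫ s in (0:ℝ)..1, Complex.exp (Complex.I * (φ.eval s : ℝ)) =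
      ∑ k ∈ Finset.range N, ∫ s in (p k)..(p (k + 1)), Complex.exp (Complex.I * (φ.eval s : ℝ)) := by
    rw [intervalIntegral.sum_integral_adjacent_intervals]
    · congr 1
      · simp [p]
      · simp only [p]; rw [div_self hNpos.ne']
    · intro k _
      apply Continuous.intervalIntegrable
      have := φ.continuous
      fun_prop
  classical
  let B : Finset ℕ := (Finset.range N).filter fun k => ∃ s ∈ Set.Icc (p k) (p (k + 1)), |ψ.eval s| < M
  set μ : ℝ := B.card / N with hμ
  have hBN : B.card ≤ N := by
    refine (Finset.card_filter_le _ _).trans ?_; simp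
  have hμ1 : μ ≤ 1 := by rw [hμ, div_le_one hNpos]; exact_mod_cast hBN
  have hΛM : Λ * Λ ^ (-(1 / 4) : ℝ) = M := by
    rw [hM, ← Real.rpow_one_add' hΛ.le (by norm_num)]; norm_num
  have hlen : 1 / (N:ℝ) * R ≤ d ^ 2 * M := by
    rw [one_div, inv_mul_le_iff₀ hNpos, hR]
    have h1 : Λ ≤ Λ ^ (1/2:ℝ) * M := by
      rw [hM, ← Real.rpow_add hΛ]; norm_num
      exact Real.self_le_rpow_of_one_le hΛ1 (by norm_num)
    calc (d:ℝ)^2 * Λ ≤ d ^ 2 * (Λ ^ (1/2:ℝ) * M) := by gcongr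
      _ ≤ d ^ 2 * (N * M) := by gcongr
      _ = _ := by ring
  have hbadsub : ∀ k ∈ B, ∀ s ∈ Set.Icc (p k) (p (k + 1)), |ψ.eval s| ≤ (1 + d ^ 2) * M := by
    intro k hk s hs
    obtain ⟨hkN, s', hs', hlt⟩ := Finset.mem_filter.1 hk
    rw [Finset.mem_range] at hkN
    have hsubI : Set.Icc (p k) (p (k+1)) ⊆ Set.Icc (0:ℝ) 1 :=
      Set.Icc_subset_Icc (hp0 k) (hp1 k hkN)
    have hl := Convex.norm_image_sub_le_of_norm_hasDerivWithin_le (f := fun s => ψ.eval s)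
      (f' := fun s => ψ.derivative.eval s) (s := Set.Icc (0:ℝ) 1) (C := R) (x := s') (y := s)
      (fun x _ => (ψ.hasDerivAt x).hasDerivWithinAt) (fun x hx => hχ x hx) (convex_Icc _ _)
      (hsubI hs') (hsubI hs)
    simp only [Real.norm_eq_abs] at hl
    have hd' : |s - s'| ≤ 1 / N := by
      rw [← hpstep k, abs_le]; constructor <;> linarith [hs.1, hs.2, hs'.1, hs'.2]
    have : |ψ.eval s| ≤ |ψ.eval s'| + |ψ.eval s - ψ.eval s'| := by
      have := abs_add_le (ψ.eval s') (ψ.eval s - ψ.eval s'); simpa using this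
    have h3 : R * |s - s'| ≤ 1 / N * R := by
      rw [mul_comm]; gcongr
    linarith
  have hμbound : μ ≤ K ^ (1 / d : ℝ) * Λ ^ (-(1 / (4 * d) : ℝ)) := by
    rcases B.eq_empty_or_nonempty with hBe | hBne
    · rw [hμ, hBe]; simp; positivity
    have hμpos : 0 < μ := by
      rw [hμ]; have : 0 < B.card := hBne.card_pos
      positivity
    let E : Set ℝ := ⋃ k ∈ B, Set.Ico (p k) (p (k + 1))
    have hE01 : E ⊆ Set.Icc 0 1 := by
      intro s hs
      simp only [E, Set.mem_iUnion] at hs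
      obtain ⟨k, hk, hs⟩ := hs
      have hkN := Finset.mem_range.1 (Finset.mem_filter.1 hk).1
      exact ⟨(hp0 k).trans hs.1, hs.2.le.trans (hp1 k hkN)⟩
    have hmono : Monotone p := monotone_nat_of_le_succ hple
    have hEvol : volume E = ENNReal.ofReal μ := by
      rw [measure_biUnion_finset]
      · simp_rw [Real.volume_Ico, hpstep]
        rw [Finset.sum_const, nsmul_eq_mul, ← ENNReal.ofReal_natCast,
          ← ENNReal.ofReal_mul (by positivity)]
        congr 1; rw [hμ]; ring
      · intro a _ b _ hab
        exact (hmono.pairwise_disjoint_on_Ico_succ) hab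
      · intro k _; exact measurableSet_Ico
    obtain ⟨i, hi⟩ : ∃ i, Λ / d ≤ |ψ.coeff i| := by
      by_contra! hcon
      have : Λ < ∑ i ∈ Finset.range d, Λ / d := by
        rw [hΛdef]
        apply Finset.sum_lt_sum_of_nonempty ⟨0, Finset.mem_range.2 hd⟩
        intro i _
        refine lt_of_le_of_lt ?_ (hcon i)
        rw [hψ, coeff_derivative, abs_mul]
        refine le_mul_of_one_le_right (abs_nonneg _) ?_
        rw [abs_of_nonneg (by positivity)]; linarith [(Nat.cast_nonneg i : (0:ℝ) ≤ i)]
      rw [Finset.sum_const, Finset.card_range, nsmul_eq_mul, mul_div_cancel₀ _ hd0.ne'] at this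
      exact lt_irrefl _ this
    have h4 := hsub ψ hψdeg E hE01 ((1 + d ^ 2) * M) μ hμpos hμ1 hEvol.ge (by
      intro h hh
      simp only [E, Set.mem_iUnion] at hh
      obtain ⟨k, hk, hh⟩ := hh
      exact hbadsub k hk h ⟨hh.1, hh.2.le⟩) i
    have h5 := hi.trans h4
    have h6 : μ ^ d ≤ K * Λ ^ (-(1/4) : ℝ) := by
      rw [le_div_iff₀ (by positivity), div_mul_eq_mul_div, div_le_iff₀ hd0, ← hΛM] at h5
      have : Λ * μ ^ d ≤ Λ * (K * Λ ^ (-(1/4) : ℝ)) := by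
        rw [hK]; linarith
      exact le_of_mul_le_mul_left this hΛ
    have h7 : μ = (μ ^ d) ^ (1 / d : ℝ) := by
      rw [← Real.rpow_natCast, ← Real.rpow_mul hμpos.le, mul_one_div_cancel hd0.ne', Real.rpow_one]
    rw [h7]
    calc (μ ^ d) ^ (1 / d : ℝ) ≤ (K * Λ ^ (-(1/4) : ℝ)) ^ (1 / d : ℝ) := by gcongr
      _ = _ := by
        rw [Real.mul_rpow hKpos.le (by positivity), ← Real.rpow_mul hΛ.le]
        congr 2; field_simp
  have hterm : ∀ k ∈ Finset.range N, ‖∫ s in (p k)..(p (k + 1)), Complex.exp (Complex.I * (φ.eval s : ℝ))‖ ≤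
      (if k ∈ B then 1 / (N:ℝ) else 0) + (2 / M + 1 / N * R / M ^ 2) := by
    intro k hk
    have hkN := Finset.mem_range.1 hk
    have hpos : 0 ≤ 2 / M + 1 / N * R / M ^ 2 := by positivity
    split_ifs with hkB
    · have := hshort _ _ (hple k); rw [hpstep] at this; linarith
    · have hgood : ∀ s ∈ Set.Icc (p k) (p (k + 1)), M ≤ |ψ.eval s| := by
        intro s hs; by_contra! hlt
        exact hkB (Finset.mem_filter.2 ⟨hk, s, hs, hlt⟩)
      have := good_interval φ (p k) (p (k+1)) M R (hple k) hMpos hgood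
        (fun s hs => hχ s ⟨(hp0 k).trans hs.1, hs.2.trans (hp1 k hkN)⟩)
      rw [hpstep] at this; linarith
  rw [hsum]
  have hδ : Λ ^ (-(1/4) : ℝ) ≤ Λ ^ (-(1 / (4 * d) : ℝ)) := by
    apply Real.rpow_le_rpow_of_exponent_le hΛ1
    rw [neg_le_neg_iff]
    apply one_div_le_one_div_of_le (by norm_num); linarith
  have hA : N * (2 / M) ≤ 4 * Λ ^ (-(1/4) : ℝ) := by
    have : Λ ^ (1/2:ℝ) / M = Λ ^ (-(1/4) : ℝ) := by
      rw [hM, ← Real.rpow_sub hΛ]; norm_num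
    rw [← this]
    calc N * (2 / M) ≤ (2 * Λ ^ (1 / 2 : ℝ)) * (2 / M) := by gcongr
      _ = _ := by ring
  have hB : R / M ^ 2 ≤ d ^ 2 * Λ ^ (-(1/4) : ℝ) := by
    have h1 : Λ / M ^ 2 = Λ ^ (-(1/2) : ℝ) := by
      rw [hM, ← Real.rpow_natCast, ← Real.rpow_mul hΛ.le]
      nth_rewrite 1 [← Real.rpow_one Λ]
      rw [← Real.rpow_sub hΛ]; norm_num
    have h2 : Λ ^ (-(1/2) : ℝ) ≤ Λ ^ (-(1/4) : ℝ) :=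
      Real.rpow_le_rpow_of_exponent_le hΛ1 (by norm_num)
    rw [hR, mul_div_assoc, h1]; gcongr
  calc _ ≤ ∑ k ∈ Finset.range N, ((if k ∈ B then 1 / (N:ℝ) else 0) + (2 / M + 1 / N * R / M ^ 2)) :=
        (norm_sum_le _ _).trans (Finset.sum_le_sum hterm)
    _ = μ + (N * (2 / M) + R / M ^ 2) := by
      rw [Finset.sum_add_distrib, Finset.sum_const, Finset.card_range, nsmul_eq_mul,
        ← Finset.sum_filter]
      have : (Finset.range N).filter (fun k => k ∈ B) = B := by
        ext k; simp only [Finset.mem_filter, B]; tauto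
      rw [this, Finset.sum_const, nsmul_eq_mul, hμ]
      field_simp
    _ ≤ K ^ (1 / d : ℝ) * Λ ^ (-(1 / (4 * d) : ℝ)) + (4 * Λ ^ (-(1 / (4 * d) : ℝ)) + d ^ 2 * Λ ^ (-(1 / (4 * d) : ℝ))) := by
      exact add_le_add hμbound (add_le_add (hA.trans (mul_le_mul_of_nonneg_left hδ (by positivity)))
        (hB.trans (mul_le_mul_of_nonneg_left hδ (by positivity))))
    _ = _ := by ring

end Radon

namespace Radon
open MeasureTheory

abbrev V (d : ℕ) := EuclideanSpace ℝ (Fin d)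

/-- nonisotropic dyadic scale -/
def scl {d : ℕ} (m : ℤ) (i : Fin d) : ℝ := (2:ℝ) ^ (m * ((i:ℤ) + 1))

lemma scl_pos {d : ℕ} (m : ℤ) (i : Fin d) : 0 < scl m i := by unfold scl; positivity

lemma scl_add {d : ℕ} (m n : ℤ) (i : Fin d) : scl (m + n) i = scl m i * scl n i := by
  unfold scl; rw [add_mul, zpow_add₀ (by norm_num)]

lemma scl_one {d : ℕ} (i : Fin d) : scl 1 i = ((2 ^ ((i:ℕ) + 1) : ℕ) : ℝ) := by
  unfold scl; rw [one_mul]; push_cast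
  rw [← zpow_natCast]; push_cast; rfl

lemma scl_zero {d : ℕ} (i : Fin d) : scl 0 i = 1 := by
  simp [scl]

lemma scl_mono {d : ℕ} {m n : ℤ} (h : m ≤ n) (i : Fin d) : scl m i ≤ scl n i := by
  unfold scl
  exact zpow_le_zpow_right₀ (by norm_num) (by nlinarith [Int.natCast_nonneg (i:ℕ)])

/-- volume of a cube -/
def vl (d : ℕ) (m : ℤ) : ℝ := ∏ i : Fin d, scl m i

lemma vl_pos (d : ℕ) (m : ℤ) : 0 < vl d m := Finset.prod_pos fun i _ => scl_pos m i

lemma vl_add (d : ℕ) (m n : ℤ) : vl d (m + n) = vl d m * vl d n := by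
  unfold vl; rw [← Finset.prod_mul_distrib]; exact Finset.prod_congr rfl fun i _ => scl_add m n i

lemma vl_one_ge (d : ℕ) : 1 ≤ vl d 1 := by
  unfold vl
  refine Finset.prod_induction _ (fun z : ℝ => 1 ≤ z) (fun a b => one_le_mul_of_one_le_of_one_le) le_rfl
    fun i _ => ?_
  rw [scl_one]; exact_mod_cast Nat.one_le_two_pow

def idx {d : ℕ} (m : ℤ) (x : V d) : Fin d → ℤ := fun i => ⌊x i / scl m i⌋

lemma idx_nest1 {d : ℕ} (m : ℤ) {x y : V d} (h : idx m x = idx m y) :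
    idx (m + 1) x = idx (m + 1) y := by
  funext i
  have := congrFun h i
  simp only [idx] at this ⊢
  rw [scl_add, scl_one, ← div_div, ← div_div, Int.floor_div_natCast, Int.floor_div_natCast, this]

lemma idx_nest {d : ℕ} {m n : ℤ} (hmn : m ≤ n) {x y : V d} (h : idx m x = idx m y) :
    idx n x = idx n y := by
  obtain ⟨k, rfl⟩ := Int.le.dest hmn
  clear hmn
  induction k with
  | zero => simpa using h
  | succ k ih =>
    have := idx_nest1 _ ih
    push_cast; rw [← add_assoc]; exact this

lemma measurable_idx {d : ℕ} (m : ℤ) : Measurable (idx (d := d) m) := by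
  unfold idx
  refine measurable_pi_lambda _ fun i => ?_
  exact Int.measurable_floor.comp (by fun_prop)

lemma volume_box {d : ℕ} (a b : Fin d → ℝ) :
    volume {x : V d | ∀ i, x i ∈ Set.Ico (a i) (b i)} = ∏ i, ENNReal.ofReal (b i - a i) := by
  have h := (EuclideanSpace.volume_preserving_symm_measurableEquiv_toLp (Fin d)).symm
  have e : {x : V d | ∀ i, x i ∈ Set.Ico (a i) (b i)} =
      (MeasurableEquiv.toLp 2 (Fin d → ℝ)).symm ⁻¹' (Set.pi Set.univ fun i => Set.Ico (a i) (b i)) := by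
    ext x; simp
  rw [e, (EuclideanSpace.volume_preserving_symm_measurableEquiv_toLp (Fin d)).measure_preimage_equiv,
    Real.volume_pi_Ico]

lemma volume_boxc {d : ℕ} (a b : Fin d → ℝ) :
    volume {x : V d | ∀ i, x i ∈ Set.Icc (a i) (b i)} = ∏ i, ENNReal.ofReal (b i - a i) := by
  have e : {x : V d | ∀ i, x i ∈ Set.Icc (a i) (b i)} =
      (MeasurableEquiv.toLp 2 (Fin d → ℝ)).symm ⁻¹' (Set.Icc a b) := by
    ext x; simp [Pi.le_def, forall_and]
  rw [e, (EuclideanSpace.volume_preserving_symm_measurableEquiv_toLp (Fin d)).measure_preimage_equiv,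
    Real.volume_Icc_pi]

lemma cube_eq {d : ℕ} (m : ℤ) (a : Fin d → ℤ) :
    {x : V d | idx m x = a} = {x | ∀ i, x i ∈ Set.Ico (a i * scl m i) ((a i + 1) * scl m i)} := by
  ext x
  simp only [Set.mem_ofPred_eq, idx, funext_iff, Int.floor_eq_iff, Set.mem_Ico]
  refine forall_congr' fun i => ?_
  rw [le_div_iff₀ (scl_pos m i), div_lt_iff₀ (scl_pos m i)]

lemma volume_cube {d : ℕ} (m : ℤ) (a : Fin d → ℤ) :
    volume {x : V d | idx m x = a} = ENNReal.ofReal (vl d m) := by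
  rw [cube_eq, volume_box, vl, ENNReal.ofReal_prod_of_nonneg fun i _ => (scl_pos m i).le]
  refine Finset.prod_congr rfl fun i _ => ?_
  congr 1; ring

end Radon

namespace Radon
open MeasureTheory

section stopping_cubes
variable {d : ℕ} (u : V d → ℝ≥0∞) (lam : ℝ≥0∞) (lo : ℤ) (N : ℕ)

def bad (n : ℕ) (x : V d) : Prop :=
  lam * ENNReal.ofReal (vl d (lo + n)) < ∫⁻ y in {y | idx (lo + n) y = idx (lo + n) x}, u y

open Classical in
def stp (x : V d) : ℕ := Nat.findGreatest (fun n => bad u lam lo n x) N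

def kap (x : V d) : ℕ × (Fin d → ℤ) := (stp u lam lo N x, idx (lo + stp u lam lo N x) x)

lemma bad_congr {n m : ℕ} (h : m ≤ n) {x y : V d} (hxy : idx (lo + m) x = idx (lo + m) y) :
    bad u lam lo n x ↔ bad u lam lo n y := by
  have := idx_nest (m := lo + m) (n := lo + n) (by gcongr) hxy
  unfold bad; rw [this]

lemma stp_congr {x y : V d} (h : idx (lo + stp u lam lo N x) y = idx (lo + stp u lam lo N x) x) :
    stp u lam lo N y = stp u lam lo N x := by
  classical
  have h0 : stp u lam lo N x = stp u lam lo N x := rfl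
  unfold stp at h0 ⊢
  rw [Nat.findGreatest_eq_iff] at h0 ⊢
  refine ⟨h0.1, fun hne => ?_, fun n hn hnN => ?_⟩
  · exact (bad_congr u lam lo le_rfl h).2 (h0.2.1 hne)
  · exact fun hb => h0.2.2 hn hnN ((bad_congr u lam lo hn.le h).1 hb)

lemma kap_eq_iff {x y : V d} : kap u lam lo N y = kap u lam lo N x ↔
    idx (lo + stp u lam lo N x) y = idx (lo + stp u lam lo N x) x := by
  constructor
  · intro h
    simp only [kap, Prod.mk.injEq] at h
    rw [← h.2, h.1]
  · intro h
    simp only [kap, stp_congr u lam lo N h, h]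

lemma measurable_kap : Measurable (kap u lam lo N) := by
  have hf : Function.FactorsThrough (kap u lam lo N) (idx (d := d) lo) := by
    intro x y h
    rw [kap_eq_iff]
    exact idx_nest (by simp) h
  rw [← hf.extend_comp (e' := fun _ => (0, 0))]
  exact Measurable.of_discrete.comp (measurable_idx lo)

lemma fiber_eq (x : V d) : {y | kap u lam lo N y = kap u lam lo N x} =
    {y | idx (lo + stp u lam lo N x) y = idx (lo + stp u lam lo N x) x} := by
  ext y; exact kap_eq_iff u lam lo N

lemma volume_fiber (x : V d) : volume {y | kap u lam lo N y = kap u lam lo N x} =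
    ENNReal.ofReal (vl d (lo + stp u lam lo N x)) := by
  rw [fiber_eq, volume_cube]

lemma bad_of_pos (x : V d) (h : stp u lam lo N x ≠ 0) : bad u lam lo (stp u lam lo N x) x := by
  classical
  exact Nat.findGreatest_of_ne_zero (P := fun n => bad u lam lo n x) rfl h

lemma avg_le (hN1 : 1 ≤ N) (hN : ∫⁻ y, u y ≤ lam * ENNReal.ofReal (vl d (lo + N))) (x : V d) :
    ∫⁻ y in {y | kap u lam lo N y = kap u lam lo N x}, u y ≤
      lam * ENNReal.ofReal (vl d 1) * ENNReal.ofReal (vl d (lo + stp u lam lo N x)) := by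
  classical
  have hle : stp u lam lo N x ≤ N := Nat.findGreatest_le N
  have hne : stp u lam lo N x ≠ N := by
    intro h
    have := bad_of_pos u lam lo N x (by omega)
    rw [h] at this
    exact absurd (this.trans_le (setLIntegral_le_lintegral _ _)) (not_lt.2 hN)
  have hnb : ¬ bad u lam lo (stp u lam lo N x + 1) x :=
    Nat.findGreatest_is_greatest (P := fun n => bad u lam lo n x) (Nat.lt_succ_self _) (by omega)
  unfold bad at hnb
  rw [not_lt] at hnb
  rw [fiber_eq]
  refine (lintegral_mono_set fun y hy => ?_).trans (hnb.trans (le_of_eq ?_))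
  · exact idx_nest (by simp) hy
  · push_cast
    rw [← add_assoc, vl_add, ENNReal.ofReal_mul (vl_pos _ _).le]; ring

end stopping_cubes

section partition
variable {α ι : Type*} [MeasurableSpace α] {μ : Measure α} [Countable ι] [MeasurableSpace ι]
  [MeasurableSingletonClass ι] {κ : α → ι}

lemma lint_fib (hκ : Measurable κ) (u : α → ℝ≥0∞) :
    ∫⁻ x, u x ∂μ = ∑' a, ∫⁻ x in {x | κ x = a}, u x ∂μ := by
  rw [← lintegral_iUnion (s := fun a => {x | κ x = a}) (fun a => hκ (measurableSet_singleton a))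
    (fun a b hab => Set.disjoint_left.2 fun x hx hy => hab (hx.symm.trans hy))]
  have : ⋃ a, {x | κ x = a} = Set.univ := by ext x; simp
  rw [this, Measure.restrict_univ]

lemma int_fib_zero {G : Type*} [NormedAddCommGroup G] [NormedSpace ℝ G] (hκ : Measurable κ) (f : α → G)
    (hf : Integrable f μ) (h : ∀ a, ∫ x in {x | κ x = a}, f x ∂μ = 0) : ∫ x, f x ∂μ = 0 := by
  have : ⋃ a, {x | κ x = a} = Set.univ := by ext x; simp
  rw [← setIntegral_univ, ← this, integral_iUnion (s := fun a => {x | κ x = a}) (fun a => hκ (measurableSet_singleton a))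
    (fun a b hab => Set.disjoint_left.2 fun x hx hy => hab (hx.symm.trans hy)) hf.integrableOn]
  simp [h]

variable {E : Type*} [NormedAddCommGroup E] [NormedSpace ℝ E]

/-- averaging over fibres -/
def fav (κ : α → ι) (μ : Measure α) (f : α → E) (x : α) : E := ⨍ y in {y | κ y = κ x}, f y ∂μ

lemma fav_strongly (hκ : Measurable κ) (f : α → E) : StronglyMeasurable (fav κ μ f) := by
  have : fav κ μ f = (fun a => ⨍ y in {y | κ y = a}, f y ∂μ) ∘ κ := rfl
  rw [this]
  have h1 : StronglyMeasurable (fun a : ι => ⨍ y in {y | κ y = a}, f y ∂μ) :=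
    StronglyMeasurable.of_discrete
  exact h1.comp_measurable hκ

lemma fav_int [CompleteSpace E] (hκ : Measurable κ) (f : α → E) (hfin : ∀ x, μ {y | κ y = κ x} ≠ ∞) (a : ι) :
    ∫ x in {x | κ x = a}, fav κ μ f x ∂μ = ∫ x in {x | κ x = a}, f x ∂μ := by
  have h1 : ∫ x in {x | κ x = a}, fav κ μ f x ∂μ = ∫ x in {x | κ x = a}, (⨍ y in {y | κ y = a}, f y ∂μ) ∂μ := by
    refine setIntegral_congr_fun (hκ (measurableSet_singleton a)) fun x hx => ?_
    have hx' : κ x = a := hx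
    simp only [fav, hx']
  by_cases hne : ∃ x, κ x = a
  · obtain ⟨x, rfl⟩ := hne
    rw [h1, setIntegral_const, measure_smul_setAverage _ (hfin x)]
  · have : {x | κ x = a} = ∅ := by ext x; simpa using fun h => hne ⟨x, h⟩
    simp [this]

lemma fav_mul_le (f : α → E) (x : α) (hfin : μ {y | κ y = κ x} ≠ ∞) :
    ‖fav κ μ f x‖ₑ * μ {y | κ y = κ x} ≤ ∫⁻ y in {y | κ y = κ x}, ‖f y‖ₑ ∂μ := by
  have h1 : ∫ y in {y | κ y = κ x}, f y ∂μ = μ.real {y | κ y = κ x} • fav κ μ f x := by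
    by_cases h : CompleteSpace E
    · rw [fav, measure_smul_setAverage _ hfin]
    · simp [fav, average, integral_def, h]
  have h2 := enorm_integral_le_lintegral_enorm (μ := μ.restrict {y | κ y = κ x}) f
  rw [h1, enorm_smul] at h2
  have h3 : ‖μ.real {y | κ y = κ x}‖ₑ = μ {y | κ y = κ x} := by
    rw [Real.enorm_eq_ofReal measureReal_nonneg, ofReal_measureReal hfin]
  rwa [h3, mul_comm] at h2

lemma fav_lint (hκ : Measurable κ) (f : α → E) (hfin : ∀ x, μ {y | κ y = κ x} ≠ ∞) :
    ∫⁻ x, ‖fav κ μ f x‖ₑ ∂μ ≤ ∫⁻ x, ‖f x‖ₑ ∂μ := by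
  rw [lint_fib hκ, lint_fib hκ (fun x => ‖f x‖ₑ)]
  refine ENNReal.tsum_le_tsum fun a => ?_
  by_cases hne : ∃ x, κ x = a
  · obtain ⟨x, rfl⟩ := hne
    refine le_trans (le_of_eq ?_) (fav_mul_le f x (hfin x))
    rw [← setLIntegral_const]
    refine setLIntegral_congr_fun (hκ (measurableSet_singleton _)) fun y hy => ?_
    have hy' : κ y = κ x := hy
    simp only [fav, hy']
  · have : {x | κ x = a} = ∅ := by ext x; simpa using fun h => hne ⟨x, h⟩
    simp [this]

end partition
end Radon

namespace Radon
open MeasureTheory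

structure Nice {d : ℕ} {E : Type*} [NormedAddCommGroup E] (f : V d → E) : Prop where
  sm : StronglyMeasurable f
  int : Integrable f volume
  bd : ∃ B : ℝ, ∀ x, ‖f x‖ ≤ B

section
variable {d : ℕ} {E F : Type*} [NormedAddCommGroup E] [NormedSpace ℝ E]
  [NormedAddCommGroup F] [NormedSpace ℝ F]

def cv (k : V d → E →L[ℝ] F) (f : V d → E) (x : V d) : F := ∫ y, k (x - y) (f y)

structure KerOK (k : V d → E →L[ℝ] F) (A H : ℝ≥0∞) : Prop where
  nice : Nice k
  l2 : ∀ f : V d → E, Nice f → ∫⁻ x, ‖cv k f x‖ₑ ^ 2 ≤ A * ∫⁻ x, ‖f x‖ₑ ^ 2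
  hor : ∀ (m : ℤ) (y c : V d), (∀ i, |y i - c i| ≤ scl m i) →
    ∫⁻ x in {x : V d | ∃ i, 4 * scl m i < |x i - c i|}, ‖k (x - y) - k (x - c)‖ₑ ≤ H
  fine : ∃ lo : ℤ, ∀ (y c : V d), (∀ i, |y i - c i| ≤ scl lo i) →
    ∫⁻ x, ‖k (x - y) - k (x - c)‖ₑ ≤ 1

variable {k : V d → E →L[ℝ] F}

lemma sm_apply {α : Type*} [MeasurableSpace α] {g : α → E →L[ℝ] F} {f : α → E}
    (hg : StronglyMeasurable g) (hf : StronglyMeasurable f) :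
    StronglyMeasurable fun a => g a (f a) :=
  isBoundedBilinearMap_apply.continuous.comp_stronglyMeasurable (hg.prodMk hf)

lemma integrable_ker {α : Type*} [MeasurableSpace α] {μ : Measure α} {f : α → E} (hk : Nice k)
    (hf : StronglyMeasurable f) (hfi : Integrable f μ)
    {c : α → V d} (hc : Measurable c) : Integrable (fun y => k (c y) (f y)) μ := by
  obtain ⟨B, hB⟩ := hk.bd
  refine Integrable.mono' (hfi.norm.const_mul B)
    (sm_apply (hk.sm.comp_measurable hc) hf).aestronglyMeasurable (ae_of_all _ fun y => ?_)
  exact ((k (c y)).le_opNorm _).trans (mul_le_mul_of_nonneg_right (hB _) (norm_nonneg _))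

lemma cv_add (hk : Nice k) {f g : V d → E} (hf : Nice f) (hg : Nice g) (x : V d) :
    cv k (fun y => f y + g y) x = cv k f x + cv k g x := by
  unfold cv
  rw [← integral_add (integrable_ker hk hf.sm hf.int (by fun_prop))
    (integrable_ker hk hg.sm hg.int (by fun_prop))]
  simp only [map_add]

lemma cv_sm (hk : Nice k) {f : V d → E} (hf : StronglyMeasurable f) : StronglyMeasurable (cv k f) := by
  unfold cv
  refine StronglyMeasurable.integral_prod_right' (f := fun p : V d × V d => k (p.1 - p.2) (f p.2)) ?_
  exact sm_apply (hk.sm.comp_measurable (by fun_prop)) (hf.comp_measurable (by fun_prop))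

/-- the corner of the stopping cube -/
def crn (lo : ℤ) (a : ℕ × (Fin d → ℤ)) : V d := WithLp.toLp 2 fun i => a.2 i * scl (lo + a.1) i

lemma crn_close (u : V d → ℝ≥0∞) (lam : ℝ≥0∞) (lo : ℤ) (N : ℕ) (x : V d) (i : Fin d) :
    |x i - crn lo (kap u lam lo N x) i| ≤ scl (lo + stp u lam lo N x) i := by
  have h : x ∈ {y | idx (lo + stp u lam lo N x) y = idx (lo + stp u lam lo N x) x} := rfl
  rw [cube_eq] at h
  have := h i
  simp only [crn, kap]
  rw [abs_le]
  constructor <;> nlinarith [this.1, this.2, scl_pos (lo + stp u lam lo N x) i]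

lemma vl_one_ge_two (hd : 0 < d) : 2 ≤ vl d 1 := by
  unfold vl
  obtain ⟨n, rfl⟩ : ∃ n, d = n + 1 := ⟨d - 1, by omega⟩
  rw [Fin.prod_univ_succ]
  have h1 : (1:ℝ) ≤ ∏ i : Fin n, scl 1 (Fin.succ i) := by
    refine Finset.prod_induction _ (fun z : ℝ => 1 ≤ z) (fun a b => one_le_mul_of_one_le_of_one_le) le_rfl
      fun i _ => ?_
    rw [scl_one]; exact_mod_cast Nat.one_le_two_pow
  have h2 : scl 1 (0 : Fin (n+1)) = 2 := by rw [scl_one]; simp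
  rw [h2]; linarith

lemma vl_add_nat (lo : ℤ) (N : ℕ) : vl d (lo + N) = vl d lo * vl d 1 ^ N := by
  induction N with
  | zero => simp
  | succ n ih => push_cast; rw [← add_assoc, vl_add, ih, pow_succ]; ring

lemma exists_N (hd : 0 < d) (lo : ℤ) {lam U : ℝ≥0∞} (h0 : lam ≠ 0) (hU : U ≠ ∞) :
    ∃ N : ℕ, 1 ≤ N ∧ U ≤ lam * ENNReal.ofReal (vl d (lo + N)) := by
  have h1 : Filter.Tendsto (fun N : ℕ => ENNReal.ofReal (vl d (lo + N))) Filter.atTop (nhds ∞) := by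
    refine ENNReal.tendsto_ofReal_atTop.comp ?_
    simp_rw [vl_add_nat]
    exact (tendsto_pow_atTop_atTop_of_one_lt (by linarith [vl_one_ge_two hd])).const_mul_atTop (vl_pos d lo)
  have h2 := ENNReal.Tendsto.const_mul (a := lam) h1 (Or.inl (by simp))
  rw [ENNReal.mul_top h0] at h2
  have h3 := (h2.eventually (lt_mem_nhds hU.lt_top)).and (Filter.eventually_ge_atTop 1)
  obtain ⟨N, hN⟩ := h3.exists
  exact ⟨N, hN.2, hN.1.le⟩

theorem weak11 [CompleteSpace E] [CompleteSpace F] (hd : 0 < d) {A H : ℝ≥0∞} (hk : KerOK k A H) {f : V d → E} (hf : Nice f) {lam : ℝ≥0∞}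
    (h0 : lam ≠ 0) (htop : lam ≠ ∞) :
    volume {x | lam < ‖cv k f x‖ₑ} ≤
      (4 * A * ENNReal.ofReal (vl d 1) + 8 ^ d + 4 * (H + 1)) * lam⁻¹ * ∫⁻ x, ‖f x‖ₑ := by
  classical
  obtain ⟨lo, hlo⟩ := hk.fine
  set u : V d → ℝ≥0∞ := fun x => ‖f x‖ₑ with hu
  have hum : Measurable u := hf.sm.enorm
  have hufin : ∫⁻ x, u x ≠ ∞ := hf.int.2.ne
  obtain ⟨N, hN1, hN⟩ := exists_N hd lo h0 hufin
  set κ := kap u lam lo N with hκd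
  have hκ : Measurable κ := measurable_kap u lam lo N
  have hvf : ∀ x, volume {y | κ y = κ x} = ENNReal.ofReal (vl d (lo + stp u lam lo N x)) :=
    volume_fiber u lam lo N
  have hfin : ∀ x, volume {y | κ y = κ x} ≠ ∞ := fun x => by rw [hvf]; exact ENNReal.ofReal_ne_top
  set g := fav κ volume f with hg
  have hgl1 : ∫⁻ x, ‖g x‖ₑ ≤ ∫⁻ x, u x := fav_lint hκ f hfin
  have hgsup : ∀ x, ‖g x‖ₑ ≤ lam * ENNReal.ofReal (vl d 1) := by
    intro x
    have h1 := (fav_mul_le f x (hfin x)).trans (avg_le u lam lo N hN1 hN x)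
    rw [hvf] at h1
    exact (ENNReal.mul_le_mul_iff_left (by simpa using vl_pos _ _) ENNReal.ofReal_ne_top).1 h1
  have hgn : Nice g := by
    refine ⟨fav_strongly hκ f, ⟨(fav_strongly hκ f).aestronglyMeasurable, hgl1.trans_lt hufin.lt_top⟩,
      (lam * ENNReal.ofReal (vl d 1)).toReal, fun x => ?_⟩
    rw [← toReal_enorm]
    exact ENNReal.toReal_mono (ENNReal.mul_ne_top htop ENNReal.ofReal_ne_top) (hgsup x)
  set b : V d → E := fun x => f x - g x with hb
  have hbn : Nice b := by
    refine ⟨hf.sm.sub hgn.sm, hf.int.sub hgn.int, ?_⟩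
    obtain ⟨B1, h1⟩ := hf.bd
    obtain ⟨B2, h2⟩ := hgn.bd
    exact ⟨B1 + B2, fun x => (norm_sub_le _ _).trans (add_le_add (h1 x) (h2 x))⟩
  have hbl1 : ∫⁻ x, ‖b x‖ₑ ≤ 2 * ∫⁻ x, u x := by
    calc ∫⁻ x, ‖b x‖ₑ ≤ ∫⁻ x, (u x + ‖g x‖ₑ) := lintegral_mono fun x => enorm_sub_le
      _ = (∫⁻ x, u x) + ∫⁻ x, ‖g x‖ₑ := lintegral_add_left hum _
      _ ≤ _ := by rw [two_mul]; gcongr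
  set c : V d → V d := fun y => crn lo (κ y) with hc
  have hcm : Measurable c := (Measurable.of_discrete (f := crn (d := d) lo)).comp hκ
  have hTb : ∀ x, cv k b x = ∫ y, (k (x - y) - k (x - c y)) (b y) := by
    intro x
    have hi := integrable_ker hk.nice hbn.sm hbn.int (c := fun y => x - c y) (by fun_prop)
    have hz : ∫ y, k (x - c y) (b y) = 0 := by
      refine int_fib_zero hκ _ hi fun a => ?_
      have h1 : ∫ y in {y | κ y = a}, k (x - c y) (b y) = ∫ y in {y | κ y = a}, k (x - crn lo a) (b y) := by
        refine setIntegral_congr_fun (hκ (measurableSet_singleton a)) fun y hy => ?_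
        have hy' : κ y = a := hy
        simp only [hc, hy']
      rw [h1, ContinuousLinearMap.integral_comp_comm _ hbn.int.integrableOn,
        integral_sub hf.int.integrableOn hgn.int.integrableOn, fav_int hκ f hfin, sub_self, map_zero]
    simp only [sub_apply]
    rw [integral_sub (integrable_ker hk.nice hbn.sm hbn.int (by fun_prop)) hi, hz, sub_zero]; rfl
  -- the exceptional set
  set isb : ℕ × (Fin d → ℤ) → Prop := fun a => ∃ y, κ y = a ∧ bad u lam lo (stp u lam lo N y) y with hisb
  set Om : ℕ × (Fin d → ℤ) → Set (V d) := fun a =>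
    {x | isb a ∧ ∀ i, |x i - crn lo a i| ≤ 4 * scl (lo + a.1) i} with hOm
  have hOmv : ∀ a, volume (Om a) ≤ 8 ^ d * lam⁻¹ * ∫⁻ x in {x | κ x = a}, u x := by
    intro a
    by_cases ha : isb a
    · have e : Om a = {x : V d | ∀ i, x i ∈ Set.Icc (crn lo a i - 4 * scl (lo + a.1) i)
          (crn lo a i + 4 * scl (lo + a.1) i)} := by
        ext x; simp only [hOm, Set.mem_ofPred_eq, ha, true_and, abs_le, Set.mem_Icc]
        refine forall_congr' fun i => ?_
        constructor <;> intro h <;> constructor <;> linarith [h.1, h.2]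
      have hv : volume (Om a) = 8 ^ d * ENNReal.ofReal (vl d (lo + a.1)) := by
        rw [e, volume_boxc, vl, ENNReal.ofReal_prod_of_nonneg fun i _ => (scl_pos _ i).le]
        have : ∀ i : Fin d, ENNReal.ofReal (crn lo a i + 4 * scl (lo + a.1) i - (crn lo a i - 4 * scl (lo + a.1) i))
            = 8 * ENNReal.ofReal (scl (lo + a.1) i) := by
          intro i
          rw [show (8:ℝ≥0∞) = ENNReal.ofReal 8 by simp, ← ENNReal.ofReal_mul (by norm_num)]
          congr 1; ring
        simp_rw [this, Finset.prod_mul_distrib]; simp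
      obtain ⟨y, rfl, hy⟩ := ha
      rw [hv, mul_assoc]
      gcongr
      unfold bad at hy
      rw [hκd, fiber_eq, ← ENNReal.div_eq_inv_mul, ENNReal.le_div_iff_mul_le (Or.inl h0) (Or.inl htop), mul_comm]
      exact hy.le
    · have : Om a = ∅ := by ext x; simp [hOm, ha]
      simp [this]
  set O := ⋃ a, Om a with hO
  have hOv : volume O ≤ 8 ^ d * lam⁻¹ * ∫⁻ x, u x := by
    refine (measure_iUnion_le _).trans ((ENNReal.tsum_le_tsum hOmv).trans (le_of_eq ?_))
    rw [ENNReal.tsum_mul_left, ← lint_fib hκ]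
  have hOmm : MeasurableSet O := by
    refine MeasurableSet.iUnion fun a => ?_
    by_cases ha : isb a
    · simp only [hOm, ha, true_and]
      have : {x : V d | ∀ i, |x i - crn lo a i| ≤ 4 * scl (lo + a.1) i} =
        ⋂ i, {x : V d | |x i - crn lo a i| ≤ 4 * scl (lo + a.1) i} := by ext x; simp
      rw [this]
      exact MeasurableSet.iInter fun i => measurableSet_le (by fun_prop) measurable_const
    · have : Om a = ∅ := by ext x; simp [hOm, ha]
      simp [this]
  have hker : ∀ y, ∫⁻ x in Oᶜ, ‖k (x - y) - k (x - c y)‖ₑ ≤ H + 1 := by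
    intro y
    by_cases hy : bad u lam lo (stp u lam lo N y) y
    · refine le_trans (lintegral_mono_set fun x hx => ?_)
        ((hk.hor (lo + stp u lam lo N y) y (c y) (crn_close u lam lo N y)).trans le_self_add)
      by_contra hcon
      refine hx (Set.mem_iUnion.2 ⟨κ y, ⟨y, rfl, hy⟩, fun i => ?_⟩)
      by_contra hi
      exact hcon ⟨i, not_le.1 hi⟩
    · have hs : stp u lam lo N y = 0 := by
        by_contra h
        exact hy (bad_of_pos u lam lo N y h)
      refine (setLIntegral_le_lintegral _ _).trans ((hlo y (c y) fun i => ?_).trans le_add_self)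
      have := crn_close u lam lo N y i
      rwa [hs, Nat.cast_zero, add_zero] at this
  have hTbint : ∫⁻ x in Oᶜ, ‖cv k b x‖ₑ ≤ (H + 1) * (2 * ∫⁻ x, u x) := by
    calc ∫⁻ x in Oᶜ, ‖cv k b x‖ₑ ≤ ∫⁻ x in Oᶜ, ∫⁻ y, ‖k (x - y) - k (x - c y)‖ₑ * ‖b y‖ₑ := by
          refine lintegral_mono fun x => ?_
          rw [hTb x]
          refine (enorm_integral_le_lintegral_enorm _).trans (lintegral_mono fun y => ?_)
          exact ContinuousLinearMap.le_opENorm _ _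
      _ = ∫⁻ y, ∫⁻ x in Oᶜ, ‖k (x - y) - k (x - c y)‖ₑ * ‖b y‖ₑ := by
          refine lintegral_lintegral_swap (Measurable.aemeasurable ?_)
          refine Measurable.mul (StronglyMeasurable.enorm ?_) (StronglyMeasurable.enorm ?_)
          · exact (hk.nice.sm.comp_measurable (g := fun p : V d × V d => p.1 - p.2) (by fun_prop)).sub
              (hk.nice.sm.comp_measurable (g := fun p : V d × V d => p.1 - c p.2) (by fun_prop))
          · exact hbn.sm.comp_measurable (by fun_prop)
      _ ≤ ∫⁻ y, (H + 1) * ‖b y‖ₑ := by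
          refine lintegral_mono fun y => ?_
          rw [lintegral_mul_const' _ _ (by simp)]
          gcongr
          exact hker y
      _ = (H + 1) * ∫⁻ y, ‖b y‖ₑ := lintegral_const_mul _ hbn.sm.enorm
      _ ≤ _ := by gcongr
  have hTg : ∫⁻ x, ‖cv k g x‖ₑ ^ 2 ≤ A * (lam * ENNReal.ofReal (vl d 1) * ∫⁻ x, u x) := by
    refine (hk.l2 g hgn).trans ?_
    gcongr
    calc ∫⁻ x, ‖g x‖ₑ ^ 2 ≤ ∫⁻ x, lam * ENNReal.ofReal (vl d 1) * ‖g x‖ₑ := by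
          refine lintegral_mono fun x => ?_
          rw [sq]; gcongr; exact hgsup x
      _ = lam * ENNReal.ofReal (vl d 1) * ∫⁻ x, ‖g x‖ₑ := lintegral_const_mul _ hgn.sm.enorm
      _ ≤ _ := by gcongr
  have hsub : {x | lam < ‖cv k f x‖ₑ} ⊆ {x | (lam / 2) ^ 2 ≤ ‖cv k g x‖ₑ ^ 2} ∪
      (O ∪ {x | lam / 2 ≤ Oᶜ.indicator (fun x => ‖cv k b x‖ₑ) x}) := by
    intro x hx
    by_contra hcon
    simp only [Set.mem_union, Set.mem_ofPred_eq, not_or, not_le] at hcon hx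
    obtain ⟨h1, h2, h3⟩ := hcon
    rw [Set.indicator_of_mem (by exact h2)] at h3
    have h1' : ‖cv k g x‖ₑ < lam / 2 := lt_of_pow_lt_pow_left' 2 h1
    have h4 : cv k f x = cv k b x + cv k g x := by
      rw [← cv_add hk.nice hbn hgn]; simp [hb]
    rw [h4] at hx
    have := (hx.trans_le (enorm_add_le _ _)).trans (ENNReal.add_lt_add h3 h1')
    rw [ENNReal.add_halves] at this
    exact lt_irrefl _ this
  have hl2 : lam / 2 ≠ 0 := by simp [h0]
  have hl2t : lam / 2 ≠ ∞ := ENNReal.div_ne_top htop (by simp)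
  have hlinv : (lam / 2)⁻¹ = 2 * lam⁻¹ := by
    rw [ENNReal.inv_div (by simp) (by simp), div_eq_mul_inv]
  have hll : lam⁻¹ * lam = 1 := ENNReal.inv_mul_cancel h0 htop
  have hA1 : volume {x | (lam / 2) ^ 2 ≤ ‖cv k g x‖ₑ ^ 2} ≤
      4 * A * ENNReal.ofReal (vl d 1) * lam⁻¹ * ∫⁻ x, u x := by
    refine (meas_ge_le_lintegral_div ((cv_sm hk.nice hgn.sm).enorm.pow_const 2).aemeasurable
      (pow_ne_zero _ hl2) (ENNReal.pow_ne_top hl2t)).trans ?_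
    rw [div_eq_mul_inv, ENNReal.inv_pow, hlinv]
    calc _ ≤ A * (lam * ENNReal.ofReal (vl d 1) * ∫⁻ x, u x) * (2 * lam⁻¹) ^ 2 := by gcongr
      _ = 4 * A * ENNReal.ofReal (vl d 1) * lam⁻¹ * (∫⁻ x, u x) * (lam⁻¹ * lam) := by ring
      _ = _ := by rw [hll, mul_one]
  have hA2 : volume {x | lam / 2 ≤ Oᶜ.indicator (fun x => ‖cv k b x‖ₑ) x} ≤
      4 * (H + 1) * lam⁻¹ * ∫⁻ x, u x := by
    refine (meas_ge_le_lintegral_div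
      ((cv_sm hk.nice hbn.sm).enorm.indicator hOmm.compl).aemeasurable hl2 hl2t).trans ?_
    rw [lintegral_indicator hOmm.compl, div_eq_mul_inv, hlinv]
    calc _ ≤ (H + 1) * (2 * ∫⁻ x, u x) * (2 * lam⁻¹) := by gcongr
      _ = _ := by ring
  calc _ ≤ _ := measure_mono hsub
    _ ≤ _ := measure_union_le _ _
    _ ≤ _ := add_le_add hA1 ((measure_union_le _ _).trans (add_le_add hOv hA2))
    _ = _ := by ring

end
end Radon

namespace Radon
open MeasureTheory

lemma lint_pow_low {q b : ℝ} (hq : -1 < q) (hb : 0 ≤ b) :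
    ∫⁻ t in Set.Ioc 0 b, ENNReal.ofReal (t ^ q) = ENNReal.ofReal (b ^ (q + 1) / (q + 1)) := by
  rw [← ofReal_integral_eq_lintegral_ofReal]
  · rw [← intervalIntegral.integral_of_le hb, integral_rpow (Or.inl hq), Real.zero_rpow (by linarith), sub_zero]
  · exact (intervalIntegral.intervalIntegrable_rpow' hq).1
  · filter_upwards [ae_restrict_mem measurableSet_Ioc] with t ht
    exact Real.rpow_nonneg ht.1.le _

lemma lint_pow_high {q b : ℝ} (hq : q < -1) (hb : 0 < b) :
    ∫⁻ t in Set.Ioi b, ENNReal.ofReal (t ^ q) = ENNReal.ofReal (b ^ (q + 1) / (-(q + 1))) := by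
  rw [← ofReal_integral_eq_lintegral_ofReal]
  · rw [integral_Ioi_rpow_of_lt hq hb, neg_div, div_neg]
  · exact integrableOn_Ioi_rpow_of_lt hq hb
  · filter_upwards [ae_restrict_mem measurableSet_Ioi] with t ht
    exact Real.rpow_nonneg (hb.le.trans (le_of_lt ht)) _

section
variable {d : ℕ} {E F : Type*} [NormedAddCommGroup E] [NormedSpace ℝ E] [CompleteSpace E]
  [NormedAddCommGroup F] [NormedSpace ℝ F] [CompleteSpace F] {k : V d → E →L[ℝ] F}

lemma Nice.indicator {f : V d → E} (hf : Nice f) {s : Set (V d)} (hs : MeasurableSet s) : Nice (s.indicator f) := by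
  refine ⟨hf.sm.indicator hs, hf.int.indicator hs, ?_⟩
  obtain ⟨B, hB⟩ := hf.bd
  exact ⟨B, fun x => (norm_indicator_le_norm_self _ _).trans (hB x)⟩

/-- abstract Marcinkiewicz from a distributional bound -/
lemma marc {α : Type*} [MeasurableSpace α] {μ : Measure α} [SFinite μ] {v w : α → ℝ} (hv : Measurable v)
    (hw : Measurable w) (hv0 : ∀ x, 0 ≤ v x) (hw0 : ∀ x, 0 ≤ w x) {p a : ℝ} (hp1 : 1 < p) (hp2 : p < 2)
    (ha : 0 < a) (C A : ℝ) (hC : 0 ≤ C) (hA : 0 ≤ A)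
    (h : ∀ t : ℝ, 0 < t → μ {x | t < v x} ≤
      ENNReal.ofReal (C / t) * ∫⁻ x in {x | a * t < w x}, ENNReal.ofReal (w x) ∂μ +
      ENNReal.ofReal (A / t ^ 2) * ∫⁻ x in {x | w x ≤ a * t}, ENNReal.ofReal (w x ^ 2) ∂μ) :
    ∫⁻ x, ENNReal.ofReal (v x ^ p) ∂μ ≤
      ENNReal.ofReal (p * (C * a ^ (1 - p) / (p - 1) + A * a ^ (2 - p) / (2 - p))) *
        ∫⁻ x, ENNReal.ofReal (w x ^ p) ∂μ := by
  rw [lintegral_rpow_eq_lintegral_meas_lt_mul μ (ae_of_all _ hv0) hv.aemeasurable (by linarith)]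
  have hms1 : MeasurableSet {q : ℝ × α | a * q.1 < w q.2} :=
    measurableSet_lt (by fun_prop) (by fun_prop)
  have hms2 : MeasurableSet {q : ℝ × α | w q.2 ≤ a * q.1} :=
    measurableSet_le (by fun_prop) (by fun_prop)
  set G1 : ℝ → α → ℝ≥0∞ := fun t x =>
    {q : ℝ × α | a * q.1 < w q.2}.indicator (fun q => ENNReal.ofReal (C * q.1 ^ (p - 2)) * ENNReal.ofReal (w q.2)) (t, x) with hG1
  set G2 : ℝ → α → ℝ≥0∞ := fun t x =>
    {q : ℝ × α | w q.2 ≤ a * q.1}.indicator (fun q => ENNReal.ofReal (A * q.1 ^ (p - 3)) * ENNReal.ofReal (w q.2 ^ 2)) (t, x) with hG2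
  have hG1m : Measurable (Function.uncurry G1) := by
    refine Measurable.indicator ?_ hms1
    fun_prop
  have hG2m : Measurable (Function.uncurry G2) := by
    refine Measurable.indicator ?_ hms2
    fun_prop
  have hstep : ∫⁻ t in Set.Ioi (0:ℝ), μ {x | t < v x} * ENNReal.ofReal (t ^ (p - 1)) ≤
      ∫⁻ t in Set.Ioi (0:ℝ), ∫⁻ x, (G1 t x + G2 t x) ∂μ := by
    refine setLIntegral_mono' measurableSet_Ioi fun t ht => ?_
    have ht' : 0 < t := ht
    have e1 : ∫⁻ x, G1 t x ∂μ = ENNReal.ofReal (C * t ^ (p - 2)) * ∫⁻ x in {x | a * t < w x}, ENNReal.ofReal (w x) ∂μ := by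
      rw [← lintegral_const_mul _ (by fun_prop), ← lintegral_indicator (measurableSet_lt (by fun_prop) hw)]
      rfl
    have e2 : ∫⁻ x, G2 t x ∂μ = ENNReal.ofReal (A * t ^ (p - 3)) * ∫⁻ x in {x | w x ≤ a * t}, ENNReal.ofReal (w x ^ 2) ∂μ := by
      rw [← lintegral_const_mul _ (by fun_prop), ← lintegral_indicator (measurableSet_le hw (by fun_prop))]
      rfl
    rw [lintegral_add_left (by exact hG1m.comp measurable_prodMk_left), e1, e2]
    refine (mul_le_mul_left (h t ht) _).trans (le_of_eq ?_)
    rw [add_mul, mul_right_comm, mul_right_comm (ENNReal.ofReal (A / t ^ 2)),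
      ← ENNReal.ofReal_mul (by positivity), ← ENNReal.ofReal_mul (by positivity)]
    congr 3
    · have : t ^ (p - 2) = t ^ (p - 1) / t := by
        rw [← Real.rpow_sub_one ht'.ne']; congr 1; ring
      rw [this]; ring
    · have : t ^ (p - 3) = t ^ (p - 1) / t ^ 2 := by
        rw [← Real.rpow_sub_natCast ht'.ne']; congr 1; push_cast; ring
      rw [this]; ring
  have hx : ∀ x, ∫⁻ t in Set.Ioi (0:ℝ), (G1 t x + G2 t x) ≤
      ENNReal.ofReal (C * a ^ (1 - p) / (p - 1) + A * a ^ (2 - p) / (2 - p)) * ENNReal.ofReal (w x ^ p) := by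
    intro x
    rcases (hw0 x).eq_or_lt with hwx | hwx
    · have : ∀ t, G1 t x + G2 t x = 0 := by
        intro t
        simp only [hG1, hG2, Set.indicator_apply, ← hwx]; simp
      simp [this]
    have b1 : ∫⁻ t in Set.Ioi (0:ℝ), G1 t x ≤ ENNReal.ofReal (C * (w x) * ((w x / a) ^ (p - 2 + 1) / (p - 2 + 1))) := by
      rw [ENNReal.ofReal_mul (by positivity), ← lint_pow_low (by linarith) (by positivity),
        ← lintegral_const_mul _ (by fun_prop), ← lintegral_indicator measurableSet_Ioi, ← lintegral_indicator measurableSet_Ioc]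
      refine lintegral_mono fun t => ?_
      simp only [Set.indicator_apply, hG1, Set.mem_Ioi, Set.mem_Ioc, Set.mem_ofPred_eq]
      by_cases h1 : 0 < t
      · by_cases h2 : a * t < w x
        · have h3 : t ≤ w x / a := by rw [le_div_iff₀ ha]; linarith
          simp only [h1, h2, h3, if_true, true_and]
          rw [← ENNReal.ofReal_mul (by positivity), ← ENNReal.ofReal_mul (by positivity)]
          apply le_of_eq; congr 1; ring
        · simp [h2]
      · simp [h1]
    have b2 : ∫⁻ t in Set.Ioi (0:ℝ), G2 t x ≤ ENNReal.ofReal (A * (w x) ^ 2 * ((w x / a) ^ (p - 3 + 1) / (-(p - 3 + 1)))) := by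
      rw [ENNReal.ofReal_mul (by positivity), ← lint_pow_high (by linarith) (by positivity),
        ← lintegral_const_mul _ (by fun_prop), restrict_Ioi_eq_restrict_Ici (μ := volume) (a := w x / a), ← lintegral_indicator measurableSet_Ioi, ← lintegral_indicator measurableSet_Ici]
      refine lintegral_mono fun t => ?_
      simp only [Set.indicator_apply, hG2, Set.mem_Ioi, Set.mem_Ici, Set.mem_ofPred_eq]
      by_cases h1 : 0 < t
      · by_cases h2 : w x ≤ a * t
        · have h3 : w x / a ≤ t := by rw [div_le_iff₀ ha]; linarith
          simp only [h1, h2, h3, if_true]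
          rw [← ENNReal.ofReal_mul (by positivity), ← ENNReal.ofReal_mul (by positivity)]
          apply le_of_eq; congr 1; ring
        · simp [h2]
      · simp [h1]
    rw [lintegral_add_left (by exact hG1m.comp measurable_prodMk_right)]
    refine (add_le_add b1 b2).trans (le_of_eq ?_)
    have q1 : 0 < p - 2 + 1 := by linarith
    have q2 : 0 < -(p - 3 + 1) := by linarith
    have q3 : 0 < p - 1 := by linarith
    have q4 : 0 < 2 - p := by linarith
    rw [← ENNReal.ofReal_add (by positivity) (by positivity), ← ENNReal.ofReal_mul (by positivity)]
    congr 1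
    have r1 : (w x / a) ^ (p - 2 + 1) = w x ^ p / w x * a ^ (1 - p) := by
      rw [Real.div_rpow hwx.le ha.le, show p - 2 + 1 = p - 1 by ring, Real.rpow_sub_one hwx.ne',
        show (1 - p) = -(p - 1) by ring, Real.rpow_neg ha.le]; rfl
    have r2 : (w x / a) ^ (p - 3 + 1) = w x ^ p / w x ^ 2 * a ^ (2 - p) := by
      rw [Real.div_rpow hwx.le ha.le, show p - 3 + 1 = p - (2:ℕ) by push_cast; ring, Real.rpow_sub_natCast hwx.ne',
        show (2 - p) = -(p - (2:ℕ)) by push_cast; ring, Real.rpow_neg ha.le]; rfl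
    rw [r1, r2, show p - 2 + 1 = p - 1 by ring, show -(p - 3 + 1) = 2 - p by ring]
    field_simp
  have hswap : ∫⁻ t in Set.Ioi (0:ℝ), ∫⁻ x, (G1 t x + G2 t x) ∂μ = ∫⁻ x, (∫⁻ t in Set.Ioi (0:ℝ), (G1 t x + G2 t x)) ∂μ :=
    lintegral_lintegral_swap (by exact (hG1m.add hG2m).aemeasurable)
  rw [hswap] at hstep
  rw [ENNReal.ofReal_mul (by linarith), mul_assoc]
  refine mul_le_mul_right (hstep.trans ?_) _
  rw [← lintegral_const_mul _ (by fun_prop)]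
  exact lintegral_mono hx


/-- constant in the Marcinkiewicz interpolation -/
def cm (d : ℕ) (p : ℝ) : ℝ := 2 ^ p * (p * ((4 * vl d 1 + 8 ^ d + 4) / (p - 1) + 1 / (2 - p)))

theorem strongp (hd : 0 < d) {a h p : ℝ} (ha : 0 < a) (hh : 0 ≤ h) (hp1 : 1 < p) (hp2 : p < 2)
    (hk : KerOK k (ENNReal.ofReal a) (ENNReal.ofReal h)) {f : V d → E} (hf : Nice f) :
    ∫⁻ x, ENNReal.ofReal (‖cv k f x‖ ^ p) ≤
      ENNReal.ofReal (cm d p * (1 + a + h) * a ^ (p - 1)) * ∫⁻ x, ENNReal.ofReal (‖f x‖ ^ p) := by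
  set C : ℝ := 4 * a * vl d 1 + 8 ^ d + 4 * (h + 1) with hC
  have hvl := vl_pos d 1
  have hC0 : 0 ≤ C := by positivity
  have hCe : ENNReal.ofReal C = 4 * ENNReal.ofReal a * ENNReal.ofReal (vl d 1) + 8 ^ d + 4 * (ENNReal.ofReal h + 1) := by
    rw [hC, ENNReal.ofReal_add (by positivity) (by positivity), ENNReal.ofReal_add (by positivity) (by positivity),
      ENNReal.ofReal_mul (by positivity), ENNReal.ofReal_mul (by positivity), ENNReal.ofReal_mul (by positivity),
      ENNReal.ofReal_add (by positivity) (by positivity), ENNReal.ofReal_pow (by positivity)]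
    simp
  have key := marc (μ := volume) (v := fun x => ‖cv k f x‖ / 2) (w := fun x => ‖f x‖)
    ((cv_sm hk.nice hf.sm).norm.measurable.div_const 2) hf.sm.norm.measurable (fun x => by positivity) (fun x => by positivity)
    hp1 hp2 (inv_pos.2 ha) C a hC0 ha.le ?_
  · have e : ∫⁻ x, ENNReal.ofReal (‖cv k f x‖ ^ p) = ENNReal.ofReal (2 ^ p) * ∫⁻ x, ENNReal.ofReal ((‖cv k f x‖ / 2) ^ p) := by
      rw [← lintegral_const_mul']
      · refine lintegral_congr fun x => ?_
        rw [← ENNReal.ofReal_mul (by positivity), ← Real.mul_rpow (by positivity) (by positivity)]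
        congr 2; ring
      · exact ENNReal.ofReal_ne_top
    rw [e]
    refine (mul_le_mul_right key _).trans ?_
    rw [← mul_assoc, ← ENNReal.ofReal_mul (by positivity)]
    refine mul_le_mul_left (ENNReal.ofReal_le_ofReal ?_) _
    have q3 : 0 < p - 1 := by linarith
    have q4 : 0 < 2 - p := by linarith
    have r1 : a⁻¹ ^ (1 - p) = a ^ (p - 1) := by
      rw [Real.inv_rpow ha.le, ← Real.rpow_neg ha.le]; congr 1; ring
    have r2 : a * a⁻¹ ^ (2 - p) = a ^ (p - 1) := by
      rw [Real.inv_rpow ha.le, ← Real.rpow_neg ha.le]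
      nth_rewrite 1 [← Real.rpow_one a]
      rw [← Real.rpow_add ha]; congr 1; ring
    rw [r1, r2, cm]
    have hapos : 0 < a ^ (p - 1) := by positivity
    have h8 : (0:ℝ) < 8 ^ d := by positivity
    have hCle : C ≤ (4 * vl d 1 + 8 ^ d + 4) * (1 + a + h) := by
      rw [hC]; nlinarith [mul_nonneg hvl.le hh, mul_nonneg h8.le hh, mul_nonneg h8.le ha.le]
    calc 2 ^ p * (p * (C * a ^ (p - 1) / (p - 1) + a ^ (p - 1) / (2 - p)))
        ≤ 2 ^ p * (p * ((4 * vl d 1 + 8 ^ d + 4) * (1 + a + h) * a ^ (p - 1) / (p - 1) + (1 + a + h) * a ^ (p - 1) / (2 - p))) := by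
          gcongr
          nlinarith
      _ = _ := by ring
  · intro t ht
    have hms : MeasurableSet {x | a⁻¹ * t < ‖f x‖} := measurableSet_lt (by fun_prop) hf.sm.norm.measurable
    have hms' : MeasurableSet {x | ‖f x‖ ≤ a⁻¹ * t} := measurableSet_le hf.sm.norm.measurable (by fun_prop)
    set fh := {x | a⁻¹ * t < ‖f x‖}.indicator f with hfh
    set fl := {x | ‖f x‖ ≤ a⁻¹ * t}.indicator f with hfl
    have nh : Nice fh := hf.indicator hms
    have nl : Nice fl := hf.indicator hms'
    have hsum : f = fun x => fh x + fl x := by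
      funext x
      by_cases hx : a⁻¹ * t < ‖f x‖
      · simp [hfh, hfl, hx, not_le.2 hx, Set.indicator_apply]
      · simp [hfh, hfl, hx, not_lt.1 hx, Set.indicator_apply]
    have hsub : {x | t < ‖cv k f x‖ / 2} ⊆ {x | ENNReal.ofReal t < ‖cv k fh x‖ₑ} ∪ {x | ENNReal.ofReal t ^ 2 ≤ ‖cv k fl x‖ₑ ^ 2} := by
      intro x hx
      by_contra hcon
      simp only [Set.mem_union, Set.mem_ofPred_eq, not_or, not_le, not_lt] at hcon hx
      obtain ⟨h1, h2⟩ := hcon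
      have h2 := lt_of_pow_lt_pow_left' 2 h2
      rw [← ofReal_norm, ENNReal.ofReal_le_ofReal_iff ht.le] at h1
      rw [← ofReal_norm, ENNReal.ofReal_lt_ofReal_iff ht] at h2
      have h4 : cv k f x = cv k fh x + cv k fl x := by
        rw [← cv_add hk.nice nh nl, ← hsum]
      rw [h4] at hx
      linarith [norm_add_le (cv k fh x) (cv k fl x)]
    refine (measure_mono hsub).trans ((measure_union_le _ _).trans (add_le_add ?_ ?_))
    · refine (weak11 hd hk nh (by simpa using ht) ENNReal.ofReal_ne_top).trans (le_of_eq ?_)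
      rw [← hCe, ← ENNReal.ofReal_inv_of_pos ht, ← ENNReal.ofReal_mul hC0, div_eq_mul_inv,
        ← lintegral_indicator hms]
      congr 1
      refine lintegral_congr fun x => ?_
      simp only [hfh, Set.indicator_apply]
      split_ifs <;> simp
    · refine (meas_ge_le_lintegral_div ((cv_sm hk.nice nl.sm).enorm.pow_const 2).aemeasurable
        (pow_ne_zero _ (by simpa using ht)) (ENNReal.pow_ne_top ENNReal.ofReal_ne_top)).trans ?_
      rw [div_eq_mul_inv, ← ENNReal.ofReal_pow ht.le, ← ENNReal.ofReal_inv_of_pos (by positivity)]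
      refine (mul_le_mul_left (hk.l2 fl nl) _).trans (le_of_eq ?_)
      rw [mul_right_comm, ← ENNReal.ofReal_mul ha.le, div_eq_mul_inv, ← lintegral_indicator hms']
      congr 1
      refine lintegral_congr fun x => ?_
      simp only [hfl, Set.indicator_apply]
      split_ifs
      · rw [ENNReal.ofReal_pow (norm_nonneg _), ofReal_norm]
      · simp

end
end Radon

namespace Radon
open MeasureTheory

section gen
variable {α : Type*} [MeasurableSpace α] {μ : Measure α}

lemma cs {f g : α → ℝ≥0∞} (hf : AEMeasurable f μ) (hg : AEMeasurable g μ) :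
    (∫⁻ x, f x * g x ∂μ) ^ 2 ≤ (∫⁻ x, f x ^ 2 ∂μ) * ∫⁻ x, g x ^ 2 ∂μ := by
  have h := ENNReal.lintegral_mul_le_Lp_mul_Lq μ (Real.HolderConjugate.two_two) hf hg
  simp only [Pi.mul_apply, ENNReal.rpow_two] at h
  calc _ ≤ ((∫⁻ x, f x ^ 2 ∂μ) ^ (1 / 2 : ℝ) * (∫⁻ x, g x ^ 2 ∂μ) ^ (1 / 2 : ℝ)) ^ 2 := by gcongr
    _ = _ := by
      rw [mul_pow, ← ENNReal.rpow_two, ← ENNReal.rpow_two, ← ENNReal.rpow_mul, ← ENNReal.rpow_mul]; norm_num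

lemma jensen2 {w g : α → ℝ≥0∞} (hw : Measurable w) (hg : Measurable g) :
    (∫⁻ x, w x * g x ∂μ) ^ 2 ≤ (∫⁻ x, w x ∂μ) * ∫⁻ x, w x * g x ^ 2 ∂μ := by
  have h := cs (μ := μ.withDensity w) (f := fun _ => 1) (g := g) (by fun_prop) hg.aemeasurable
  rw [lintegral_withDensity_eq_lintegral_mul _ hw (by fun_prop), lintegral_withDensity_eq_lintegral_mul _ hw (by fun_prop),
    lintegral_withDensity_eq_lintegral_mul _ hw (by fun_prop)] at h
  simpa using h

/-- if `s ≤ c √s` with `s` finite then `s ≤ c²` -/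
lemma boot {s c : ℝ≥0∞} (hs : s ≠ ∞) (h : s ^ 2 ≤ c * s) : s ≤ c := by
  rcases eq_or_ne s 0 with rfl | h0
  · simp
  · rw [sq] at h
    exact (ENNReal.mul_le_mul_iff_left h0 hs).1 h

lemma meas_sup {ι : Type*} (S : Finset ι) (a : ι → α → ℝ≥0∞) (ha : ∀ i, Measurable (a i)) :
    Measurable fun x => S.sup fun i => a i x := by
  classical
  induction S using Finset.induction_on with
  | empty => simp
  | insert j S hj ih =>
    simp only [Finset.sup_insert]
    exact (ha j).sup ih

/-- measurable selection of weights realizing a finite maximum -/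
lemma selection {ι : Type*} (S : Finset ι) (a : ι → α → ℝ≥0∞) (ha : ∀ i, Measurable (a i)) :
    ∃ w : ι → α → ℝ≥0∞, (∀ i, Measurable (w i)) ∧ (∀ x, ∑ i ∈ S, w i x ≤ 1) ∧
      ∀ x, ∑ i ∈ S, w i x * a i x = S.sup fun i => a i x := by
  classical
  induction S using Finset.induction_on with
  | empty => exact ⟨fun _ _ => 0, by simp, by simp, by simp⟩
  | insert j S hj ih =>
    obtain ⟨w, hw, h1, h2⟩ := ih
    have hm := meas_sup S a ha
    obtain ⟨B, hB⟩ : ∃ B : Set α, B = {x | (S.sup fun i => a i x) ≤ a j x} := ⟨_, rfl⟩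
    have hms : MeasurableSet B := by rw [hB]; exact measurableSet_le hm (ha j)
    refine ⟨fun i => if i = j then B.indicator (fun _ => 1) else Bᶜ.indicator (w i), fun i => ?_, fun x => ?_, fun x => ?_⟩
    · dsimp only
      split_ifs
      · exact measurable_const.indicator hms
      · exact (hw i).indicator hms.compl
    all_goals
      rw [Finset.sum_insert hj]
      simp only [if_true]
    · rw [Finset.sum_congr rfl (g := fun i => Bᶜ.indicator (w i) x)
        fun i hi => by rw [if_neg]; rintro rfl; exact hj hi]
      by_cases hx : x ∈ B
      · simp [hx]
      · simpa [hx] using h1 x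
    · rw [Finset.sum_congr rfl (g := fun i => Bᶜ.indicator (w i) x * a i x)
        fun i hi => by rw [if_neg]; rintro rfl; exact hj hi]
      rw [Finset.sup_insert]
      by_cases hx : x ∈ B
      · have hx' : (S.sup fun i => a i x) ≤ a j x := by rw [hB] at hx; exact hx
        simp only [Set.indicator_of_mem hx, Set.indicator_of_notMem (s := Bᶜ) (by simpa using hx), one_mul, zero_mul, Finset.sum_const_zero, add_zero]
        exact (sup_eq_left.2 hx').symm
      · have hx' : ¬ (S.sup fun i => a i x) ≤ a j x := by rw [hB] at hx; exact hx
        simp only [Set.indicator_of_notMem hx, Set.indicator_of_mem (s := Bᶜ) (by simpa using hx), h2, zero_mul, zero_add]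
        exact (sup_eq_right.2 (not_le.1 hx').le).symm
end gen

section q
variable {d : ℕ}

def q (m : ℤ) (x : V d) : ℝ≥0∞ :=
  {x : V d | ∀ i, |x i| ≤ 2 * scl m i}.indicator (fun _ => (ENNReal.ofReal (vl d m))⁻¹) x

def cq (m : ℤ) (g : V d → ℝ≥0∞) (x : V d) : ℝ≥0∞ := ∫⁻ y, q m (x - y) * g y

lemma q_set_meas (m : ℤ) : MeasurableSet {x : V d | ∀ i, |x i| ≤ 2 * scl m i} := by
  have : {x : V d | ∀ i, |x i| ≤ 2 * scl m i} = ⋂ i, {x : V d | |x i| ≤ 2 * scl m i} := by ext x; simp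
  rw [this]
  exact MeasurableSet.iInter fun i => measurableSet_le (by fun_prop) measurable_const

@[fun_prop]
lemma q_meas (m : ℤ) : Measurable (q (d := d) m) := measurable_const.indicator (q_set_meas m)

lemma q_symm (m : ℤ) (x y : V d) : q m (x - y) = q m (y - x) := by
  have : ∀ i, |(x - y) i| = |(y - x) i| := fun i => by simp only [PiLp.sub_apply]; exact abs_sub_comm _ _
  simp only [q, Set.indicator_apply, Set.mem_ofPred_eq, this]

lemma lint_q (m : ℤ) : ∫⁻ x : V d, q m x = 4 ^ d := by
  unfold q
  rw [lintegral_indicator (q_set_meas m), setLIntegral_const]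
  have e : {x : V d | ∀ i, |x i| ≤ 2 * scl m i} = {x : V d | ∀ i, x i ∈ Set.Icc (- (2 * scl m i)) (2 * scl m i)} := by
    ext x; simp only [Set.mem_ofPred_eq, abs_le, Set.mem_Icc]
  rw [e, volume_boxc, vl, ENNReal.ofReal_prod_of_nonneg fun i _ => (scl_pos _ i).le]
  have : ∀ i : Fin d, ENNReal.ofReal (2 * scl m i - -(2 * scl m i)) = 4 * ENNReal.ofReal (scl m i) := by
    intro i
    rw [show (4:ℝ≥0∞) = ENNReal.ofReal 4 by simp, ← ENNReal.ofReal_mul (by norm_num)]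
    congr 1; ring
  simp_rw [this, Finset.prod_mul_distrib]
  rw [mul_comm, mul_assoc, ENNReal.mul_inv_cancel]
  · simp
  · exact Finset.prod_ne_zero_iff.2 fun i _ => by simpa using scl_pos m i
  · exact ENNReal.prod_ne_top fun i _ => ENNReal.ofReal_ne_top

lemma lint_q_left (m : ℤ) (x : V d) : ∫⁻ y : V d, q m (x - y) = 4 ^ d := by
  rw [lintegral_sub_left_eq_self (fun y => q m y), lint_q]

lemma lint_q_right (m : ℤ) (y : V d) : ∫⁻ x : V d, q m (x - y) = 4 ^ d := by
  rw [lintegral_sub_right_eq_self (fun y => q m y), lint_q]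

@[fun_prop]
lemma cq_meas (m : ℤ) {g : V d → ℝ≥0∞} (hg : Measurable g) : Measurable (cq m g) := by
  unfold cq
  exact Measurable.lintegral_prod_right' (f := fun p : V d × V d => q m (p.1 - p.2) * g p.2) (by fun_prop)

lemma cq_adj (m : ℤ) {g h : V d → ℝ≥0∞} (hg : Measurable g) (hh : Measurable h) :
    ∫⁻ x, cq m g x * h x = ∫⁻ x, g x * cq m h x := by
  have e1 : ∀ x, cq m g x * h x = ∫⁻ y, q m (x - y) * g y * h x := by
    intro x; unfold cq; rw [lintegral_mul_const _ (by fun_prop)]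
  have e2 : ∀ y, g y * cq m h y = ∫⁻ x, q m (x - y) * g y * h x := by
    intro y; unfold cq; rw [← lintegral_const_mul _ (by fun_prop)]
    refine lintegral_congr fun x => ?_
    rw [q_symm]; ring
  simp_rw [e1, e2]
  exact lintegral_lintegral_swap (by exact Measurable.aemeasurable (by fun_prop))

lemma cq_sq (m : ℤ) {g : V d → ℝ≥0∞} (hg : Measurable g) (x : V d) :
    cq m g x ^ 2 ≤ 4 ^ d * cq m (fun y => g y ^ 2) x := by
  have := jensen2 (μ := volume) (w := fun y => q m (x - y)) (g := g) (by fun_prop) hg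
  rwa [lint_q_left] at this

lemma cq_l2 (m : ℤ) {g : V d → ℝ≥0∞} (hg : Measurable g) :
    ∫⁻ x, cq m g x ^ 2 ≤ 4 ^ d * 4 ^ d * ∫⁻ x, g x ^ 2 := by
  calc _ ≤ ∫⁻ x, 4 ^ d * (cq m (fun y => g y ^ 2) x * 1) := lintegral_mono fun x => by rw [mul_one]; exact cq_sq m hg x
    _ = 4 ^ d * ∫⁻ x, g x ^ 2 * cq m (fun _ => 1) x := by
      rw [lintegral_const_mul _ (by fun_prop), cq_adj m (by fun_prop) (by fun_prop)]
    _ = 4 ^ d * ∫⁻ x, g x ^ 2 * 4 ^ d := by simp only [cq, mul_one, lint_q_left]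
    _ = _ := by rw [lintegral_mul_const _ (by fun_prop)]; ring

lemma cq_comp {n m : ℤ} (hnm : n ≤ m) {h : V d → ℝ≥0∞} (hh : Measurable h) (x : V d) :
    cq n (cq m h) x ≤ 4 ^ d * ENNReal.ofReal (vl d 1) * cq (m + 1) h x := by
  have hv1 : ENNReal.ofReal (vl d 1) ≠ 0 := by simpa using vl_pos d 1
  have key : ∀ y z : V d, q n (x - y) * q m (y - z) ≤ q n (x - y) * (ENNReal.ofReal (vl d 1) * q (m + 1) (x - z)) := by
    intro y z
    by_cases h1 : ∀ i, |(x - y) i| ≤ 2 * scl n i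
    · by_cases h2 : ∀ i, |(y - z) i| ≤ 2 * scl m i
      · have h3 : ∀ i, |(x - z) i| ≤ 2 * scl (m + 1) i := by
          intro i
          have e : (x - z) i = (x - y) i + (y - z) i := by simp
          have s1 := scl_mono hnm i
          have s2 : 2 * scl m i ≤ scl (m + 1) i := by
            rw [scl_add, scl_one]
            have : (2:ℝ) ≤ ((2 ^ ((i:ℕ) + 1) : ℕ) : ℝ) := by
              exact_mod_cast Nat.le_self_pow (by omega) 2
            nlinarith [scl_pos m i]
          rw [e]
          refine (abs_add_le _ _).trans ?_
          linarith [h1 i, h2 i]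
        have e2 : q m (y - z) = (ENNReal.ofReal (vl d m))⁻¹ :=
          Set.indicator_of_mem (s := {x : V d | ∀ i, |x i| ≤ 2 * scl m i}) (by exact h2) _
        have e3 : q (m + 1) (x - z) = (ENNReal.ofReal (vl d (m + 1)))⁻¹ :=
          Set.indicator_of_mem (s := {x : V d | ∀ i, |x i| ≤ 2 * scl (m + 1) i}) (by exact h3) _
        rw [e2, e3, vl_add, ENNReal.ofReal_mul (vl_pos _ _).le,
          ENNReal.mul_inv (Or.inr ENNReal.ofReal_ne_top) (Or.inr hv1),
          mul_comm _ (ENNReal.ofReal (vl d 1))⁻¹, ← mul_assoc (ENNReal.ofReal (vl d 1)), ENNReal.mul_inv_cancel hv1 ENNReal.ofReal_ne_top, one_mul]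
      · have : q m (y - z) = 0 := Set.indicator_of_notMem (s := {x : V d | ∀ i, |x i| ≤ 2 * scl m i}) (by exact h2) _
        simp [this]
    · have : q n (x - y) = 0 := Set.indicator_of_notMem (s := {x : V d | ∀ i, |x i| ≤ 2 * scl n i}) (by exact h1) _
      simp [this]
  calc cq n (cq m h) x = ∫⁻ y, ∫⁻ z, q n (x - y) * q m (y - z) * h z := by
        unfold cq
        refine lintegral_congr fun y => ?_
        rw [← lintegral_const_mul _ (by fun_prop)]
        simp only [mul_assoc]
    _ ≤ ∫⁻ y, ∫⁻ z, q n (x - y) * (ENNReal.ofReal (vl d 1) * q (m + 1) (x - z)) * h z :=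
        lintegral_mono fun y => lintegral_mono fun z => mul_le_mul_left (key y z) _
    _ = ∫⁻ y, q n (x - y) * (ENNReal.ofReal (vl d 1) * cq (m + 1) h x) := by
        refine lintegral_congr fun y => ?_
        unfold cq
        rw [← lintegral_const_mul _ (by fun_prop), ← lintegral_const_mul _ (by fun_prop)]
        simp only [mul_assoc]
    _ = _ := by rw [lintegral_mul_const _ (by fun_prop), lint_q_left]; ring

def cqc (d : ℕ) : ℝ≥0∞ := 4 * (4 ^ d * ENNReal.ofReal (vl d 1)) ^ 2

lemma q_dual (S : Finset ℤ) (g : ℤ → V d → ℝ≥0∞) (hg : ∀ n, Measurable (g n))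
    (hfin : ∫⁻ x, (∑ n ∈ S, g n x) ^ 2 ≠ ∞) :
    ∫⁻ x, (∑ n ∈ S, cq n (g n) x) ^ 2 ≤ cqc d * ∫⁻ x, (∑ n ∈ S, g n x) ^ 2 := by
  set G := ∫⁻ x, (∑ n ∈ S, g n x) ^ 2 with hG
  set c : ℝ≥0∞ := 4 ^ d * ENNReal.ofReal (vl d 1) with hc
  set a : ℤ → ℝ≥0∞ := fun k => ∫⁻ x, (∑ n ∈ S, cq (n + k) (g n) x) ^ 2 with ha
  have hstep : ∀ k, a k ^ 2 ≤ cqc d * G * a (k + 1) := by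
    intro k
    have h1 : a k ≤ 2 * c * ∫⁻ x, (∑ n ∈ S, g n x) * (∑ m ∈ S, cq (m + (k + 1)) (g m) x) := by
      have hpt : ∀ x, (∑ n ∈ S, cq (n + k) (g n) x) ^ 2 ≤
          2 * ∑ n ∈ S, ∑ m ∈ S, if n ≤ m then cq (n + k) (g n) x * cq (m + k) (g m) x else 0 := by
        intro x
        have e : (∑ n ∈ S, cq (n + k) (g n) x) ^ 2 = ∑ n ∈ S, ∑ m ∈ S, cq (n + k) (g n) x * cq (m + k) (g m) x := by
          rw [sq, Finset.sum_mul_sum]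
        rw [e, two_mul]
        nth_rewrite 3 [Finset.sum_comm]
        rw [← Finset.sum_add_distrib]
        refine Finset.sum_le_sum fun n _ => ?_
        rw [← Finset.sum_add_distrib]
        refine Finset.sum_le_sum fun m _ => ?_
        rcases le_total n m with h | h
        · rw [if_pos h]; exact le_self_add
        · rw [if_pos h, mul_comm]; exact le_add_self
      calc a k ≤ ∫⁻ x, 2 * ∑ n ∈ S, ∑ m ∈ S, if n ≤ m then cq (n + k) (g n) x * cq (m + k) (g m) x else 0 :=
            lintegral_mono hpt
        _ = 2 * ∑ n ∈ S, ∑ m ∈ S, ∫⁻ x, if n ≤ m then cq (n + k) (g n) x * cq (m + k) (g m) x else 0 := by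
            have hmm : ∀ n m, Measurable fun x => if n ≤ m then cq (n + k) (g n) x * cq (m + k) (g m) x else 0 := by
              intro n m
              split_ifs
              · exact (cq_meas _ (hg n)).mul (cq_meas _ (hg m))
              · fun_prop
            rw [lintegral_const_mul _ (Finset.measurable_fun_sum _ fun n _ => Finset.measurable_fun_sum _ fun m _ => hmm n m),
              lintegral_finsetSum _ fun n _ => Finset.measurable_fun_sum _ fun m _ => hmm n m]
            simp_rw [lintegral_finsetSum S fun m _ => hmm _ m]
        _ ≤ 2 * ∑ n ∈ S, ∑ m ∈ S, ∫⁻ x, c * (g n x * cq (m + (k + 1)) (g m) x) := by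
            refine mul_le_mul_right (Finset.sum_le_sum fun n _ => Finset.sum_le_sum fun m _ => ?_) _
            split_ifs with h
            · rw [cq_adj _ (hg n) (cq_meas _ (hg m))]
              refine lintegral_mono fun x => ?_
              calc _ ≤ g n x * (c * cq (m + k + 1) (g m) x) := by
                    gcongr
                    exact cq_comp (by gcongr) (hg m) x
                _ = _ := by rw [add_assoc]; ring
            · simp
        _ = _ := by
            have hmm : ∀ n m, Measurable fun x => c * (g n x * cq (m + (k + 1)) (g m) x) := fun n m =>
              ((hg n).mul (cq_meas _ (hg m))).const_mul c
            have hmm' : ∀ n m, Measurable fun x => (g n x * cq (m + (k + 1)) (g m) x) := fun n m =>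
              ((hg n).mul (cq_meas _ (hg m)))
            rw [mul_assoc]
            congr 1
            simp_rw [Finset.sum_mul_sum]
            rw [← lintegral_const_mul _ (Finset.measurable_fun_sum _ fun n _ => Finset.measurable_fun_sum _ fun m _ => hmm' n m)]
            simp_rw [Finset.mul_sum]
            rw [lintegral_finsetSum _ fun n _ => Finset.measurable_fun_sum _ fun m _ => hmm n m]
            simp_rw [lintegral_finsetSum S fun m _ => hmm _ m]
    calc a k ^ 2 ≤ (2 * c * ∫⁻ x, (∑ n ∈ S, g n x) * (∑ m ∈ S, cq (m + (k + 1)) (g m) x)) ^ 2 := by gcongr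
      _ = (2 * c) ^ 2 * (∫⁻ x, (∑ n ∈ S, g n x) * (∑ m ∈ S, cq (m + (k + 1)) (g m) x)) ^ 2 := by rw [mul_pow]
      _ ≤ (2 * c) ^ 2 * (G * a (k + 1)) := by
          gcongr
          exact cs (Finset.measurable_fun_sum _ fun n _ => hg n).aemeasurable
            (Finset.measurable_fun_sum _ fun n _ => cq_meas _ (hg n)).aemeasurable
      _ = _ := by rw [cqc]; ring
  have hsup : ∀ k, a k ≤ S.card * (4 ^ d * 4 ^ d * (S.card * G)) := by
    intro k
    have hpt : ∀ x, (∑ n ∈ S, cq (n + k) (g n) x) ^ 2 ≤ S.card * ∑ n ∈ S, cq (n + k) (g n) x ^ 2 := fun x => by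
      have := ENNReal.inner_le_Lp_mul_Lq S (fun _ => (1:ℝ≥0∞)) (fun n => cq (n + k) (g n) x) Real.HolderConjugate.two_two
      simp only [one_mul, ENNReal.one_rpow, Finset.sum_const, nsmul_eq_mul, mul_one, ENNReal.rpow_two, one_pow] at this
      calc _ ≤ _ := pow_le_pow_left' this 2
        _ = _ := by
          rw [mul_pow, ← ENNReal.rpow_two, ← ENNReal.rpow_two, ← ENNReal.rpow_mul, ← ENNReal.rpow_mul]; norm_num
    refine (lintegral_mono hpt).trans ?_
    rw [lintegral_const_mul _ (Finset.measurable_fun_sum _ fun n _ => (cq_meas _ (hg n)).pow_const 2),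
      lintegral_finsetSum _ fun n _ => (cq_meas _ (hg n)).pow_const 2]
    gcongr
    calc _ ≤ ∑ n ∈ S, 4 ^ d * 4 ^ d * G := by
          refine Finset.sum_le_sum fun n hn => (cq_l2 _ (hg n)).trans ?_
          refine mul_le_mul_right (lintegral_mono fun x => pow_le_pow_left' ?_ 2) _
          exact Finset.single_le_sum (f := fun n => g n x) (fun _ _ => zero_le) hn
      _ = _ := by rw [Finset.sum_const, nsmul_eq_mul]; ring
  set s := ⨆ k, a k with hs
  have hsfin : s ≠ ∞ := ne_top_of_le_ne_top
    (ENNReal.mul_ne_top (by simp) (ENNReal.mul_ne_top (ENNReal.mul_ne_top (by simp) (by simp)) (ENNReal.mul_ne_top (by simp) hfin)))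
    (iSup_le hsup)
  have hs2 : s ^ 2 ≤ cqc d * G * s := by
    rw [hs, ENNReal.iSup_pow]
    exact iSup_le fun k => (hstep k).trans (mul_le_mul_right (le_iSup a (k + 1)) _)
  have h0 : a 0 ≤ s := le_iSup a 0
  simp only [ha, add_zero] at h0
  exact h0.trans (boot hsfin hs2)

lemma q_fwd (S : Finset ℤ) {g : V d → ℝ≥0∞} (hg : Measurable g) (hfin : ∫⁻ x, g x ^ 2 ≠ ∞) :
    ∫⁻ x, (S.sup fun n => cq n g x) ^ 2 ≤ cqc d * ∫⁻ x, g x ^ 2 := by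
  obtain ⟨w, hw, h1, h2⟩ := selection S (fun n => cq n g) (fun n => cq_meas n hg)
  set M : V d → ℝ≥0∞ := fun x => S.sup fun n => cq n g x with hM
  have hMm : Measurable M := meas_sup S (fun n => cq n g) fun n => cq_meas n hg
  have hMfin : ∫⁻ x, M x ^ 2 ≠ ∞ := by
    refine ne_top_of_le_ne_top (b := ∑ n ∈ S, 4 ^ d * 4 ^ d * ∫⁻ x, g x ^ 2)
      (ENNReal.sum_ne_top.2 fun n _ => ENNReal.mul_ne_top (by simp [ENNReal.mul_eq_top]) hfin) ?_
    calc ∫⁻ x, M x ^ 2 ≤ ∫⁻ x, ∑ n ∈ S, cq n g x ^ 2 := by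
          refine lintegral_mono fun x => ?_
          rcases S.eq_empty_or_nonempty with rfl | hne
          · simp [hM]
          obtain ⟨n, hn, he⟩ := Finset.exists_mem_eq_sup S hne fun n => cq n g x
          simp only [hM, he]
          exact Finset.single_le_sum (f := fun n => cq n g x ^ 2) (fun _ _ => zero_le) hn
      _ = ∑ n ∈ S, ∫⁻ x, cq n g x ^ 2 := lintegral_finsetSum _ fun n _ => (cq_meas n hg).pow_const 2
      _ ≤ _ := Finset.sum_le_sum fun n _ => cq_l2 n hg
  have hle : ∫⁻ x, (∑ n ∈ S, w n x * M x) ^ 2 ≤ ∫⁻ x, M x ^ 2 := by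
    refine lintegral_mono fun x => ?_
    rw [← Finset.sum_mul]
    gcongr
    exact (mul_le_mul_left (h1 x) _).trans (by rw [one_mul])
  have hd := q_dual S (fun n x => w n x * M x) (fun n => (hw n).mul hMm) (ne_top_of_le_ne_top hMfin hle)
  refine boot hMfin ?_
  have e : ∫⁻ x, M x ^ 2 = ∫⁻ x, g x * ∑ n ∈ S, cq n (fun x => w n x * M x) x := by
    calc ∫⁻ x, M x ^ 2 = ∫⁻ x, ∑ n ∈ S, cq n g x * (w n x * M x) := by
          refine lintegral_congr fun x => ?_
          rw [sq]; nth_rewrite 1 [hM]; simp only [← h2, Finset.sum_mul]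
          exact Finset.sum_congr rfl fun n _ => by ring
      _ = ∑ n ∈ S, ∫⁻ x, g x * cq n (fun x => w n x * M x) x := by
          rw [lintegral_finsetSum (f := fun n x => cq n g x * (w n x * M x)) _ fun n _ => (cq_meas n hg).mul ((hw n).mul hMm)]
          exact Finset.sum_congr rfl fun n _ => cq_adj n hg ((hw n).mul hMm)
      _ = _ := by
          simp_rw [Finset.mul_sum]
          rw [lintegral_finsetSum (f := fun n x => g x * cq n (fun x => w n x * M x) x) _ fun n _ => hg.mul (cq_meas n ((hw n).mul hMm))]
  calc (∫⁻ x, M x ^ 2) ^ 2 ≤ (∫⁻ x, g x ^ 2) * ∫⁻ x, (∑ n ∈ S, cq n (fun x => w n x * M x) x) ^ 2 := by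
        rw [e]
        exact cs hg.aemeasurable (Finset.measurable_fun_sum _ fun n _ => cq_meas n ((hw n).mul hMm)).aemeasurable
    _ ≤ (∫⁻ x, g x ^ 2) * (cqc d * ∫⁻ x, M x ^ 2) := by gcongr; exact hd.trans (mul_le_mul_right hle _)
    _ = _ := by ring
end q
end Radon

namespace Radon
open MeasureTheory
open scoped FourierTransform Convolution

section sc
variable {d : ℕ}

/-- scalar convolution -/
def sc (k g : V d → ℝ) (x : V d) : ℝ := ∫ y, k (x - y) * g y

lemma sc_sm {k g : V d → ℝ} (hk : Nice k) (hg : Nice g) : StronglyMeasurable (sc k g) := by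
  unfold sc
  refine StronglyMeasurable.integral_prod_right' (f := fun p : V d × V d => k (p.1 - p.2) * g p.2) ?_
  exact (hk.sm.comp_measurable (by fun_prop)).mul (hg.sm.comp_measurable (by fun_prop))

lemma sc_integrand {k g : V d → ℝ} (hk : Nice k) (hg : Nice g) (x : V d) :
    Integrable fun y => k (x - y) * g y := by
  obtain ⟨B, hB⟩ := hk.bd
  exact hg.int.bdd_mul (c := B) (hk.sm.comp_measurable (by fun_prop)).aestronglyMeasurable (ae_of_all _ fun y => hB _)

lemma toC_conv (k g : V d → ℝ) :
    (fun x => ((sc k g x : ℝ) : ℂ)) = (fun x => (g x : ℂ)) ⋆[ContinuousLinearMap.mul ℂ ℂ] (fun x => (k x : ℂ)) := by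
  funext x
  unfold sc
  rw [convolution_def, ← integral_complex_ofReal]
  refine integral_congr_ae (ae_of_all _ fun y => ?_)
  simp [mul_comm]

lemma sc_nice {k g : V d → ℝ} (hk : Nice k) (hg : Nice g) : Nice (sc k g) := by
  refine ⟨sc_sm hk hg, ?_, ?_⟩
  · have h := (hg.int.ofReal (𝕜 := ℂ)).integrable_convolution (ContinuousLinearMap.mul ℂ ℂ) (hk.int.ofReal (𝕜 := ℂ))
    have e := toC_conv k g
    have h' : Integrable (fun x => ((sc k g x : ℝ) : ℂ)) := by rw [e]; exact h
    simpa using h'.re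
  · obtain ⟨B, hB⟩ := hk.bd
    refine ⟨∫ y, B * ‖g y‖, fun x => ?_⟩
    refine norm_integral_le_of_norm_le (hg.int.norm.const_mul B) (ae_of_all _ fun y => ?_)
    rw [norm_mul]
    exact mul_le_mul_of_nonneg_right (hB _) (norm_nonneg _)

def ft (g : V d → ℝ) : V d → ℂ := 𝓕 (fun x => (g x : ℂ))

lemma ft_sc {k g : V d → ℝ} (hk : Nice k) (hg : Nice g) (ξ : V d) : ft (sc k g) ξ = ft k ξ * ft g ξ := by
  have h1 : Integrable fun x => ((g x : ℝ) : ℂ) := hg.int.ofReal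
  have h2 : Integrable fun x => ((k x : ℝ) : ℂ) := hk.int.ofReal
  unfold ft
  rw [toC_conv, Real.fourier_mul_convolution_eq h1 h2, mul_comm]

lemma Nice.memLp2 {E : Type*} [NormedAddCommGroup E] {g : V d → E} (hg : Nice g) : MemLp g 2 volume := by
  obtain ⟨B, hB⟩ := hg.bd
  rw [memLp_two_iff_integrable_sq_norm hg.sm.aestronglyMeasurable]
  simp_rw [sq]
  exact hg.int.norm.bdd_mul (c := B) hg.sm.norm.aestronglyMeasurable (ae_of_all _ fun y => by simpa using hB y)

lemma lint_sq_eLp {E : Type*} [NormedAddCommGroup E] (g : V d → E) :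
    ∫⁻ x, ‖g x‖ₑ ^ 2 = eLpNorm g 2 volume ^ 2 := by
  rw [eLpNorm_eq_lintegral_rpow_enorm_toReal (by norm_num) (by norm_num)]
  simp only [ENNReal.toReal_ofNat, ENNReal.rpow_two]
  rw [← ENNReal.rpow_two, ← ENNReal.rpow_mul]; norm_num

lemma ft_planch {g : V d → ℝ} (hg : Nice g) : ∫⁻ ξ, ‖ft g ξ‖ₑ ^ 2 = ∫⁻ x, ‖g x‖ₑ ^ 2 := by
  have h1 : Integrable fun x => ((g x : ℝ) : ℂ) := hg.int.ofReal
  have h2 : MemLp (fun x => ((g x : ℝ) : ℂ)) 2 volume := hg.memLp2.ofReal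
  rw [lint_sq_eLp, ft, plancherel _ h1 h2, ← lint_sq_eLp]
  simp [← ofReal_norm]

lemma ft_meas {g : V d → ℝ} (hg : Nice g) : Measurable (ft g) := by
  unfold ft
  exact (VectorFourier.fourierIntegral_continuous Real.continuous_fourierChar (by exact continuous_inner) (hg.int.ofReal (𝕜 := ℂ))).measurable

lemma Nice.add {E : Type*} [NormedAddCommGroup E] {f g : V d → E} (hf : Nice f) (hg : Nice g) : Nice (fun x => f x + g x) := by
  obtain ⟨B, hB⟩ := hf.bd
  obtain ⟨B', hB'⟩ := hg.bd
  exact ⟨hf.sm.add hg.sm, hf.int.add hg.int, B + B', fun x => (norm_add_le _ _).trans (add_le_add (hB x) (hB' x))⟩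

lemma Nice.zero {E : Type*} [NormedAddCommGroup E] : Nice (fun _ : V d => (0 : E)) :=
  ⟨stronglyMeasurable_const, integrable_zero _ _ _, 0, by simp⟩

lemma Nice.sum {ι E : Type*} [NormedAddCommGroup E] (S : Finset ι) {f : ι → V d → E} (hf : ∀ n ∈ S, Nice (f n)) :
    Nice (fun x => ∑ n ∈ S, f n x) := by
  classical
  induction S using Finset.induction_on with
  | empty => simpa using Nice.zero
  | insert j S hj ih =>
    simp only [Finset.sum_insert hj]
    exact (hf j (by simp)).add (ih fun n hn => hf n (by simp [hn]))

lemma ft_sum (S : Finset ℤ) {f : ℤ → V d → ℝ} (hf : ∀ n, Nice (f n)) (ξ : V d) :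
    ft (fun x => ∑ n ∈ S, f n x) ξ = ∑ n ∈ S, ft (f n) ξ := by
  classical
  induction S using Finset.induction_on with
  | empty => simp [ft, Real.fourier_eq]
  | insert j S hj ih =>
    simp only [Finset.sum_insert hj]
    rw [← ih]
    simp only [ft, Real.fourier_eq]
    rw [← integral_add]
    · refine integral_congr_ae (ae_of_all _ fun y => ?_)
      simp [smul_add]
    · exact (Real.fourierIntegral_convergent_iff _).2 ((hf j).int.ofReal (𝕜 := ℂ))
    · exact (Real.fourierIntegral_convergent_iff _).2 ((Nice.sum S fun n _ => hf n).int.ofReal (𝕜 := ℂ))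

lemma cs_sum {ι : Type*} (S : Finset ι) (a b : ι → ℝ≥0∞) :
    (∑ n ∈ S, a n * b n) ^ 2 ≤ (∑ n ∈ S, a n ^ 2) * ∑ n ∈ S, b n ^ 2 := by
  have := ENNReal.inner_le_Lp_mul_Lq S a b Real.HolderConjugate.two_two
  simp only [ENNReal.rpow_two] at this
  calc _ ≤ _ := pow_le_pow_left' this 2
    _ = _ := by
      rw [mul_pow, ← ENNReal.rpow_two, ← ENNReal.rpow_two, ← ENNReal.rpow_mul, ← ENNReal.rpow_mul]; norm_num

lemma enorm_sum_sq {ι : Type*} (S : Finset ι) (a : ι → ℂ) {B : ℝ} (h : ∑ n ∈ S, ‖a n‖ ^ 2 ≤ B) :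
    ∑ n ∈ S, ‖a n‖ₑ ^ 2 ≤ ENNReal.ofReal B := by
  refine le_trans (le_of_eq ?_) (ENNReal.ofReal_le_ofReal h)
  rw [ENNReal.ofReal_sum_of_nonneg fun n _ => by positivity]
  refine Finset.sum_congr rfl fun n _ => ?_
  rw [ENNReal.ofReal_pow (norm_nonneg _), ofReal_norm]

lemma l2_dual (S : Finset ℤ) {D : ℤ → V d → ℝ} (hD : ∀ n, Nice (D n)) {B : ℝ}
    (hB : ∀ ξ, ∑ n ∈ S, ‖ft (D n) ξ‖ ^ 2 ≤ B) {g : ℤ → V d → ℝ} (hg : ∀ n, Nice (g n)) :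
    ∫⁻ x, ‖∑ n ∈ S, sc (D n) (g n) x‖ₑ ^ 2 ≤ ENNReal.ofReal B * ∑ n ∈ S, ∫⁻ x, ‖g n x‖ₑ ^ 2 := by
  rw [← ft_planch (Nice.sum S fun n _ => sc_nice (hD n) (hg n))]
  calc _ ≤ ∫⁻ ξ, ENNReal.ofReal B * ∑ n ∈ S, ‖ft (g n) ξ‖ₑ ^ 2 := by
        refine lintegral_mono fun ξ => ?_
        rw [ft_sum S fun n => sc_nice (hD n) (hg n)]
        calc _ ≤ (∑ n ∈ S, ‖ft (D n) ξ‖ₑ * ‖ft (g n) ξ‖ₑ) ^ 2 := by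
              gcongr
              refine (enorm_sum_le _ _).trans (le_of_eq (Finset.sum_congr rfl fun n _ => ?_))
              rw [ft_sc (hD n) (hg n), enorm_mul]
          _ ≤ _ := (cs_sum _ _ _).trans (mul_le_mul_left (enorm_sum_sq S _ (hB ξ)) _)
    _ = _ := by
        have hm : ∀ n, Measurable fun ξ => ‖ft (g n) ξ‖ₑ ^ 2 := fun n => (ft_meas (hg n)).enorm.pow_const 2
        rw [lintegral_const_mul _ (Finset.measurable_fun_sum _ fun n _ => hm n), lintegral_finsetSum _ fun n _ => hm n]
        simp_rw [ft_planch (hg _)]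

lemma l2_fwd (S : Finset ℤ) {D : ℤ → V d → ℝ} (hD : ∀ n, Nice (D n)) {B : ℝ}
    (hB : ∀ ξ, ∑ n ∈ S, ‖ft (D n) ξ‖ ^ 2 ≤ B) {g : V d → ℝ} (hg : Nice g) :
    ∫⁻ x, ∑ n ∈ S, ‖sc (D n) g x‖ₑ ^ 2 ≤ ENNReal.ofReal B * ∫⁻ x, ‖g x‖ₑ ^ 2 := by
  rw [lintegral_finsetSum _ fun n _ => (sc_sm (hD n) hg).measurable.enorm.pow_const 2]
  simp_rw [← ft_planch (sc_nice (hD _) hg)]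
  rw [← lintegral_finsetSum _ fun n _ => (ft_meas (sc_nice (hD n) hg)).enorm.pow_const 2, ← ft_planch hg,
    ← lintegral_const_mul _ ((ft_meas hg).enorm.pow_const 2)]
  refine lintegral_mono fun ξ => ?_
  simp_rw [ft_sc (hD _) hg, enorm_mul, mul_pow]
  rw [← Finset.sum_mul]
  exact mul_le_mul_left (enorm_sum_sq S _ (hB ξ)) _
end sc
end Radon

namespace Radon
open MeasureTheory
open scoped FourierTransform

section ker
variable {d : ℕ}

def Qs (m : ℤ) : Set (V d) := {x | ∀ i, x i ∈ Set.Ico 0 (scl m i)}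

lemma Qs_meas (m : ℤ) : MeasurableSet (Qs (d := d) m) := by
  have : Qs (d := d) m = ⋂ i, (fun x : V d => x i) ⁻¹' (Set.Ico 0 (scl m i)) := by ext x; simp [Qs]
  rw [this]
  exact MeasurableSet.iInter fun i => (by fun_prop : Measurable fun x : V d => x i) measurableSet_Ico

lemma Qs_vol (m : ℤ) : volume (Qs (d := d) m) = ENNReal.ofReal (vl d m) := by
  unfold Qs
  rw [volume_box (fun _ => 0) (fun i => scl m i), vl, ENNReal.ofReal_prod_of_nonneg fun i _ => (scl_pos _ i).le]
  simp

def chi (m : ℤ) (x : V d) : ℝ := (Qs m).indicator (fun _ => (vl d m)⁻¹) x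

lemma chi_meas (m : ℤ) : Measurable (chi (d := d) m) := measurable_const.indicator (Qs_meas m)

lemma chi_nonneg (m : ℤ) (x : V d) : 0 ≤ chi m x :=
  Set.indicator_nonneg (fun _ _ => inv_nonneg.2 (vl_pos d m).le) _

lemma chi_le (m : ℤ) (x : V d) : chi m x ≤ (vl d m)⁻¹ :=
  Set.indicator_le_self' (f := fun _ : V d => (vl d m)⁻¹) (fun _ _ => inv_nonneg.2 (vl_pos d m).le) x

lemma chi_lint (m : ℤ) : ∫⁻ x : V d, ‖chi m x‖ₑ = 1 := by
  have : ∀ x : V d, ‖chi m x‖ₑ = (Qs m).indicator (fun _ => ENNReal.ofReal (vl d m)⁻¹) x := by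
    intro x
    rw [Real.enorm_of_nonneg (chi_nonneg m x)]
    unfold chi
    by_cases h : x ∈ Qs m <;> simp [h]
  simp_rw [this]
  rw [lintegral_indicator (Qs_meas m), setLIntegral_const, Qs_vol, ← ENNReal.ofReal_mul (inv_nonneg.2 (vl_pos d m).le),
    inv_mul_cancel₀ (vl_pos d m).ne']
  simp

lemma chi_nice (m : ℤ) : Nice (chi (d := d) m) := by
  refine ⟨(chi_meas m).stronglyMeasurable, ⟨(chi_meas m).aestronglyMeasurable, ?_⟩, (vl d m)⁻¹, fun x => ?_⟩
  · rw [HasFiniteIntegral, chi_lint]; simp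
  · rw [Real.norm_of_nonneg (chi_nonneg m x)]; exact chi_le m x

lemma chi_integral (m : ℤ) : ∫ x : V d, chi m x = 1 := by
  rw [integral_eq_lintegral_of_nonneg_ae (ae_of_all _ (chi_nonneg m)) (chi_meas m).aestronglyMeasurable]
  have : ∀ x : V d, ENNReal.ofReal (chi m x) = ‖chi m x‖ₑ := fun x => (Real.enorm_of_nonneg (chi_nonneg m x)).symm
  simp_rw [this, chi_lint]; simp

/-- one direction of the translation estimate -/
lemma Qs_trans (m : ℤ) (z : V d) : volume {u : V d | u ∈ Qs m ∧ u + z ∉ Qs m} ≤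
    ENNReal.ofReal (vl d m * ∑ i, |z i| / scl m i) := by
  classical
  set a : Fin d → Fin d → ℝ := fun i => Function.update (fun _ => 0) i (if 0 ≤ z i then scl m i - z i else 0) with ha
  set b : Fin d → Fin d → ℝ := fun i => Function.update (fun k => scl m k) i (if 0 ≤ z i then scl m i else - z i) with hb
  have hsub : {u : V d | u ∈ Qs m ∧ u + z ∉ Qs m} ⊆ ⋃ i, {u : V d | ∀ k, u k ∈ Set.Ico (a i k) (b i k)} := by
    rintro u ⟨h1, h2⟩
    simp only [Qs, Set.mem_ofPred_eq, not_forall] at h1 h2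
    obtain ⟨i, hi⟩ := h2
    rw [Set.mem_iUnion]
    refine ⟨i, fun k => ?_⟩
    rcases eq_or_ne k i with rfl | hk
    · simp only [ha, hb, Function.update_self]
      have := h1 k
      simp only [PiLp.add_apply, Set.mem_Ico, not_and_or, not_le, not_lt] at hi this ⊢
      split_ifs with h0
      · rcases hi with hi | hi
        · linarith [this.1]
        · exact ⟨by linarith, this.2⟩
      · push Not at h0
        rcases hi with hi | hi
        · exact ⟨this.1, by linarith⟩
        · linarith [this.2]
    · simp only [ha, hb, Function.update_of_ne hk]
      exact h1 k
  have hvol : ∀ i, volume {u : V d | ∀ k, u k ∈ Set.Ico (a i k) (b i k)} = ENNReal.ofReal (vl d m * (|z i| / scl m i)) := by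
    intro i
    rw [volume_box]
    have hpos : ∀ k, 0 ≤ b i k - a i k := by
      intro k
      rcases eq_or_ne k i with rfl | hk
      · simp only [ha, hb, Function.update_self]
        split_ifs with h0 <;> linarith
      · simp only [ha, hb, Function.update_of_ne hk]
        linarith [scl_pos m k]
    rw [← ENNReal.ofReal_prod_of_nonneg fun k _ => hpos k]
    congr 1
    rw [← Finset.mul_prod_erase _ _ (Finset.mem_univ i), vl, ← Finset.mul_prod_erase _ (fun i => scl m i) (Finset.mem_univ i)]
    have e1 : b i i - a i i = |z i| := by
      simp only [ha, hb, Function.update_self]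
      split_ifs with h0
      · rw [abs_of_nonneg h0]; ring
      · rw [abs_of_neg (not_le.1 h0)]; ring
    have e2 : ∏ k ∈ Finset.univ.erase i, (b i k - a i k) = ∏ k ∈ Finset.univ.erase i, scl m k := by
      refine Finset.prod_congr rfl fun k hk => ?_
      simp only [ha, hb, Function.update_of_ne (Finset.ne_of_mem_erase hk), sub_zero]
    rw [e1, e2]
    have := (scl_pos m i).ne'
    field_simp
  calc _ ≤ ∑ i, volume {u : V d | ∀ k, u k ∈ Set.Ico (a i k) (b i k)} := (measure_mono hsub).trans (measure_iUnion_fintype_le _ _)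
    _ = _ := by
      simp_rw [hvol]
      rw [← ENNReal.ofReal_sum_of_nonneg fun i _ => mul_nonneg (vl_pos d m).le (div_nonneg (abs_nonneg _) (scl_pos m i).le), Finset.mul_sum]

lemma chi_two (m : ℤ) (y c : V d) : ∫⁻ x, ‖chi m (x - y) - chi m (x - c)‖ₑ ≤ 2 := by
  have hm : ∀ y : V d, Measurable fun x => chi m (x - y) := fun y => (chi_meas m).comp (by fun_prop)
  calc _ ≤ ∫⁻ x, (‖chi m (x - y)‖ₑ + ‖chi m (x - c)‖ₑ) := lintegral_mono fun x => enorm_sub_le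
    _ = 2 := by
      rw [lintegral_add_left (hm y).enorm, lintegral_sub_right_eq_self (fun x => ‖chi m x‖ₑ),
        lintegral_sub_right_eq_self (fun x => ‖chi m x‖ₑ), chi_lint]; norm_num

lemma chi_trans (m : ℤ) (y c : V d) : ∫⁻ x, ‖chi m (x - y) - chi m (x - c)‖ₑ ≤
    ENNReal.ofReal (2 * ∑ i, |y i - c i| / scl m i) := by
  set w := ENNReal.ofReal (vl d m)⁻¹ with hw
  have key : ∀ y c : V d, ∫⁻ x, {u : V d | u ∈ Qs m ∧ u + (y - c) ∉ Qs m}.indicator (fun _ => w) (x - y) ≤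
      ENNReal.ofReal (∑ i, |y i - c i| / scl m i) := by
    intro y c
    have hms : MeasurableSet {u : V d | u ∈ Qs m ∧ u + (y - c) ∉ Qs m} :=
      (Qs_meas m).inter ((by fun_prop : Measurable fun u : V d => u + (y - c)) (Qs_meas m).compl)
    rw [lintegral_sub_right_eq_self (fun x => {u : V d | u ∈ Qs m ∧ u + (y - c) ∉ Qs m}.indicator (fun _ => w) x),
      lintegral_indicator hms, setLIntegral_const]
    calc _ ≤ w * ENNReal.ofReal (vl d m * ∑ i, |(y - c) i| / scl m i) := by gcongr; exact Qs_trans m _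
      _ = _ := by
        rw [hw, ← ENNReal.ofReal_mul (inv_nonneg.2 (vl_pos d m).le), ← mul_assoc, inv_mul_cancel₀ (vl_pos d m).ne', one_mul]
        simp
  have hms : ∀ y c : V d, MeasurableSet {u : V d | u ∈ Qs m ∧ u + (y - c) ∉ Qs m} := fun y c =>
      (Qs_meas m).inter ((by fun_prop : Measurable fun u : V d => u + (y - c)) (Qs_meas m).compl)
  calc _ ≤ ∫⁻ x, ({u : V d | u ∈ Qs m ∧ u + (y - c) ∉ Qs m}.indicator (fun _ => w) (x - y) +
        {u : V d | u ∈ Qs m ∧ u + (c - y) ∉ Qs m}.indicator (fun _ => w) (x - c)) := by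
        refine lintegral_mono fun x => ?_
        have e1 : x - y + (y - c) = x - c := by abel
        have e2 : x - c + (c - y) = x - y := by abel
        simp only [Set.indicator_apply, Set.mem_ofPred_eq, e1, e2, chi]
        have hpos := vl_pos d m
        by_cases h1 : x - y ∈ Qs m <;> by_cases h2 : x - c ∈ Qs m <;> simp [h1, h2, hw, Real.enorm_eq_ofReal_abs, abs_of_pos hpos]
    _ ≤ ENNReal.ofReal (∑ i, |y i - c i| / scl m i) + ENNReal.ofReal (∑ i, |c i - y i| / scl m i) := by
        have hme : Measurable fun x : V d => {u : V d | u ∈ Qs m ∧ u + (y - c) ∉ Qs m}.indicator (fun _ => w) (x - y) :=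
          (measurable_const.indicator (hms y c)).comp (by fun_prop : Measurable fun x : V d => x - y)
        rw [lintegral_add_left hme]
        exact add_le_add (key y c) (key c y)
    _ = _ := by
        simp_rw [abs_sub_comm (c _) (y _)]
        rw [← ENNReal.ofReal_add (Finset.sum_nonneg fun i _ => div_nonneg (abs_nonneg _) (scl_pos m i).le)
          (Finset.sum_nonneg fun i _ => div_nonneg (abs_nonneg _) (scl_pos m i).le), two_mul]

/-- the dilated moment curve -/
def gam (n : ℤ) (s : ℝ) : V d := WithLp.toLp 2 fun i => scl n i * s ^ ((i:ℕ) + 1)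

lemma gam_cont (n : ℤ) : Continuous (gam (d := d) n) := by unfold gam; fun_prop

@[fun_prop]
lemma gam_meas (n : ℤ) : Measurable (gam (d := d) n) := (gam_cont n).measurable

def K (n m : ℤ) (x : V d) : ℝ := ∫ s in Set.Ioc (0:ℝ) 1, chi m (x - gam n s)

instance : IsProbabilityMeasure (volume.restrict (Set.Ioc (0:ℝ) 1)) := ⟨by simp⟩

lemma K_sm (n m : ℤ) : StronglyMeasurable (K (d := d) n m) := by
  unfold K
  refine StronglyMeasurable.integral_prod_right' (f := fun p : V d × ℝ => chi m (p.1 - gam n p.2)) ?_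
  exact (chi_nice m).sm.comp_measurable (by fun_prop)

lemma K_nonneg (n m : ℤ) (x : V d) : 0 ≤ K n m x := integral_nonneg fun s => chi_nonneg m _

lemma chig_int (n m : ℤ) (x : V d) : Integrable (fun s => chi m (x - gam n s)) (volume.restrict (Set.Ioc (0:ℝ) 1)) := by
  refine Integrable.of_bound (C := (vl d m)⁻¹) ((chi_meas m).comp (by fun_prop)).aestronglyMeasurable (ae_of_all _ fun s => ?_)
  rw [Real.norm_of_nonneg (chi_nonneg m _)]; exact chi_le m _

lemma K_le (n m : ℤ) (x : V d) : K n m x ≤ (vl d m)⁻¹ := by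
  have := integral_mono (chig_int n m x) (integrable_const (vl d m)⁻¹) fun s => chi_le m _
  simpa [K] using this

lemma K_supp {n m : ℤ} {x : V d} (h : K n m x ≠ 0) (i : Fin d) : x i ∈ Set.Ico 0 (scl m i + scl n i) := by
  by_contra hx
  refine h ?_
  unfold K
  rw [setIntegral_congr_fun (g := fun _ => (0:ℝ)) measurableSet_Ioc]
  · simp
  · intro s hs
    refine Set.indicator_of_notMem (s := Qs m) ?_ _
    intro hq
    have := hq i
    simp only [gam, PiLp.sub_apply, Set.mem_Ico] at this
    have h1 : 0 ≤ s ^ ((i:ℕ)+1) := pow_nonneg hs.1.le _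
    have h2 : s ^ ((i:ℕ)+1) ≤ 1 := pow_le_one₀ hs.1.le hs.2
    have h3 := scl_pos n i
    exact hx ⟨by nlinarith, by nlinarith⟩

lemma prod_int (n m : ℤ) : Integrable (fun p : V d × ℝ => chi m (p.1 - gam n p.2)) (volume.prod (volume.restrict (Set.Ioc (0:ℝ) 1))) := by
  have hme : Measurable (fun p : V d × ℝ => chi m (p.1 - gam n p.2)) := (chi_meas m).comp (by fun_prop)
  rw [integrable_prod_iff' hme.aestronglyMeasurable]
  have h1 : ∀ s : ℝ, Integrable (fun x : V d => chi m (x - gam n s)) := fun s => (chi_nice m).int.comp_sub_right (gam n s)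
  refine ⟨ae_of_all _ h1, ?_⟩
  have : ∀ s : ℝ, ∫ x : V d, ‖chi m (x - gam n s)‖ = 1 := by
    intro s
    rw [integral_sub_right_eq_self (fun x : V d => ‖chi m x‖)]
    simp_rw [Real.norm_of_nonneg (chi_nonneg m _)]
    exact chi_integral m
  have e : (fun s : ℝ => ∫ x : V d, ‖chi m (x - gam n s)‖) = fun _ => 1 := funext this
  rw [e]
  exact integrable_const (1:ℝ)

lemma K_nice (n m : ℤ) : Nice (K (d := d) n m) := by
  refine ⟨K_sm n m, ?_, (vl d m)⁻¹, fun x => ?_⟩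
  · exact (prod_int n m).integral_prod_left
  · rw [Real.norm_of_nonneg (K_nonneg n m x)]; exact K_le n m x

lemma K_diff (n m : ℤ) (y c : V d) {B : ℝ≥0∞} (hB : ∀ y' c' : V d, y' - c' = y - c → ∫⁻ x, ‖chi m (x - y') - chi m (x - c')‖ₑ ≤ B) :
    ∫⁻ x, ‖K n m (x - y) - K n m (x - c)‖ₑ ≤ B := by
  calc _ ≤ ∫⁻ x, ∫⁻ s in Set.Ioc (0:ℝ) 1, ‖chi m (x - (y + gam n s)) - chi m (x - (c + gam n s))‖ₑ := by
        refine lintegral_mono fun x => ?_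
        unfold K
        rw [← integral_sub (chig_int n m _) (chig_int n m _)]
        refine (enorm_integral_le_lintegral_enorm _).trans (le_of_eq ?_)
        simp only [sub_sub]
    _ = ∫⁻ s in Set.Ioc (0:ℝ) 1, ∫⁻ x, ‖chi m (x - (y + gam n s)) - chi m (x - (c + gam n s))‖ₑ := by
        refine lintegral_lintegral_swap (Measurable.aemeasurable (Measurable.enorm ?_))
        exact ((chi_meas m).comp (by fun_prop)).sub ((chi_meas m).comp (by fun_prop))
    _ ≤ ∫⁻ s in Set.Ioc (0:ℝ) 1, B := lintegral_mono fun s => hB _ _ (by abel)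
    _ = B := by simp

lemma K_two (n m : ℤ) (y c : V d) : ∫⁻ x, ‖K n m (x - y) - K n m (x - c)‖ₑ ≤ 2 :=
  K_diff n m y c fun _ _ _ => chi_two _ _ _

lemma K_trans (n m : ℤ) (y c : V d) : ∫⁻ x, ‖K n m (x - y) - K n m (x - c)‖ₑ ≤
    ENNReal.ofReal (2 * ∑ i, |y i - c i| / scl m i) := by
  refine K_diff n m y c fun y' c' h => (chi_trans m y' c').trans (le_of_eq ?_)
  have : ∀ i, y' i - c' i = y i - c i := fun i => by
    have := congrArg (fun v : V d => v i) h; simpa using this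
  simp_rw [this]

def nu (n : ℤ) (ξ : V d) : ℂ := ∫ s in (0:ℝ)..1, Complex.exp (Complex.I * ((-(2 * Real.pi) * ∑ i, ξ i * (scl n i * s ^ ((i:ℕ)+1)) : ℝ) : ℂ))

lemma ft_K (n m : ℤ) (ξ : V d) : ft (K n m) ξ = nu n ξ * ft (chi m) ξ := by
  have hh_intg : Integrable (fun p : V d × ℝ => Real.fourierChar (-(inner ℝ p.1 ξ)) • ((chi m (p.1 - gam n p.2) : ℝ) : ℂ)) (volume.prod (volume.restrict (Set.Ioc (0:ℝ) 1))) := by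
    have h0 : Integrable (fun p : V d × ℝ => ((chi m (p.1 - gam n p.2) : ℝ) : ℂ)) (volume.prod (volume.restrict (Set.Ioc (0:ℝ) 1))) := (prod_int n m).ofReal
    refine Integrable.mono h0 ?_ (ae_of_all _ fun p => by simp)
    refine AEStronglyMeasurable.smul (f := fun p : V d × ℝ => Real.fourierChar (-(inner ℝ p.1 ξ))) ?_ h0.aestronglyMeasurable
    exact (Real.continuous_fourierChar.comp (by fun_prop)).aestronglyMeasurable
  calc ft (K n m) ξ = ∫ x : V d, ∫ s in Set.Ioc (0:ℝ) 1, Real.fourierChar (-(inner ℝ x ξ)) • ((chi m (x - gam n s) : ℝ) : ℂ) := by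
        unfold ft
        rw [Real.fourier_eq]
        refine integral_congr_ae (ae_of_all _ fun x => ?_)
        simp only [K]
        rw [← integral_complex_ofReal]
        simp only [Circle.smul_def, smul_eq_mul]
        rw [integral_const_mul]
    _ = ∫ s in Set.Ioc (0:ℝ) 1, ∫ x : V d, Real.fourierChar (-(inner ℝ x ξ)) • ((chi m (x - gam n s) : ℝ) : ℂ) := integral_integral_swap hh_intg
    _ = ∫ s in Set.Ioc (0:ℝ) 1, Complex.exp (Complex.I * ((-(2 * Real.pi) * ∑ i, ξ i * (scl n i * s ^ ((i:ℕ)+1)) : ℝ) : ℂ)) * ft (chi m) ξ := by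
        refine integral_congr_ae (ae_of_all _ fun s => ?_)
        dsimp only
        rw [← integral_add_right_eq_self _ (gam n s)]
        unfold ft
        rw [Real.fourier_eq, ← integral_const_mul]
        refine integral_congr_ae (ae_of_all _ fun x => ?_)
        dsimp only
        rw [add_sub_cancel_right, inner_add_left, neg_add, AddChar.map_add_eq_mul, mul_comm, mul_smul, Circle.smul_def, Real.fourierChar_apply]
        have e : inner ℝ (gam n s) ξ = ∑ i, ξ i * (scl n i * s ^ ((i:ℕ)+1)) := by
          rw [PiLp.inner_apply]; simp [gam, mul_comm]
        rw [e, smul_eq_mul]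
        congr 2
        push_cast; ring
    _ = _ := by
        rw [integral_mul_const, nu, intervalIntegral.integral_of_le zero_le_one]
end ker
end Radon

namespace Radon
open MeasureTheory
open scoped FourierTransform

section fb
variable {d : ℕ}

def NN (n : ℤ) (ξ : V d) : ℝ := ∑ i, |ξ i| * scl n i

lemma NN_nonneg (n : ℤ) (ξ : V d) : 0 ≤ NN n ξ := Finset.sum_nonneg fun i _ => mul_nonneg (abs_nonneg _) (scl_pos n i).le

lemma NN_pos (n : ℤ) {ξ : V d} (h : ξ ≠ 0) : 0 < NN n ξ := by
  obtain ⟨i, hi⟩ : ∃ i, ξ i ≠ 0 := by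
    by_contra hc
    push Not at hc
    exact h (PiLp.ext hc)
  exact Finset.sum_pos' (fun i _ => mul_nonneg (abs_nonneg _) (scl_pos n i).le)
    ⟨i, Finset.mem_univ i, mul_pos (abs_pos.2 hi) (scl_pos n i)⟩

lemma NN_succ (n : ℤ) (ξ : V d) : 2 * NN n ξ ≤ NN (n + 1) ξ := by
  unfold NN
  rw [Finset.mul_sum]
  refine Finset.sum_le_sum fun i _ => ?_
  rw [scl_add, scl_one]
  have h2 : (2:ℝ) ≤ ((2 ^ ((i:ℕ) + 1) : ℕ) : ℝ) := by exact_mod_cast Nat.le_self_pow (by omega) 2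
  have : 0 ≤ |ξ i| * scl n i := mul_nonneg (abs_nonneg _) (scl_pos n i).le
  nlinarith

lemma NN_add (n : ℤ) (j : ℕ) (ξ : V d) : 2 ^ j * NN n ξ ≤ NN (n + j) ξ := by
  induction j with
  | zero => simp
  | succ j ih =>
    have := NN_succ (n + j) ξ
    push_cast; rw [← add_assoc, pow_succ]; linarith

lemma nu_decay (hd : 1 ≤ d) : ∃ C : ℝ, 0 < C ∧ ∀ (n : ℤ) (ξ : V d), ξ ≠ 0 →
    ‖nu n ξ‖ ≤ C * NN n ξ ^ (-(1 / (4 * d) : ℝ)) := by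
  obtain ⟨C, hC, h⟩ := vdc d hd
  refine ⟨C, hC, fun n ξ hξ => ?_⟩
  set φ : Polynomial ℝ := ∑ i : Fin d, Polynomial.monomial ((i:ℕ)+1) (-(2 * Real.pi) * (ξ i * scl n i)) with hφ
  have hdeg : φ.natDegree ≤ d := by
    refine Polynomial.natDegree_sum_le_of_forall_le _ _ fun i _ => ?_
    exact (Polynomial.natDegree_monomial_le _).trans (by omega)
  have hco : ∀ i : Fin d, φ.coeff ((i:ℕ)+1) = -(2 * Real.pi) * (ξ i * scl n i) := by
    intro i
    rw [hφ, Polynomial.finsetSum_coeff, Finset.sum_eq_single i]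
    · simp
    · intro b _ hb
      rw [Polynomial.coeff_monomial, if_neg]
      intro h; exact hb (Fin.ext (by omega))
    · simp
  have hsum : ∑ i ∈ Finset.range d, |φ.coeff (i+1)| = 2 * Real.pi * NN n ξ := by
    rw [Finset.sum_range, NN, Finset.mul_sum]
    refine Finset.sum_congr rfl fun i _ => ?_
    rw [hco, abs_mul, abs_mul, abs_neg, abs_of_pos (scl_pos n i), abs_of_pos Real.two_pi_pos]
  have hpos := NN_pos n hξ
  have h1 := h φ hdeg (by rw [hsum]; positivity)
  rw [hsum] at h1
  have e : nu n ξ = ∫ s in (0:ℝ)..1, Complex.exp (Complex.I * (φ.eval s : ℝ)) := by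
    unfold nu
    refine intervalIntegral.integral_congr fun s _ => ?_
    simp only
    congr 3
    rw [hφ, Polynomial.eval_finsetSum, Finset.mul_sum]
    refine Finset.sum_congr rfl fun i _ => ?_
    rw [Polynomial.eval_monomial]; ring
  rw [e]
  refine h1.trans ?_
  gcongr C * ?_
  refine Real.rpow_le_rpow_of_nonpos hpos ?_ (by simp only [Left.neg_nonpos_iff]; positivity)
  nlinarith [Real.pi_gt_three]

lemma ft_chi_le (m : ℤ) (ξ : V d) : ‖ft (chi m) ξ‖ ≤ 1 := by
  unfold ft
  rw [Real.fourier_eq]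
  refine (norm_integral_le_integral_norm _).trans ?_
  simp only [Circle.norm_smul, Complex.norm_real, Real.norm_of_nonneg (chi_nonneg m _)]
  rw [chi_integral]

lemma ft_chi_sub (m : ℤ) (ξ : V d) : ‖ft (chi m) ξ - 1‖ ≤ 2 * Real.pi * NN m ξ := by
  have hC : Integrable fun x : V d => ((chi m x : ℝ) : ℂ) := (chi_nice m).int.ofReal
  have e1 : (1:ℂ) = ∫ x : V d, ((chi m x : ℝ) : ℂ) := by
    rw [integral_complex_ofReal, chi_integral]; simp
  unfold ft
  rw [Real.fourier_eq, e1, ← integral_sub ((Real.fourierIntegral_convergent_iff _).2 hC) hC]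
  calc _ ≤ ∫ x : V d, (2 * Real.pi * NN m ξ) * chi m x := by
        refine norm_integral_le_of_norm_le ((chi_nice m).int.const_mul _) (ae_of_all _ fun x => ?_)
        by_cases hx : x ∈ Qs m
        · rw [Circle.smul_def, smul_eq_mul, ← sub_one_mul, norm_mul, Complex.norm_real, Real.norm_of_nonneg (chi_nonneg m _)]
          refine mul_le_mul_of_nonneg_right ?_ (chi_nonneg m _)
          rw [Real.fourierChar_apply, mul_comm]
          refine (Real.norm_exp_I_mul_ofReal_sub_one_le).trans ?_
          rw [norm_mul, Real.norm_of_nonneg Real.two_pi_pos.le, norm_neg]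
          refine mul_le_mul_of_nonneg_left ?_ Real.two_pi_pos.le
          rw [PiLp.inner_apply]
          refine (norm_sum_le _ _).trans (Finset.sum_le_sum fun i _ => ?_)
          have := hx i
          simp only [Real.inner_apply, RCLike.inner_apply, conj_trivial, norm_mul, Real.norm_eq_abs]
          rw [abs_of_nonneg this.1]
          first
          | exact mul_le_mul_of_nonneg_left this.2.le (abs_nonneg _)
          | (rw [mul_comm]; exact mul_le_mul_of_nonneg_left this.2.le (abs_nonneg _))
        · have : chi m x = 0 := Set.indicator_of_notMem hx _
          simp [this]
    _ = _ := by rw [integral_const_mul, chi_integral, mul_one]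

/-- telescoping pieces -/
def Dk (n : ℤ) : ℕ → V d → ℝ
  | 0 => K n n
  | j + 1 => fun x => K n (n - ((j:ℤ) + 1)) x - K n (n - j) x

lemma Nice.neg {E : Type*} [NormedAddCommGroup E] {f : V d → E} (hf : Nice f) : Nice (fun x => - f x) := by
  obtain ⟨B, hB⟩ := hf.bd
  exact ⟨hf.sm.neg, hf.int.neg, B, fun x => by simpa using hB x⟩

lemma Nice.sub {E : Type*} [NormedAddCommGroup E] {f g : V d → E} (hf : Nice f) (hg : Nice g) : Nice (fun x => f x - g x) := by
  simp_rw [sub_eq_add_neg]; exact hf.add hg.neg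

lemma Dk_nice (n : ℤ) (j : ℕ) : Nice (Dk (d := d) n j) := by
  cases j with
  | zero => exact K_nice n n
  | succ j => exact (K_nice _ _).sub (K_nice _ _)

lemma Dk_sum (n : ℤ) (J : ℕ) (x : V d) : ∑ j ∈ Finset.range (J + 1), Dk n j x = K n (n - J) x := by
  induction J with
  | zero => simp [Dk]
  | succ J ih => rw [Finset.sum_range_succ, ih]; simp [Dk]

lemma ft_sub {f g : V d → ℝ} (hf : Nice f) (hg : Nice g) (ξ : V d) :
    ft (fun x => f x - g x) ξ = ft f ξ - ft g ξ := by
  simp only [ft, Real.fourier_eq]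
  have h1 : Integrable fun x => ((f x : ℝ) : ℂ) := hf.int.ofReal
  have h2 : Integrable fun x => ((g x : ℝ) : ℂ) := hg.int.ofReal
  rw [← integral_sub ((Real.fourierIntegral_convergent_iff _).2 h1) ((Real.fourierIntegral_convergent_iff _).2 h2)]
  refine integral_congr_ae (ae_of_all _ fun y => ?_)
  simp [smul_sub]

lemma scal {M δ : ℝ} (hM : 0 < M) (h0 : 0 < δ) (h1 : δ ≤ 1 / 4) :
    M ^ (-δ) * min 2 (4 * Real.pi * M) ≤ 8 * Real.pi * ((2:ℝ) ^ (-δ)) ^ (Int.log 2 M).natAbs := by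
  set l := Int.log 2 M with hl
  have hlo : (2:ℝ) ^ l ≤ M := by exact_mod_cast Int.zpow_log_le_self (b := 2) (by norm_num) hM
  have hhi : M < (2:ℝ) ^ (l + 1) := by exact_mod_cast Int.lt_zpow_succ_log_self (b := 2) (by norm_num) M
  have hpi := Real.pi_gt_three
  have hr : ∀ k : ℕ, ((2:ℝ) ^ (-δ)) ^ k = ((2:ℝ) ^ k) ^ (-δ) := by
    intro k
    rw [← Real.rpow_natCast, ← Real.rpow_mul (by norm_num), mul_comm, Real.rpow_mul (by norm_num), Real.rpow_natCast]
  rw [hr]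
  rcases le_or_gt 0 l with h | h
  · obtain ⟨k, hk⟩ := Int.eq_ofNat_of_zero_le h
    rw [hk] at hlo ⊢
    simp only [Int.natAbs_natCast, zpow_natCast] at hlo ⊢
    have : M ^ (-δ) ≤ ((2:ℝ) ^ k) ^ (-δ) := Real.rpow_le_rpow_of_nonpos (by positivity) hlo (by linarith)
    calc _ ≤ ((2:ℝ) ^ k) ^ (-δ) * 2 := mul_le_mul this (min_le_left _ _) (by positivity) (by positivity)
      _ ≤ _ := by
        have : 0 < ((2:ℝ) ^ k) ^ (-δ) := by positivity
        nlinarith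
  · obtain ⟨k, hk⟩ : ∃ k : ℕ, l = -(k:ℤ) - 1 := ⟨(-l - 1).toNat, by omega⟩
    have hk' : l + 1 = -(k:ℤ) := by omega
    have hn : l.natAbs = k + 1 := by omega
    rw [hn]
    rw [hk', zpow_neg, zpow_natCast] at hhi
    have hM1 : M ≤ 1 := hhi.le.trans (inv_le_one_of_one_le₀ (one_le_pow₀ (by norm_num)))
    have e1 : M ^ (-δ) * (4 * Real.pi * M) = 4 * Real.pi * M ^ (1 - δ) := by
      rw [show 1 - δ = -δ + 1 by ring, Real.rpow_add hM, Real.rpow_one]; ring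
    have e2 : M ^ (1 - δ) ≤ M ^ δ := Real.rpow_le_rpow_of_exponent_ge hM hM1 (by linarith)
    have e3 : M ^ δ ≤ (((2:ℝ) ^ k)⁻¹) ^ δ := Real.rpow_le_rpow hM.le hhi.le h0.le
    have e4 : (((2:ℝ) ^ k)⁻¹) ^ δ = ((2:ℝ) ^ k) ^ (-δ) := by
      rw [Real.inv_rpow (by positivity), Real.rpow_neg (by positivity)]
    have e5 : ((2:ℝ) ^ k) ^ (-δ) ≤ 2 * ((2:ℝ) ^ (k + 1)) ^ (-δ) := by
      rw [pow_succ, Real.mul_rpow (by positivity) (by positivity)]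
      have : (1:ℝ) / 2 ≤ (2:ℝ) ^ (-δ) := by
        calc (1:ℝ)/2 = (2:ℝ) ^ (-1:ℝ) := by rw [Real.rpow_neg_one]; norm_num
          _ ≤ _ := Real.rpow_le_rpow_of_exponent_le (by norm_num) (by linarith)
      have h3 : 0 < ((2:ℝ) ^ k) ^ (-δ) := by positivity
      nlinarith
    calc _ ≤ M ^ (-δ) * (4 * Real.pi * M) := mul_le_mul_of_nonneg_left (min_le_right _ _) (by positivity)
      _ = 4 * Real.pi * M ^ (1 - δ) := e1
      _ ≤ 4 * Real.pi * (2 * ((2:ℝ) ^ (k + 1)) ^ (-δ)) := by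
          refine mul_le_mul_of_nonneg_left ?_ (by positivity)
          linarith
      _ = _ := by ring

lemma summ {r : ℝ} (h0 : 0 ≤ r) (h1 : r < 1) : Summable fun l : ℤ => r ^ l.natAbs := by
  refine Summable.of_nat_of_neg ?_ ?_ <;> simpa using summable_geometric_of_lt_one h0 h1

/-- the key L² symbol estimate -/
lemma symbol (hd : 1 ≤ d) : ∃ C : ℝ, 0 < C ∧ ∃ ρ : ℝ, 0 < ρ ∧ ρ < 1 ∧ ∀ (j : ℕ) (S : Finset ℤ) (ξ : V d),
    ∑ n ∈ S, ‖ft (Dk n (j + 1)) ξ‖ ^ 2 ≤ C * ρ ^ j := by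
  obtain ⟨C, hC, hnu⟩ := nu_decay hd
  set δ : ℝ := 1 / (4 * d) with hδ
  have hd' : (1:ℝ) ≤ d := by exact_mod_cast hd
  have hδ0 : 0 < δ := by positivity
  have hδ1 : δ ≤ 1 / 4 := by
    rw [hδ]; exact one_div_le_one_div_of_le (by norm_num) (by linarith)
  set r : ℝ := (2:ℝ) ^ (-δ) with hr
  have hr0 : 0 < r := by positivity
  have hr1 : r < 1 := Real.rpow_lt_one_of_one_lt_of_neg (by norm_num) (by linarith)
  set T : ℝ := ∑' l : ℤ, (r ^ 2) ^ l.natAbs with hT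
  have hs := summ (r := r ^ 2) (by positivity) (pow_lt_one₀ hr0.le hr1 (by norm_num))
  have hT0 : 0 < T := hs.tsum_pos (fun l => by positivity) 0 (by positivity)
  have hpi := Real.pi_pos
  refine ⟨(C * (8 * Real.pi)) ^ 2 * T, by positivity, r ^ 2, by positivity, pow_lt_one₀ hr0.le hr1 (by norm_num), fun j S ξ => ?_⟩
  have hft : ∀ n : ℤ, ft (Dk n (j + 1)) ξ = nu n ξ * (ft (chi (n - ((j:ℤ)+1))) ξ - ft (chi (n - j)) ξ) := by
    intro n
    simp only [Dk]
    rw [ft_sub (K_nice _ _) (K_nice _ _), ft_K, ft_K]; ring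
  rcases eq_or_ne ξ 0 with h0 | h0
  · have : ∀ n : ℤ, ‖ft (Dk n (j + 1)) ξ‖ ^ 2 = 0 := by
      intro n
      have hz : ∀ m : ℤ, ft (chi m) ξ = 1 := by
        intro m
        have := ft_chi_sub m ξ
        simp only [h0, NN, PiLp.zero_apply, abs_zero, zero_mul, Finset.sum_const_zero, mul_zero, norm_le_zero_iff, sub_eq_zero] at this
        rw [h0]; exact this
      rw [hft, hz, hz]; simp
    simp only [this, Finset.sum_const_zero]
    positivity
  · set l : ℤ → ℤ := fun n => Int.log 2 (NN (n - j) ξ) with hl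
    have hpt : ∀ n, ‖ft (Dk n (j + 1)) ξ‖ ^ 2 ≤ (C * (8 * Real.pi)) ^ 2 * (r ^ 2) ^ j * (r ^ 2) ^ (l n).natAbs := by
      intro n
      set M := NN (n - j) ξ with hM
      have hM0 : 0 < M := NN_pos _ h0
      have h1 : ‖nu n ξ‖ ≤ C * (r ^ j * M ^ (-δ)) := by
        refine (hnu n ξ h0).trans (mul_le_mul_of_nonneg_left ?_ hC.le)
        have h2 : 2 ^ j * M ≤ NN n ξ := by
          have := NN_add (n - j) j ξ
          rwa [sub_add_cancel] at this
        calc NN n ξ ^ (-δ) ≤ (2 ^ j * M) ^ (-δ) := Real.rpow_le_rpow_of_nonpos (by positivity) h2 (by linarith)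
          _ = _ := by
            rw [Real.mul_rpow (by positivity) hM0.le, hr, ← Real.rpow_natCast, ← Real.rpow_natCast, ← Real.rpow_mul (by norm_num),
              ← Real.rpow_mul (by norm_num), mul_comm (j:ℝ)]
      have h2 : ‖ft (chi (n - ((j:ℤ)+1))) ξ - ft (chi (n - j)) ξ‖ ≤ min 2 (4 * Real.pi * M) := by
        refine le_min ?_ ?_
        · exact (norm_sub_le _ _).trans (by linarith [ft_chi_le (n - ((j:ℤ)+1)) ξ, ft_chi_le (n - j) ξ])
        · have a1 := ft_chi_sub (n - ((j:ℤ)+1)) ξ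
          have a2 := ft_chi_sub (n - j) ξ
          have a3 : NN (n - ((j:ℤ)+1)) ξ ≤ M := by
            have := NN_succ (n - ((j:ℤ)+1)) ξ
            rw [show n - ((j:ℤ)+1) + 1 = n - j by ring] at this
            linarith [NN_nonneg (n - ((j:ℤ)+1)) ξ]
          calc _ = ‖(ft (chi (n - ((j:ℤ)+1))) ξ - 1) - (ft (chi (n - j)) ξ - 1)‖ := by congr 1; ring
            _ ≤ _ := (norm_sub_le _ _).trans (by nlinarith)
      have h3 : ‖ft (Dk n (j + 1)) ξ‖ ≤ C * (8 * Real.pi) * r ^ j * r ^ (l n).natAbs := by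
        rw [hft, norm_mul]
        calc _ ≤ (C * (r ^ j * M ^ (-δ))) * min 2 (4 * Real.pi * M) := mul_le_mul h1 h2 (norm_nonneg _) (by positivity)
          _ = C * r ^ j * (M ^ (-δ) * min 2 (4 * Real.pi * M)) := by ring
          _ ≤ C * r ^ j * (8 * Real.pi * r ^ (l n).natAbs) := mul_le_mul_of_nonneg_left (scal hM0 hδ0 hδ1) (by positivity)
          _ = _ := by ring
      calc _ ≤ (C * (8 * Real.pi) * r ^ j * r ^ (l n).natAbs) ^ 2 := pow_le_pow_left₀ (norm_nonneg _) h3 2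
        _ = _ := by ring
    have hinj : Function.Injective l := by
      refine StrictMono.injective (strictMono_int_of_lt_succ fun n => ?_)
      have p0 := NN_pos (n - j) h0
      have p1 := NN_pos (n + 1 - j) h0
      have h2 := NN_succ (n - j) ξ
      rw [show n - (j:ℤ) + 1 = n + 1 - j by ring] at h2
      have hlo : (2:ℝ) ^ (l n) ≤ NN (n - j) ξ := by exact_mod_cast Int.zpow_log_le_self (b := 2) (by norm_num) p0
      have : l n + 1 ≤ l (n + 1) := by
        refine (Int.zpow_le_iff_le_log (by norm_num) p1).1 ?_
        push_cast
        rw [zpow_add₀ (by norm_num), zpow_one]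
        linarith
      omega
    calc _ ≤ ∑ n ∈ S, (C * (8 * Real.pi)) ^ 2 * (r ^ 2) ^ j * (r ^ 2) ^ (l n).natAbs := Finset.sum_le_sum fun n _ => hpt n
      _ = (C * (8 * Real.pi)) ^ 2 * (r ^ 2) ^ j * ∑ n ∈ S, (r ^ 2) ^ (l n).natAbs := by rw [Finset.mul_sum]
      _ ≤ (C * (8 * Real.pi)) ^ 2 * (r ^ 2) ^ j * T := by
          refine mul_le_mul_of_nonneg_left ?_ (by positivity)
          rw [← Finset.sum_image (f := fun l : ℤ => (r ^ 2) ^ l.natAbs) (hinj.injOn)]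
          exact hs.sum_le_tsum _ fun l _ => by positivity
      _ = _ := by ring
end fb
end Radon

namespace Radon
open MeasureTheory

section hor
variable {d : ℕ}

lemma K_meas_sub (n m : ℤ) (y : V d) : Measurable fun x => K n m (x - y) := (K_sm n m).measurable.comp (by fun_prop)

lemma Dk_diff (n : ℤ) (j : ℕ) (y c : V d) {B : ℝ≥0∞}
    (hB : ∀ m, n - j ≤ m → ∫⁻ x, ‖K n m (x - y) - K n m (x - c)‖ₑ ≤ B) :
    ∫⁻ x, ‖Dk n j (x - y) - Dk n j (x - c)‖ₑ ≤ 2 * B := by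
  cases j with
  | zero =>
    refine (hB n (by simp)).trans ?_
    rw [two_mul]; exact le_self_add
  | succ j =>
    simp only [Dk]
    calc _ ≤ ∫⁻ x, (‖K n (n - ((j:ℤ)+1)) (x - y) - K n (n - ((j:ℤ)+1)) (x - c)‖ₑ + ‖K n (n - j) (x - y) - K n (n - j) (x - c)‖ₑ) := by
          refine lintegral_mono fun x => ?_
          refine le_trans (le_of_eq ?_) enorm_sub_le
          congr 1; ring
      _ ≤ _ := by
          have hme : Measurable fun x => ‖K n (n - ((j:ℤ)+1)) (x - y) - K n (n - ((j:ℤ)+1)) (x - c)‖ₑ :=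
            ((K_meas_sub _ _ _).sub (K_meas_sub _ _ _)).enorm
          rw [lintegral_add_left hme, two_mul]
          exact add_le_add (hB _ (by push_cast; rfl)) (hB _ (by push_cast; omega))

lemma Dk_four (n : ℤ) (j : ℕ) (y c : V d) : ∫⁻ x, ‖Dk n j (x - y) - Dk n j (x - c)‖ₑ ≤ 4 :=
  (Dk_diff n j y c fun m _ => K_two n m y c).trans (by norm_num)

lemma scl_ratio {m m' : ℤ} (h : m ≤ m') (i : Fin d) : scl m i / scl m' i ≤ (2:ℝ) ^ (m - m') := by
  have e : scl m i / scl m' i = scl (m - m') i := by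
    rw [div_eq_iff (scl_pos m' i).ne', ← scl_add]; congr 1; ring
  rw [e, scl]
  refine zpow_le_zpow_right₀ (by norm_num) ?_
  nlinarith [Int.natCast_nonneg (i:ℕ)]

lemma Dk_geo {n m : ℤ} {j : ℕ} (h : m ≤ n - j) {y c : V d} (hyc : ∀ i, |y i - c i| ≤ scl m i) :
    ∫⁻ x, ‖Dk n j (x - y) - Dk n j (x - c)‖ₑ ≤ ENNReal.ofReal (4 * (d * (2:ℝ) ^ (m - (n - j)))) := by
  rw [show 4 * (d * (2:ℝ) ^ (m - (n - j))) = 2 * (2 * (d * (2:ℝ) ^ (m - (n - j)))) by ring, ENNReal.ofReal_mul (by norm_num)]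
  simp only [ENNReal.ofReal_ofNat]
  refine Dk_diff n j y c fun m' hm' => (K_trans n m' y c).trans (ENNReal.ofReal_le_ofReal ?_)
  gcongr
  calc ∑ i, |y i - c i| / scl m' i ≤ ∑ i : Fin d, (2:ℝ) ^ (m - (n - j)) := by
        refine Finset.sum_le_sum fun i _ => ?_
        calc _ ≤ scl m i / scl m' i := div_le_div_of_nonneg_right (hyc i) (scl_pos _ _).le
          _ ≤ _ := (scl_ratio (by omega) i).trans (zpow_le_zpow_right₀ (by norm_num) (by omega))
    _ = _ := by simp

lemma K_far {n m m' : ℤ} (h : n ≤ m) (h' : m' ≤ n) {z : V d} {i : Fin d} (hz : 2 * scl m i ≤ |z i|) : K n m' z = 0 := by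
  by_contra hc
  have h1 := K_supp hc i
  rw [abs_of_nonneg h1.1] at hz
  have := h1.2
  linarith [scl_mono h i, scl_mono (h'.trans h) i]

lemma Dk_far {n m : ℤ} (j : ℕ) (h : n ≤ m) {z : V d} {i : Fin d} (hz : 2 * scl m i ≤ |z i|) : Dk n j z = 0 := by
  cases j with
  | zero => exact K_far h le_rfl hz
  | succ j =>
    simp only [Dk]
    rw [K_far h (by omega) hz, K_far h (by omega) hz, sub_zero]

lemma geo_tsum (j : ℕ) (c : ℝ) (hc : 0 ≤ c) :
    ∑' e : ℕ, (if e < j then (4 : ℝ≥0∞) else ENNReal.ofReal (c * (1 / 2) ^ (e - j + 1))) = ENNReal.ofReal (4 * j + c) := by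
  rw [← Summable.sum_add_tsum_nat_add' (k := j) ENNReal.summable]
  have e1 : ∑ e ∈ Finset.range j, (if e < j then (4 : ℝ≥0∞) else ENNReal.ofReal (c * (1 / 2) ^ (e - j + 1))) = ENNReal.ofReal (4 * j) := by
    rw [Finset.sum_congr rfl (g := fun _ => (4 : ℝ≥0∞)) fun e he => by rw [if_pos (Finset.mem_range.1 he)]]
    rw [Finset.sum_const, Finset.card_range, nsmul_eq_mul, ENNReal.ofReal_mul (by norm_num)]
    simp [mul_comm]
  have e2 : ∑' e : ℕ, (if e + j < j then (4 : ℝ≥0∞) else ENNReal.ofReal (c * (1 / 2) ^ (e + j - j + 1))) = ENNReal.ofReal c := by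
    have h : HasSum (fun e : ℕ => c * (1 / 2 : ℝ) ^ (e + 1)) c := by
      have := (hasSum_geometric_two.mul_left (c / 2))
      rw [show c / 2 * 2 = c by ring] at this
      refine this.congr_fun ?_
      intro e; rw [pow_succ]; ring
    simp only [show ∀ e, ¬ (e + j < j) by omega, if_false, Nat.add_sub_cancel]
    rw [← ENNReal.ofReal_tsum_of_nonneg (fun e => by positivity) h.summable, h.tsum_eq]
  rw [e1, e2, ENNReal.ofReal_add (by positivity) hc]

lemma hor_sum (S : Finset ℤ) (j : ℕ) (m : ℤ) (y c : V d) (hyc : ∀ i, |y i - c i| ≤ scl m i) :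
    ∑ n ∈ S, ∫⁻ x in {x : V d | ∃ i, 4 * scl m i < |x i - c i|}, ‖Dk n j (x - y) - Dk n j (x - c)‖ₑ ≤
      ENNReal.ofReal (4 * j + 4 * d) := by
  classical
  set F : Set (V d) := {x : V d | ∃ i, 4 * scl m i < |x i - c i|} with hF
  have hFm : MeasurableSet F := by
    have : F = ⋃ i, {x : V d | 4 * scl m i < |x i - c i|} := by ext x; simp [hF]
    rw [this]
    exact MeasurableSet.iUnion fun i => measurableSet_lt measurable_const (by fun_prop)
  set b : ℕ → ℝ≥0∞ := fun e => if e < j then (4 : ℝ≥0∞) else ENNReal.ofReal (4 * d * (1 / 2) ^ (e - j + 1)) with hb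
  have hpt : ∀ n, ∫⁻ x in F, ‖Dk n j (x - y) - Dk n j (x - c)‖ₑ ≤ if m < n then b (n - m - 1).toNat else 0 := by
    intro n
    split_ifs with hn
    · refine (setLIntegral_le_lintegral _ _).trans ?_
      simp only [hb]
      split_ifs with he
      · exact Dk_four n j y c
      · obtain ⟨e, he'⟩ : ∃ e : ℕ, n = m + j + 1 + e := ⟨(n - m - j - 1).toNat, by omega⟩
        refine (Dk_geo (m := m) (by omega) hyc).trans (le_of_eq ?_)
        have e1 : (n - m - 1).toNat - j + 1 = e + 1 := by omega
        rw [e1, show m - (n - (j:ℤ)) = -((e + 1 : ℕ) : ℤ) by push_cast; omega, zpow_neg, zpow_natCast, one_div, inv_pow]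
        congr 1; ring
    · refine le_of_eq ((setLIntegral_congr_fun hFm (g := fun _ => 0) fun x hx => ?_).trans (by simp))
      obtain ⟨i, hi⟩ := hx
      have hs := scl_pos m i
      have h1 : Dk n j (x - c) = 0 := Dk_far j (not_lt.1 hn) (i := i) (by simp only [PiLp.sub_apply]; linarith)
      have h2 : Dk n j (x - y) = 0 := by
        refine Dk_far j (not_lt.1 hn) (i := i) ?_
        simp only [PiLp.sub_apply]
        have := abs_sub_abs_le_abs_sub (x i - c i) (y i - c i)
        rw [sub_sub_sub_cancel_right] at this
        linarith [hyc i]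
      simp [h1, h2]
  calc _ ≤ ∑ n ∈ S, if m < n then b (n - m - 1).toNat else 0 := Finset.sum_le_sum fun n _ => hpt n
    _ = ∑ n ∈ S.filter (fun n => m < n), b (n - m - 1).toNat := by rw [Finset.sum_filter]
    _ = ∑ e ∈ (S.filter (fun n => m < n)).image (fun n => (n - m - 1).toNat), b e := by
        rw [Finset.sum_image]
        intro n hn n' hn' h
        simp only [Finset.coe_filter, Set.mem_ofPred_eq] at hn hn'
        dsimp only at h
        omega
    _ ≤ ∑' e, b e := ENNReal.sum_le_tsum _
    _ = _ := geo_tsum j (4 * d) (by positivity)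

variable {E F : Type*} [NormedAddCommGroup E] [NormedSpace ℝ E]
  [NormedAddCommGroup F] [NormedSpace ℝ F]

/-- operator valued kernel -/
def opk (S : Finset ℤ) (L : ℤ → E →L[ℝ] F) (j : ℕ) (x : V d) : E →L[ℝ] F := ∑ n ∈ S, Dk n j x • L n

lemma Nice.smul_const {g : V d → ℝ} (hg : Nice g) (e : E) : Nice (fun x => g x • e) := by
  obtain ⟨B, hB⟩ := hg.bd
  refine ⟨hg.sm.smul_const e, hg.int.smul_const e, B * ‖e‖, fun x => ?_⟩
  rw [norm_smul]; exact mul_le_mul_of_nonneg_right (hB x) (norm_nonneg _)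

lemma opk_nice (S : Finset ℤ) (L : ℤ → E →L[ℝ] F) (j : ℕ) : Nice (opk (d := d) S L j) :=
  Nice.sum S fun n _ => (Dk_nice n j).smul_const (L n)

lemma opk_diff (S : Finset ℤ) {L : ℤ → E →L[ℝ] F} (hL : ∀ n, ‖L n‖ ≤ 1) (j : ℕ) (u v : V d) :
    ‖opk S L j u - opk S L j v‖ₑ ≤ ∑ n ∈ S, ‖Dk n j u - Dk n j v‖ₑ := by
  unfold opk
  rw [← Finset.sum_sub_distrib]
  refine (enorm_sum_le S fun n => (Dk n j u • L n - Dk n j v • L n : E →L[ℝ] F)).trans (Finset.sum_le_sum fun n _ => ?_)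
  rw [← sub_smul, enorm_smul]
  refine (mul_le_mul_right (b := ‖L n‖ₑ) (c := 1) ?_ _).trans (by rw [mul_one])
  rw [← ofReal_norm]
  exact ENNReal.ofReal_le_one.2 (hL n)

lemma Dk_meas_diff (n : ℤ) (j : ℕ) (y c : V d) : Measurable fun x => ‖Dk n j (x - y) - Dk n j (x - c)‖ₑ :=
  (((Dk_nice n j).sm.measurable.comp (by fun_prop : Measurable fun x : V d => x - y)).sub
    ((Dk_nice n j).sm.measurable.comp (by fun_prop : Measurable fun x : V d => x - c))).enorm

lemma opk_ok (S : Finset ℤ) {L : ℤ → E →L[ℝ] F} (hL : ∀ n, ‖L n‖ ≤ 1) (j : ℕ) {A : ℝ≥0∞}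
    (hl2 : ∀ f : V d → E, Nice f → ∫⁻ x, ‖cv (opk S L j) f x‖ₑ ^ 2 ≤ A * ∫⁻ x, ‖f x‖ₑ ^ 2) :
    KerOK (d := d) (opk S L j) A (ENNReal.ofReal (4 * j + 4 * d)) := by
  refine ⟨opk_nice S L j, hl2, fun m y c hyc => ?_, ?_⟩
  · refine (lintegral_mono fun x => opk_diff S hL j _ _).trans ?_
    rw [lintegral_finsetSum _ fun n _ => Dk_meas_diff n j y c]
    exact hor_sum S j m y c hyc
  · obtain ⟨a, ha⟩ : ∃ a : ℤ, ∀ n ∈ S, a ≤ n - j := by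
      obtain ⟨a, ha⟩ := S.bddBelow
      exact ⟨a - j, fun n hn => by have := ha hn; omega⟩
    set N : ℕ := S.card * 4 * d with hN
    refine ⟨a - N, fun y c hyc => ?_⟩
    refine (lintegral_mono fun x => opk_diff S hL j _ _).trans ?_
    rw [lintegral_finsetSum _ fun n _ => Dk_meas_diff n j y c]
    calc _ ≤ ∑ n ∈ S, ENNReal.ofReal (4 * (d * (2:ℝ) ^ (-(N:ℤ)))) := by
          refine Finset.sum_le_sum fun n hn => ?_
          have := ha n hn
          refine (Dk_geo (m := a - N) (by omega) hyc).trans (ENNReal.ofReal_le_ofReal ?_)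
          gcongr 4 * (d * ?_)
          exact zpow_le_zpow_right₀ (by norm_num) (by omega)
      _ = ENNReal.ofReal (N * ((2:ℝ) ^ N)⁻¹) := by
          rw [Finset.sum_const, nsmul_eq_mul, zpow_neg, zpow_natCast, ← ENNReal.ofReal_natCast, ← ENNReal.ofReal_mul (by positivity)]
          congr 1; rw [hN]; push_cast; ring
      _ ≤ 1 := by
          refine ENNReal.ofReal_le_one.2 ?_
          rw [← div_eq_mul_inv, div_le_one (by positivity)]
          exact_mod_cast (Nat.lt_two_pow_self).le
end hor
end Radon

namespace Radon
open MeasureTheory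

section abs
variable {d : ℕ} {E F : Type*} [NormedAddCommGroup E] [NormedSpace ℝ E]
  [NormedAddCommGroup F] [NormedSpace ℝ F]

def cj (d : ℕ) (p a h : ℝ) : ℝ := |cm d p| * (1 + a + h) * a ^ (p - 1) + a

lemma eLp_rpow {G : Type*} [NormedAddCommGroup G] {p : ℝ} (hp : 0 < p) (g : V d → G) :
    eLpNorm g (ENNReal.ofReal p) volume = (∫⁻ x, ENNReal.ofReal (‖g x‖ ^ p)) ^ (1 / p) := by
  rw [eLpNorm_eq_lintegral_rpow_enorm_toReal (by simpa using hp) (by simp), ENNReal.toReal_ofReal hp.le]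
  congr 1
  refine lintegral_congr fun x => ?_
  rw [← ofReal_norm, ENNReal.ofReal_rpow_of_nonneg (norm_nonneg _) hp.le]

lemma strong2 [CompleteSpace E] [CompleteSpace F] (hd : 0 < d) {k : V d → E →L[ℝ] F} {a h p : ℝ} (ha : 0 < a) (hh : 0 ≤ h) (hp1 : 1 < p) (hp2 : p ≤ 2)
    (hk : KerOK k (ENNReal.ofReal a) (ENNReal.ofReal h)) {f : V d → E} (hf : Nice f) :
    eLpNorm (cv k f) (ENNReal.ofReal p) volume ≤ ENNReal.ofReal (cj d p a h ^ (1 / p)) * eLpNorm f (ENNReal.ofReal p) volume := by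
  have hp0 : 0 < p := by linarith
  have hcj : 0 ≤ cj d p a h := by unfold cj; positivity
  rw [eLp_rpow hp0, eLp_rpow hp0, ← ENNReal.ofReal_rpow_of_nonneg hcj (by positivity), ← ENNReal.mul_rpow_of_nonneg _ _ (by positivity)]
  refine ENNReal.rpow_le_rpow ?_ (by positivity)
  rcases hp2.lt_or_eq with hlt | rfl
  · refine (strongp hd ha hh hp1 hlt hk hf).trans ?_
    refine mul_le_mul_left (ENNReal.ofReal_le_ofReal ?_) _
    unfold cj
    have : cm d p * (1 + a + h) * a ^ (p - 1) ≤ |cm d p| * (1 + a + h) * a ^ (p - 1) := by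
      gcongr; exact le_abs_self _
    linarith
  · have e : ∀ (G : Type _) [NormedAddCommGroup G] (g : V d → G), ∫⁻ x, ENNReal.ofReal (‖g x‖ ^ (2:ℝ)) = ∫⁻ x, ‖g x‖ₑ ^ 2 := by
      intro G _ g
      refine lintegral_congr fun x => ?_
      rw [Real.rpow_two, ENNReal.ofReal_pow (norm_nonneg _), ofReal_norm]
    have e' : ∫⁻ x, ENNReal.ofReal (‖f x‖ ^ (2:ℝ)) = ∫⁻ x, ‖f x‖ₑ ^ 2 := by
      refine lintegral_congr fun x => ?_
      rw [Real.rpow_two, ENNReal.ofReal_pow (norm_nonneg _), ofReal_norm]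
    rw [e, e']
    refine (hk.l2 f hf).trans (mul_le_mul_left (ENNReal.ofReal_le_ofReal ?_) _)
    unfold cj
    have : 0 ≤ |cm d 2| * (1 + a + h) * a ^ ((2:ℝ) - 1) := by positivity
    linarith

def aj (a0 C ρ : ℝ) : ℕ → ℝ
  | 0 => a0
  | j + 1 => C * ρ ^ j

def ctot (d : ℕ) (p a0 C ρ : ℝ) : ℝ≥0∞ := ∑' j : ℕ, ENNReal.ofReal (cj d p (aj a0 C ρ j) (4 * j + 4 * d) ^ (1 / p))

lemma ctot_ne (d : ℕ) {p a0 C ρ : ℝ} (hp1 : 1 < p) (hp2 : p ≤ 2) (ha : 0 < a0) (hC : 0 < C) (h0 : 0 < ρ) (h1 : ρ < 1) :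
    ctot d p a0 C ρ ≠ ∞ := by
  have hp0 : 0 < p := by linarith
  have key : Summable fun j : ℕ => cj d p (aj a0 C ρ (j+1)) (4 * (j+1 : ℕ) + 4 * d) ^ (1 / p) := by
    set θ : ℝ := ρ ^ (p - 1) with hθ
    have hθ0 : 0 < θ := by positivity
    have hθ1 : θ < 1 := Real.rpow_lt_one h0.le h1 (by linarith)
    have hρθ : ρ ≤ θ := by
      calc ρ = ρ ^ (1:ℝ) := (Real.rpow_one _).symm
        _ ≤ _ := Real.rpow_le_rpow_of_exponent_ge h0 h1.le (by linarith)
    set Q : ℝ := |cm d p| * (5 + C + 4 * d) * C ^ (p - 1) + C with hQ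
    have hQ0 : 0 < Q := by positivity
    have hb : ∀ j : ℕ, cj d p (aj a0 C ρ (j+1)) (4 * (j+1 : ℕ) + 4 * d) ≤ Q * ((j + 1) * θ ^ j) := by
      intro j
      simp only [aj, cj]
      have e1 : (C * ρ ^ j) ^ (p - 1) = C ^ (p - 1) * θ ^ j := by
        rw [Real.mul_rpow hC.le (by positivity), hθ, ← Real.rpow_natCast, ← Real.rpow_natCast, ← Real.rpow_mul h0.le, ← Real.rpow_mul h0.le, mul_comm (j:ℝ)]
      rw [e1]
      have e2 : ρ ^ j ≤ 1 := pow_le_one₀ h0.le h1.le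
      have e3 : ρ ^ j ≤ θ ^ j := pow_le_pow_left₀ h0.le hρθ j
      have e4 : (1 + C * ρ ^ j + (4 * ((j+1 : ℕ):ℝ) + 4 * d)) ≤ (5 + C + 4 * d) * (j + 1) := by
        push_cast
        have : (0:ℝ) ≤ j := by positivity
        have hd0 : (0:ℝ) ≤ d := by positivity
        nlinarith [mul_nonneg hd0 this, mul_nonneg hC.le this]
      have e5 : (1:ℝ) ≤ j + 1 := by linarith [(Nat.cast_nonneg j : (0:ℝ) ≤ j)]
      calc _ ≤ |cm d p| * ((5 + C + 4 * d) * (j + 1)) * (C ^ (p - 1) * θ ^ j) + C * (θ ^ j * (j + 1)) := by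
            gcongr
            nlinarith [pow_pos hθ0 j]
        _ = _ := by rw [hQ]; ring
    set η : ℝ := θ ^ (1 / p) with hη
    have hη0 : 0 < η := by positivity
    have hη1 : η < 1 := Real.rpow_lt_one hθ0.le hθ1 (by positivity)
    have hs : Summable fun j : ℕ => Q ^ (1 / p) * (((j:ℝ) + 1) * η ^ j) := by
      refine Summable.mul_left _ ?_
      have s1 := summable_pow_mul_geometric_of_norm_lt_one 1 (r := η) (by rwa [Real.norm_of_nonneg hη0.le])
      have s2 := summable_geometric_of_lt_one hη0.le hη1
      refine (s1.add s2).congr fun j => ?_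
      ring
    refine Summable.of_nonneg_of_le (fun j => ?_) (fun j => ?_) hs
    · refine Real.rpow_nonneg ?_ _
      simp only [cj, aj]; positivity
    · have hnn : 0 ≤ cj d p (aj a0 C ρ (j+1)) (4 * (j+1 : ℕ) + 4 * d) := by simp only [cj, aj]; positivity
      refine (Real.rpow_le_rpow hnn (hb j) (by positivity)).trans ?_
      rw [Real.mul_rpow hQ0.le (by positivity), Real.mul_rpow (by positivity) (by positivity)]
      have e6 : (θ ^ j) ^ (1 / p) = η ^ j := by
        rw [hη, ← Real.rpow_natCast, ← Real.rpow_natCast, ← Real.rpow_mul hθ0.le, ← Real.rpow_mul hθ0.le, mul_comm (j:ℝ)]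
      rw [e6]
      gcongr
      have e5 : (1:ℝ) ≤ j + 1 := by linarith [(Nat.cast_nonneg j : (0:ℝ) ≤ j)]
      calc ((j:ℝ) + 1) ^ (1 / p) ≤ ((j:ℝ) + 1) ^ (1:ℝ) := Real.rpow_le_rpow_of_exponent_le e5 (by rw [div_le_one hp0]; exact hp1.le)
        _ = _ := Real.rpow_one _
  unfold ctot
  rw [tsum_eq_zero_add' ENNReal.summable]
  refine ENNReal.add_ne_top.2 ⟨ENNReal.ofReal_ne_top, ?_⟩
  exact key.tsum_ofReal_ne_top

def Kop (S : Finset ℤ) (L : ℤ → E →L[ℝ] F) (J : ℕ) (x : V d) : E →L[ℝ] F := ∑ n ∈ S, K n (n - J) x • L n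

lemma Kop_eq (S : Finset ℤ) (L : ℤ → E →L[ℝ] F) (J : ℕ) (x : V d) :
    Kop S L J x = ∑ j ∈ Finset.range (J + 1), opk S L j x := by
  simp only [Kop, opk, ← Dk_sum, Finset.sum_smul]
  exact Finset.sum_comm

lemma cv_sum {ι : Type*} (R : Finset ι) {k : ι → V d → E →L[ℝ] F} (hk : ∀ j, Nice (k j)) {f : V d → E} (hf : Nice f) (x : V d) :
    cv (fun x => ∑ j ∈ R, k j x) f x = ∑ j ∈ R, cv (k j) f x := by
  unfold cv
  rw [← integral_finsetSum _ fun j _ => integrable_ker (hk j) hf.sm hf.int (by fun_prop)]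
  simp only [ContinuousLinearMap.sum_apply]

lemma Kop_strong [CompleteSpace E] [CompleteSpace F] (hd : 0 < d) {p a0 C ρ : ℝ} (hp1 : 1 < p) (hp2 : p ≤ 2)
    (ha : 0 < a0) (hC : 0 < C) (h0 : 0 < ρ)
    (S : Finset ℤ) {L : ℤ → E →L[ℝ] F} (hL : ∀ n, ‖L n‖ ≤ 1)
    (hl2 : ∀ j, ∀ f : V d → E, Nice f → ∫⁻ x, ‖cv (opk S L j) f x‖ₑ ^ 2 ≤ ENNReal.ofReal (aj a0 C ρ j) * ∫⁻ x, ‖f x‖ₑ ^ 2)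
    (J : ℕ) {f : V d → E} (hf : Nice f) :
    eLpNorm (cv (Kop S L J) f) (ENNReal.ofReal p) volume ≤ ctot d p a0 C ρ * eLpNorm f (ENNReal.ofReal p) volume := by
  have e : cv (Kop S L J) f = ∑ j ∈ Finset.range (J + 1), cv (opk S L j) f := by
    funext x
    rw [Finset.sum_apply, ← cv_sum _ (fun j => opk_nice S L j) hf]
    congr 1
    funext x
    exact Kop_eq S L J x
  rw [e]
  refine (eLpNorm_sum_le (fun j _ => (cv_sm (opk_nice S L j) hf.sm).aestronglyMeasurable) (by simpa using hp1.le)).trans ?_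
  rw [ctot, ← ENNReal.tsum_mul_right]
  refine le_trans ?_ (ENNReal.sum_le_tsum (Finset.range (J + 1)))
  refine Finset.sum_le_sum fun j _ => ?_
  refine strong2 hd ?_ (by positivity) hp1 hp2 (opk_ok S hL j (hl2 j)) hf
  cases j with
  | zero => exact ha
  | succ j => simp only [aj]; positivity
end abs
end Radon

namespace Radon
open MeasureTheory

section scal
variable {d : ℕ}

lemma K_le_q (n : ℤ) (x : V d) : ‖K n n x‖ₑ ≤ q n x := by
  by_cases h : K n n x = 0
  · rw [h]; simp
  · have hm : x ∈ {x : V d | ∀ i, |x i| ≤ 2 * scl n i} := by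
      intro i
      have h1 := K_supp h i
      rw [abs_of_nonneg h1.1]; linarith [h1.2]
    unfold q
    rw [Set.indicator_of_mem hm, ← ofReal_norm, Real.norm_of_nonneg (K_nonneg _ _ _), ← ENNReal.ofReal_inv_of_pos (vl_pos d n)]
    exact ENNReal.ofReal_le_ofReal (K_le n n x)

lemma sc_le_cq (n : ℤ) (g : V d → ℝ) (x : V d) : ‖sc (K n n) g x‖ₑ ≤ cq n (fun y => ‖g y‖ₑ) x := by
  unfold sc cq
  refine (enorm_integral_le_lintegral_enorm _).trans (lintegral_mono fun y => ?_)
  rw [enorm_mul]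
  exact mul_le_mul_left (K_le_q n _) _

lemma cqc_ne (d : ℕ) : cqc d ≠ ∞ := by
  unfold cqc; finiteness

lemma cqc_pos (d : ℕ) : cqc d ≠ 0 := by
  unfold cqc
  have : ENNReal.ofReal (vl d 1) ≠ 0 := by simpa using vl_pos d 1
  simp [this]

def a0 (d : ℕ) : ℝ := (cqc d).toReal
lemma a0_pos (d : ℕ) : 0 < a0 d := ENNReal.toReal_pos (cqc_pos d) (cqc_ne d)
lemma ofReal_a0 (d : ℕ) : ENNReal.ofReal (a0 d) = cqc d := ENNReal.ofReal_toReal (cqc_ne d)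

lemma Nice.l2fin {E : Type*} [NormedAddCommGroup E] {g : V d → E} (hg : Nice g) : ∫⁻ x, ‖g x‖ₑ ^ 2 ≠ ∞ := by
  rw [lint_sq_eLp]
  exact ENNReal.pow_ne_top hg.memLp2.2.ne

lemma scal_fwd {C ρ : ℝ} (hs : ∀ (j : ℕ) (S : Finset ℤ) (ξ : V d), ∑ n ∈ S, ‖ft (Dk n (j+1)) ξ‖ ^ 2 ≤ C * ρ ^ j)
    (j : ℕ) (S : Finset ℤ) {g : V d → ℝ} (hg : Nice g) :
    ∫⁻ x, (S.sup fun n => ‖sc (Dk n j) g x‖ₑ) ^ 2 ≤ ENNReal.ofReal (aj (a0 d) C ρ j) * ∫⁻ x, ‖g x‖ₑ ^ 2 := by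
  cases j with
  | zero =>
    simp only [aj, ofReal_a0]
    refine le_trans (lintegral_mono fun x => ?_) (q_fwd S (g := fun x => ‖g x‖ₑ) hg.sm.enorm hg.l2fin)
    exact pow_le_pow_left' (Finset.sup_mono_fun fun n _ => sc_le_cq n g x) 2
  | succ j =>
    simp only [aj]
    refine le_trans (lintegral_mono fun x => ?_) (l2_fwd S (fun n => Dk_nice n (j+1)) (hs j S) hg)
    rcases S.eq_empty_or_nonempty with rfl | hne
    · simp
    · obtain ⟨n, hn, h⟩ := Finset.exists_mem_eq_sup S hne (fun n => ‖sc (Dk n (j+1)) g x‖ₑ)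
      rw [h]
      exact Finset.single_le_sum (f := fun n => ‖sc (Dk n (j+1)) g x‖ₑ ^ 2) (fun _ _ => zero_le) hn

lemma scal_dual {C ρ : ℝ} (hs : ∀ (j : ℕ) (S : Finset ℤ) (ξ : V d), ∑ n ∈ S, ‖ft (Dk n (j+1)) ξ‖ ^ 2 ≤ C * ρ ^ j)
    (j : ℕ) (S : Finset ℤ) {g : ℤ → V d → ℝ} (hg : ∀ n, Nice (g n)) :
    ∫⁻ x, ‖∑ n ∈ S, sc (Dk n j) (g n) x‖ₑ ^ 2 ≤ ENNReal.ofReal (aj (a0 d) C ρ j) * ∫⁻ x, (∑ n ∈ S, ‖g n x‖ₑ) ^ 2 := by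
  cases j with
  | zero =>
    simp only [aj, ofReal_a0]
    have hfin : ∫⁻ x, (∑ n ∈ S, ‖g n x‖ₑ) ^ 2 ≠ ∞ := by
      have h1 : Nice (fun x => ∑ n ∈ S, ‖g n x‖) := Nice.sum S fun n _ => by
        obtain ⟨B, hB⟩ := (hg n).bd
        exact ⟨(hg n).sm.norm, (hg n).int.norm, B, fun x => by simpa using hB x⟩
      convert h1.l2fin using 5 with x
      rw [← ofReal_norm, Real.norm_of_nonneg (by positivity), ENNReal.ofReal_sum_of_nonneg fun _ _ => norm_nonneg _]
      simp only [ofReal_norm]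
    refine le_trans (lintegral_mono fun x => ?_) (q_dual S (fun n x => ‖g n x‖ₑ) (fun n => (hg n).sm.enorm) hfin)
    refine pow_le_pow_left' ?_ 2
    exact (enorm_sum_le _ _).trans (Finset.sum_le_sum fun n _ => sc_le_cq n (g n) x)
  | succ j =>
    simp only [aj]
    refine le_trans (l2_dual S (fun n => Dk_nice n (j+1)) (hs j S) hg) ?_
    refine mul_le_mul_right ?_ _
    rw [← lintegral_finsetSum _ fun n _ => (hg n).sm.enorm.pow_const 2]
    refine lintegral_mono fun x => ?_
    exact Finset.sum_sq_le_sq_sum_of_nonneg (fun _ _ => zero_le)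
end scal

section inst
variable {d : ℕ} {T : Type*} [Fintype T]

lemma Nice.clm {E F : Type*} [NormedAddCommGroup E] [NormedSpace ℝ E]
  [NormedAddCommGroup F] [NormedSpace ℝ F] {f : V d → E} (hf : Nice f) (A : E →L[ℝ] F) : Nice fun x => A (f x) := by
  obtain ⟨B, hB⟩ := hf.bd
  exact ⟨A.continuous.comp_stronglyMeasurable hf.sm, A.integrable_comp hf.int, ‖A‖ * B, fun x =>
    (A.le_opNorm _).trans (mul_le_mul_of_nonneg_left (hB x) (norm_nonneg _))⟩

lemma coord {E F : Type*} [NormedAddCommGroup E] [NormedSpace ℝ E] [CompleteSpace E]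
  [NormedAddCommGroup F] [NormedSpace ℝ F] [CompleteSpace F] (S : Finset ℤ) {D : ℤ → V d → ℝ} (hD : ∀ n, Nice (D n))
  (L : ℤ → E →L[ℝ] F) (A : F →L[ℝ] ℝ) {f : V d → E} (hf : Nice f) (x : V d) :
    A (cv (fun x => ∑ n ∈ S, D n x • L n) f x) = ∑ n ∈ S, sc (D n) (fun y => A (L n (f y))) x := by
  have hk : Nice (fun x => ∑ n ∈ S, D n x • L n) := Nice.sum S fun n _ => (hD n).smul_const (L n)
  unfold cv sc
  rw [← A.integral_comp_comm (integrable_ker hk hf.sm hf.int (by fun_prop)),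
    ← integral_finsetSum (f := fun n y => D n (x - y) * A (L n (f y))) _ fun n _ => sc_integrand (hD n) (hf.clm (A.comp (L n))) x]
  refine integral_congr_ae (ae_of_all _ fun y => ?_)
  simp [ContinuousLinearMap.sum_apply]

lemma enorm_sq_pi {β : T → Type*} [∀ t, NormedAddCommGroup (β t)] (y : PiLp 2 β) : ‖y‖ₑ ^ 2 = ∑ t, ‖y t‖ₑ ^ 2 := by
  simp only [← ofReal_norm, ← ENNReal.ofReal_pow (norm_nonneg _)]
  rw [PiLp.norm_sq_eq_of_L2, ENNReal.ofReal_sum_of_nonneg fun _ _ => by positivity]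

lemma enorm_rp_pi {β : T → Type*} [∀ t, NormedAddCommGroup (β t)] (y : PiLp 2 β) (p : ℝ) :
    ‖y‖ₑ ^ p = (∑ t, ‖y t‖ₑ ^ 2) ^ (p / 2) := by
  rw [← enorm_sq_pi, ← ENNReal.rpow_two, ← ENNReal.rpow_mul]; congr 1; ring

lemma eLp_le {E F : Type*} [NormedAddCommGroup E] [NormedAddCommGroup F] {f : V d → E} {g : V d → F} {p : ℝ} (hp : 0 < p) {c : ℝ≥0∞}
    (h : eLpNorm g (ENNReal.ofReal p) volume ≤ c * eLpNorm f (ENNReal.ofReal p) volume) :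
    ∫⁻ x, ‖g x‖ₑ ^ p ≤ c ^ p * ∫⁻ x, ‖f x‖ₑ ^ p := by
  rw [eLpNorm_eq_lintegral_rpow_enorm_toReal (by simpa using hp) (by simp), eLpNorm_eq_lintegral_rpow_enorm_toReal (by simpa using hp) (by simp),
    ENNReal.toReal_ofReal hp.le] at h
  have := ENNReal.rpow_le_rpow h hp.le
  rw [ENNReal.mul_rpow_of_nonneg _ _ hp.le, ← ENNReal.rpow_mul, ← ENNReal.rpow_mul] at this
  simpa [hp.ne'] using this

/- forward instance -/
abbrev EF (T : Type*) [Fintype T] := EuclideanSpace ℝ T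

def FF (T : Type*) [Fintype T] (S : Finset ℤ) := PiLp 2 (fun _ : T => (S → ℝ))

section
variable {S : Finset ℤ}
instance : NormedAddCommGroup (FF T S) := inferInstanceAs (NormedAddCommGroup (PiLp 2 (fun _ : T => (S → ℝ))))
instance : NormedSpace ℝ (FF T S) := inferInstanceAs (NormedSpace ℝ (PiLp 2 (fun _ : T => (S → ℝ))))
instance : CompleteSpace (FF T S) := inferInstanceAs (CompleteSpace (PiLp 2 (fun _ : T => (S → ℝ))))
def FF.mk (u : T → S → ℝ) : FF T S := (WithLp.toLp 2 u : PiLp 2 (fun _ : T => (S → ℝ)))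
def FF.row (y : FF T S) (t : T) : S → ℝ := WithLp.ofLp (p := 2) (V := T → S → ℝ) y t
lemma FF.row_mk (u : T → S → ℝ) : (FF.mk u).row = u := rfl
lemma FF.row_add (y z : FF T S) (t : T) : (y + z).row t = y.row t + z.row t := rfl
lemma FF.row_smul (c : ℝ) (z : FF T S) (t : T) : (c • z).row t = c • z.row t := rfl
lemma FF.ext {y z : FF T S} (h : ∀ t m, y.row t m = z.row t m) : y = z := by
  have : y.row = z.row := by funext t m; exact h t m
  exact (WithLp.ofLp_injective (p := 2)) this
lemma FF.enorm_sq (y : FF T S) : ‖y‖ₑ ^ 2 = ∑ t, ‖y.row t‖ₑ ^ 2 := enorm_sq_pi (β := fun _ : T => (S → ℝ)) y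
lemma FF.norm_sq (y : FF T S) : ‖y‖ ^ 2 = ∑ t, ‖y.row t‖ ^ 2 := PiLp.norm_sq_eq_of_L2 (fun _ : T => (S → ℝ)) y
lemma FF.enorm_rp (y : FF T S) (p : ℝ) : ‖y‖ₑ ^ p = (∑ t, ‖y.row t‖ₑ ^ 2) ^ (p / 2) := enorm_rp_pi (β := fun _ : T => (S → ℝ)) y p
lemma FF.row_le (y : FF T S) (t : T) : ‖y.row t‖ ≤ ‖y‖ := by
  refine le_of_sq_le_sq ?_ (norm_nonneg _)
  rw [FF.norm_sq]
  exact Finset.single_le_sum (f := fun t => ‖y.row t‖ ^ 2) (fun _ _ => by positivity) (Finset.mem_univ t)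
def pF0 (t : T) (m : S) : FF T S →ₗ[ℝ] ℝ where
  toFun y := y.row t m
  map_add' a b := rfl
  map_smul' a b := rfl
def pF (t : T) (m : S) : FF T S →L[ℝ] ℝ := (pF0 t m).mkContinuous 1 fun y => by
  rw [one_mul]; exact (norm_le_pi_norm (y.row t) m).trans (y.row_le t)
lemma pF_apply (t : T) (m : S) (y : FF T S) : pF t m y = y.row t m := rfl
end

lemma enorm_pi_le {ι : Type*} [Fintype ι] (u : ι → ℝ) {B : ℝ≥0∞} : ‖u‖ₑ ≤ B ↔ ∀ i, ‖u i‖ₑ ≤ B := by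
  induction B with
  | top => simp
  | coe B =>
    simp only [enorm_eq_nnnorm, ENNReal.coe_le_coe]
    exact pi_nnnorm_le_iff

def Lf0 (S : Finset ℤ) (n : ℤ) : EF T →ₗ[ℝ] FF T S where
  toFun e := FF.mk fun t => fun m : S => if m.1 = n then e t else 0
  map_add' a b := by refine FF.ext fun t m => ?_; simp [FF.row_mk, FF.row_add]; split_ifs <;> simp
  map_smul' a b := by refine FF.ext fun t m => ?_; simp [FF.row_mk, FF.row_smul]

lemma Lf0_le (S : Finset ℤ) (n : ℤ) (e : EF T) : ‖Lf0 S n e‖ ≤ 1 * ‖e‖ := by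
  rw [one_mul]
  refine le_of_sq_le_sq ?_ (norm_nonneg _)
  rw [FF.norm_sq, PiLp.norm_sq_eq_of_L2]
  refine Finset.sum_le_sum fun t _ => pow_le_pow_left₀ (norm_nonneg _) ?_ 2
  refine (pi_norm_le_iff_of_nonneg (norm_nonneg _)).2 fun m => ?_
  simp only [Lf0, LinearMap.coe_mk, AddHom.coe_mk, FF.row_mk]
  split_ifs <;> simp

def Lf (S : Finset ℤ) (n : ℤ) : EF T →L[ℝ] FF T S := LinearMap.mkContinuous (E := EF T) (F := FF T S) (Lf0 S n) 1 (by
  intro e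
  have h := Lf0_le S n e
  exact h)

lemma Lf_norm (S : Finset ℤ) (n : ℤ) : ‖Lf (T := T) S n‖ ≤ 1 :=
  ContinuousLinearMap.opNorm_le_bound _ zero_le_one fun e => Lf0_le S n e

lemma Lf_apply (S : Finset ℤ) (n : ℤ) (e : EF T) (t : T) (m : S) : (Lf S n e).row t m = if m.1 = n then e t else 0 := rfl

lemma fwd_coord (S : Finset ℤ) {D : ℤ → V d → ℝ} (hD : ∀ n, Nice (D n)) {f : V d → EF T} (hf : Nice f) (x : V d) (t : T) (m : S) :
    (cv (fun x => ∑ n ∈ S, D n x • Lf S n) f x).row t m = sc (D m) (fun y => f y t) x := by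
  have := coord S hD (Lf S) (pF t m) hf x
  simp only [pF_apply, Lf_apply] at this
  rw [this, Finset.sum_eq_single m.1]
  · simp
  · intro n hn hne; simp [sc, hne.symm]
  · intro h; exact absurd m.2 h

lemma fwd_enorm (S : Finset ℤ) {D : ℤ → V d → ℝ} (hD : ∀ n, Nice (D n)) {f : V d → EF T} (hf : Nice f) (x : V d) (t : T) :
    ‖(cv (fun x => ∑ n ∈ S, D n x • Lf S n) f x).row t‖ₑ = S.sup fun n => ‖sc (D n) (fun y => f y t) x‖ₑ := by
  apply le_antisymm
  · refine (enorm_pi_le _).2 fun m => ?_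
    rw [fwd_coord S hD hf]
    exact Finset.le_sup (f := fun n => ‖sc (D n) (fun y => f y t) x‖ₑ) m.2
  · refine Finset.sup_le fun n hn => ?_
    rw [← fwd_coord S hD hf x t ⟨n, hn⟩]
    exact (enorm_pi_le _).1 le_rfl _

lemma Nice.coordE {f : V d → EF T} (hf : Nice f) (t : T) : Nice fun y => f y t :=
  hf.clm (PiLp.proj 2 (fun _ : T => ℝ) t)

lemma nice_toLp {f : T → V d → ℝ} (hf : ∀ t, Nice (f t)) : Nice (fun x => (WithLp.toLp 2 fun t => f t x : EF T)) := by
  classical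
  have h := Nice.sum Finset.univ fun t _ => (hf t).smul_const (WithLp.toLp 2 (Pi.single t 1) : EF T)
  convert h using 2 with x
  ext t
  simp [Finset.sum_apply, Pi.single_apply]

lemma fwd_l2 {C ρ : ℝ}
    (hs : ∀ (j : ℕ) (S : Finset ℤ) (ξ : V d), ∑ n ∈ S, ‖ft (Dk n (j+1)) ξ‖ ^ 2 ≤ C * ρ ^ j)
    (S : Finset ℤ) (j : ℕ) (g : V d → EF T) (hg : Nice g) : ∫⁻ x, ‖cv (opk S (Lf S) j) g x‖ₑ ^ 2 ≤ ENNReal.ofReal (aj (a0 d) C ρ j) * ∫⁻ x, ‖g x‖ₑ ^ 2 := by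
  have e : ∀ x, ‖cv (opk S (Lf S) j) g x‖ₑ ^ 2 = ∑ t, (S.sup fun n => ‖sc (Dk n j) (fun y => g y t) x‖ₑ) ^ 2 := fun x => by
    rw [FF.enorm_sq]
    exact Finset.sum_congr rfl fun t _ => congrArg (· ^ 2) (fwd_enorm S (fun n => Dk_nice n j) hg x t)
  have e2 : ∀ x, ‖g x‖ₑ ^ 2 = ∑ t, ‖g x t‖ₑ ^ 2 := fun x => enorm_sq_pi (g x)
  have hm : ∀ t, Measurable fun x => (S.sup fun n => ‖sc (Dk n j) (fun y => g y t) x‖ₑ) ^ 2 := fun t =>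
    (meas_sup S (fun n x => ‖sc (Dk n j) (fun y => g y t) x‖ₑ) fun n => (sc_sm (Dk_nice n j) (hg.coordE t)).enorm).pow_const 2
  rw [lintegral_congr e, lintegral_congr e2, lintegral_finsetSum _ fun t _ => hm t, lintegral_finsetSum _ fun t _ => (hg.coordE t).sm.enorm.pow_const 2, Finset.mul_sum]
  exact Finset.sum_le_sum fun t _ => scal_fwd hs j S (hg.coordE t)

lemma fwd_op (hd : 0 < d) {p C ρ : ℝ} (hp1 : 1 < p) (hp2 : p ≤ 2) (hC : 0 < C) (h0 : 0 < ρ)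
    (hs : ∀ (j : ℕ) (S : Finset ℤ) (ξ : V d), ∑ n ∈ S, ‖ft (Dk n (j+1)) ξ‖ ^ 2 ≤ C * ρ ^ j)
    (S : Finset ℤ) (J : ℕ) {f : V d → EF T} (hf : Nice f) :
    ∫⁻ x, ‖cv (Kop S (Lf S) J) f x‖ₑ ^ p ≤ ctot d p (a0 d) C ρ ^ p * ∫⁻ x, ‖f x‖ₑ ^ p := by
  have hp : 0 < p := by linarith
  have hl : ∀ n, ‖Lf (T := T) S n‖ ≤ 1 := Lf_norm S
  have h1 := Kop_strong (E := EF T) (F := FF T S) hd hp1 hp2 (a0_pos d) hC h0 S (L := Lf S) hl (fwd_l2 hs S) J hf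
  exact eLp_le hp h1

theorem fwd_p (hd : 0 < d) {p C ρ : ℝ} (hp1 : 1 < p) (hp2 : p ≤ 2) (hC : 0 < C) (h0 : 0 < ρ)
    (hs : ∀ (j : ℕ) (S : Finset ℤ) (ξ : V d), ∑ n ∈ S, ‖ft (Dk n (j+1)) ξ‖ ^ 2 ≤ C * ρ ^ j)
    (S : Finset ℤ) (J : ℕ) {f : T → V d → ℝ} (hf : ∀ t, Nice (f t)) :
    ∫⁻ x, (∑ t, (S.sup fun n => ‖sc (K n (n - J)) (f t) x‖ₑ) ^ 2) ^ (p / 2) ≤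
      ctot d p (a0 d) C ρ ^ p * ∫⁻ x, (∑ t, ‖f t x‖ₑ ^ 2) ^ (p / 2) := by
  have hF := nice_toLp hf
  have h := fwd_op hd hp1 hp2 hC h0 hs S J hF
  have e : ∀ x, ‖cv (Kop S (Lf S) J) (fun x => (WithLp.toLp 2 fun t => f t x : EF T)) x‖ₑ ^ p = (∑ t, (S.sup fun n => ‖sc (K n (n - J)) (f t) x‖ₑ) ^ 2) ^ (p / 2) := fun x => by
    rw [FF.enorm_rp]
    congr 1
    exact Finset.sum_congr rfl fun t _ => congrArg (· ^ 2) (fwd_enorm S (D := fun n => K n (n - J)) (fun n => K_nice n _) hF x t)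
  have e2 : ∀ x, ‖(WithLp.toLp 2 fun t => f t x : EF T)‖ₑ ^ p = (∑ t, ‖f t x‖ₑ ^ 2) ^ (p / 2) := fun x => enorm_rp_pi _ p
  rwa [lintegral_congr e, lintegral_congr e2] at h

/- dual instance -/
def ED (T : Type*) [Fintype T] (S : Finset ℤ) := PiLp 2 (fun _ : T => PiLp 1 (fun _ : S => ℝ))

section
variable {S : Finset ℤ}
instance : NormedAddCommGroup (ED T S) := inferInstanceAs (NormedAddCommGroup (PiLp 2 (fun _ : T => PiLp 1 (fun _ : S => ℝ))))
instance : NormedSpace ℝ (ED T S) := inferInstanceAs (NormedSpace ℝ (PiLp 2 (fun _ : T => PiLp 1 (fun _ : S => ℝ))))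
instance : CompleteSpace (ED T S) := inferInstanceAs (CompleteSpace (PiLp 2 (fun _ : T => PiLp 1 (fun _ : S => ℝ))))
def ED.mk (u : T → S → ℝ) : ED T S := (WithLp.toLp 2 fun t => WithLp.toLp 1 (u t) : PiLp 2 (fun _ : T => PiLp 1 (fun _ : S => ℝ)))
def ED.row (y : ED T S) (t : T) : PiLp 1 (fun _ : S => ℝ) := WithLp.ofLp (p := 2) (V := T → PiLp 1 (fun _ : S => ℝ)) y t
lemma ED.row_mk (u : T → S → ℝ) (t : T) (m : S) : (ED.mk u).row t m = u t m := rfl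
lemma ED.row_add (y z : ED T S) (t : T) : (y + z).row t = y.row t + z.row t := rfl
lemma ED.row_smul (c : ℝ) (z : ED T S) (t : T) : (c • z).row t = c • z.row t := rfl
lemma ED.ext {y z : ED T S} (h : ∀ t m, y.row t m = z.row t m) : y = z := by
  have : y.row = z.row := by funext t; exact PiLp.ext fun m => h t m
  exact (WithLp.ofLp_injective (p := 2)) this
lemma ED.enorm_sq (y : ED T S) : ‖y‖ₑ ^ 2 = ∑ t, ‖y.row t‖ₑ ^ 2 := enorm_sq_pi (β := fun _ : T => PiLp 1 (fun _ : S => ℝ)) y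
lemma ED.norm_sq (y : ED T S) : ‖y‖ ^ 2 = ∑ t, ‖y.row t‖ ^ 2 := PiLp.norm_sq_eq_of_L2 (fun _ : T => PiLp 1 (fun _ : S => ℝ)) y
lemma ED.enorm_rp (y : ED T S) (p : ℝ) : ‖y‖ₑ ^ p = (∑ t, ‖y.row t‖ₑ ^ 2) ^ (p / 2) := enorm_rp_pi (β := fun _ : T => PiLp 1 (fun _ : S => ℝ)) y p
def pD0 (t : T) (m : S) : ED T S →ₗ[ℝ] ℝ where
  toFun y := y.row t m
  map_add' a b := rfl
  map_smul' a b := rfl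
lemma pD0_apply (t : T) (m : S) (y : ED T S) : pD0 t m y = y.row t m := rfl
end

def Ld0 (S : Finset ℤ) (n : ℤ) : ED T S →ₗ[ℝ] EF T where
  toFun e := WithLp.toLp 2 fun t => if h : n ∈ S then e.row t ⟨n, h⟩ else 0
  map_add' a b := by ext t; simp [ED.row_add]; split_ifs <;> simp
  map_smul' a b := by ext t; simp [ED.row_smul]

lemma Ld0_le (S : Finset ℤ) (n : ℤ) (e : ED T S) : ‖Ld0 S n e‖ ≤ 1 * ‖e‖ := by
  rw [one_mul]
  refine le_of_sq_le_sq ?_ (norm_nonneg _)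
  rw [PiLp.norm_sq_eq_of_L2, ED.norm_sq]
  refine Finset.sum_le_sum fun t _ => pow_le_pow_left₀ (norm_nonneg _) ?_ 2
  simp only [Ld0, LinearMap.coe_mk, AddHom.coe_mk]
  split_ifs with h
  · rw [PiLp.norm_eq_of_L1]
    exact Finset.single_le_sum (f := fun m : S => ‖e.row t m‖) (fun _ _ => norm_nonneg _) (Finset.mem_univ (⟨n, h⟩ : S))
  · simp

def Ld (S : Finset ℤ) (n : ℤ) : ED T S →L[ℝ] EF T := LinearMap.mkContinuous (E := ED T S) (F := EF T) (Ld0 S n) 1 (by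
  intro e
  have h := Ld0_le S n e
  exact h)

lemma Ld_norm (S : Finset ℤ) (n : ℤ) : ‖Ld (T := T) S n‖ ≤ 1 :=
  ContinuousLinearMap.opNorm_le_bound _ zero_le_one fun e => Ld0_le S n e

lemma Ld_apply (S : Finset ℤ) (n : ℤ) (e : ED T S) (t : T) : Ld S n e t = if h : n ∈ S then e.row t ⟨n, h⟩ else 0 := rfl

lemma dual_coord (S : Finset ℤ) {D : ℤ → V d → ℝ} (hD : ∀ n, Nice (D n)) {f : V d → ED T S} (hf : Nice f) (x : V d) (t : T) :
    (cv (fun x => ∑ n ∈ S, D n x • Ld S n) f x : EF T) t = ∑ n ∈ S, sc (D n) (fun y => if h : n ∈ S then (f y).row t ⟨n, h⟩ else 0) x := by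
  have := coord S hD (Ld S) (PiLp.proj 2 (fun _ : T => ℝ) t) hf x
  simpa only [PiLp.proj_apply, Ld_apply] using this

lemma Nice.coordD {S : Finset ℤ} {f : V d → ED T S} (hf : Nice f) (t : T) (n : ℤ) :
    Nice fun y => if h : n ∈ S then (f y).row t ⟨n, h⟩ else 0 :=
  hf.clm ((PiLp.proj 2 (fun _ : T => ℝ) t).comp (Ld S n))

lemma enorm_L1 {S : Finset ℤ} (u : PiLp 1 (fun _ : S => ℝ)) : ‖u‖ₑ = ∑ n ∈ S, ‖if h : n ∈ S then u ⟨n, h⟩ else 0‖ₑ := by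
  rw [← ofReal_norm, PiLp.norm_eq_of_L1, ENNReal.ofReal_sum_of_nonneg fun _ _ => norm_nonneg _, ← Finset.sum_attach S]
  simp [← ofReal_norm]

lemma nice_toLpD (S : Finset ℤ) {g : T → ℤ → V d → ℝ} (hg : ∀ t n, Nice (g t n)) :
    Nice (fun x => (ED.mk fun t (n : S) => g t n x : ED T S)) := by
  classical
  have h := Nice.sum Finset.univ fun t _ => Nice.sum Finset.univ fun (n : S) _ =>
    (hg t n).smul_const (ED.mk (Pi.single t (Pi.single n 1)) : ED T S)
  convert h using 2 with x
  refine ED.ext fun t n => ?_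
  rw [← pD0_apply t n (∑ _, _), map_sum]
  simp only [map_sum, map_smul, pD0_apply, ED.row_mk, smul_eq_mul]
  rw [Finset.sum_eq_single t]
  · simp [Pi.single_apply]
  · intro b _ hb; simp [Pi.single_apply, hb.symm]
  · simp

lemma dual_l2 {C ρ : ℝ}
    (hs : ∀ (j : ℕ) (S : Finset ℤ) (ξ : V d), ∑ n ∈ S, ‖ft (Dk n (j+1)) ξ‖ ^ 2 ≤ C * ρ ^ j)
    (S : Finset ℤ) (j : ℕ) (f : V d → ED T S) (hf : Nice f) : ∫⁻ x, ‖cv (opk S (Ld S) j) f x‖ₑ ^ 2 ≤ ENNReal.ofReal (aj (a0 d) C ρ j) * ∫⁻ x, ‖f x‖ₑ ^ 2 := by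
  have e : ∀ x, ‖cv (opk S (Ld S) j) f x‖ₑ ^ 2 = ∑ t, ‖∑ n ∈ S, sc (Dk n j) (fun y => if h : n ∈ S then (f y).row t ⟨n, h⟩ else 0) x‖ₑ ^ 2 := fun x => by
    rw [enorm_sq_pi]
    exact Finset.sum_congr rfl fun t _ => congrArg (‖·‖ₑ ^ 2) (dual_coord S (fun n => Dk_nice n j) hf x t)
  have e2 : ∀ x, ‖f x‖ₑ ^ 2 = ∑ t, (∑ n ∈ S, ‖if h : n ∈ S then (f x).row t ⟨n, h⟩ else 0‖ₑ) ^ 2 := fun x => by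
    rw [ED.enorm_sq]
    exact Finset.sum_congr rfl fun t _ => congrArg (· ^ 2) (enorm_L1 _)
  have hm : ∀ t, Measurable fun x => ‖∑ n ∈ S, sc (Dk n j) (fun y => if h : n ∈ S then (f y).row t ⟨n, h⟩ else 0) x‖ₑ ^ 2 := fun t =>
    (Finset.measurable_fun_sum S fun n _ => (sc_sm (Dk_nice n j) (hf.coordD t n)).measurable).enorm.pow_const 2
  have hm2 : ∀ t, Measurable fun x => (∑ n ∈ S, ‖if h : n ∈ S then (f x).row t ⟨n, h⟩ else 0‖ₑ) ^ 2 := fun t =>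
    (Finset.measurable_fun_sum S fun n _ => (hf.coordD t n).sm.enorm).pow_const 2
  rw [lintegral_congr e, lintegral_congr e2, lintegral_finsetSum _ fun t _ => hm t, lintegral_finsetSum _ fun t _ => hm2 t, Finset.mul_sum]
  exact Finset.sum_le_sum fun t _ => scal_dual hs j S (hf.coordD t)

lemma dual_op (hd : 0 < d) {p C ρ : ℝ} (hp1 : 1 < p) (hp2 : p ≤ 2) (hC : 0 < C) (h0 : 0 < ρ)
    (hs : ∀ (j : ℕ) (S : Finset ℤ) (ξ : V d), ∑ n ∈ S, ‖ft (Dk n (j+1)) ξ‖ ^ 2 ≤ C * ρ ^ j)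
    (S : Finset ℤ) (J : ℕ) {f : V d → ED T S} (hf : Nice f) :
    ∫⁻ x, ‖cv (Kop S (Ld S) J) f x‖ₑ ^ p ≤ ctot d p (a0 d) C ρ ^ p * ∫⁻ x, ‖f x‖ₑ ^ p := by
  have hp : 0 < p := by linarith
  have hl : ∀ n, ‖Ld (T := T) S n‖ ≤ 1 := Ld_norm S
  have h1 := Kop_strong (E := ED T S) (F := EF T) hd hp1 hp2 (a0_pos d) hC h0 S (L := Ld S) hl (dual_l2 hs S) J hf
  exact eLp_le hp h1

theorem dual_p (hd : 0 < d) {p C ρ : ℝ} (hp1 : 1 < p) (hp2 : p ≤ 2) (hC : 0 < C) (h0 : 0 < ρ)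
    (hs : ∀ (j : ℕ) (S : Finset ℤ) (ξ : V d), ∑ n ∈ S, ‖ft (Dk n (j+1)) ξ‖ ^ 2 ≤ C * ρ ^ j)
    (S : Finset ℤ) (J : ℕ) {g : T → ℤ → V d → ℝ} (hg : ∀ t n, Nice (g t n)) :
    ∫⁻ x, (∑ t, ‖∑ n ∈ S, sc (K n (n - J)) (g t n) x‖ₑ ^ 2) ^ (p / 2) ≤
      ctot d p (a0 d) C ρ ^ p * ∫⁻ x, (∑ t, (∑ n ∈ S, ‖g t n x‖ₑ) ^ 2) ^ (p / 2) := by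
  have hF := nice_toLpD S hg
  have h := dual_op hd hp1 hp2 hC h0 hs S J hF
  have e : ∀ x, ‖cv (Kop S (Ld S) J) (fun x => (ED.mk fun t (n : S) => g t n x : ED T S)) x‖ₑ ^ p = (∑ t, ‖∑ n ∈ S, sc (K n (n - J)) (g t n) x‖ₑ ^ 2) ^ (p / 2) := fun x => by
    rw [enorm_rp_pi]
    congr 1
    refine Finset.sum_congr rfl fun t _ => congrArg (‖·‖ₑ ^ 2) ?_
    refine (dual_coord S (D := fun n => K n (n - J)) (fun n => K_nice n _) hF x t).trans ?_
    refine Finset.sum_congr rfl fun n hn => ?_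
    simp [hn, ED.row_mk]
  have e2 : ∀ x, ‖(ED.mk fun t (n : S) => g t n x : ED T S)‖ₑ ^ p = (∑ t, (∑ n ∈ S, ‖g t n x‖ₑ) ^ 2) ^ (p / 2) := fun x => by
    rw [ED.enorm_rp]
    congr 1
    refine Finset.sum_congr rfl fun t _ => congrArg (· ^ 2) ?_
    rw [enorm_L1]
    refine Finset.sum_congr rfl fun n hn => ?_
    simp [hn, ED.row_mk]
  rwa [lintegral_congr e, lintegral_congr e2] at h
end inst
end Radon

namespace Radon
open MeasureTheory Filter Topology

section lim
variable {d : ℕ}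

lemma trans_cont {h : V d → ℝ} (hh : Integrable h) :
    Tendsto (fun z : V d => ∫⁻ x, ‖h (x - z) - h x‖ₑ) (𝓝 0) (𝓝 0) := by
  have hm : MemLp h 1 volume := memLp_one_iff_integrable.2 hh
  haveI : Fact ((1:ℝ≥0∞) ≤ 1) := ⟨le_rfl⟩
  haveI : Fact ((1:ℝ≥0∞) ≠ ∞) := ⟨by simp⟩
  have hc : Continuous fun z : V d => (DomAddAct.mk (-z)) +ᵥ (hm.toLp h : Lp ℝ 1 (volume : Measure (V d))) := by
    have h1 : Continuous fun z : V d => DomAddAct.mk (-z) := DomAddAct.mkHomeomorph.continuous.comp continuous_neg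
    exact h1.vadd continuous_const
  have h2 : Tendsto (fun z : V d => edist ((DomAddAct.mk (-z)) +ᵥ (hm.toLp h : Lp ℝ 1 (volume : Measure (V d)))) (hm.toLp h)) (𝓝 0) (𝓝 0) := by
    have h3 := (hc.tendsto 0).edist (tendsto_const_nhds (x := (hm.toLp h : Lp ℝ 1 (volume : Measure (V d)))))
    simpa using h3
  refine h2.congr fun z => ?_
  rw [DomAddAct.mk_vadd_toLp, Lp.edist_toLp_toLp, eLpNorm_one_eq_lintegral_enorm]
  refine lintegral_congr fun x => ?_
  simp [neg_add_eq_sub]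

/-- real curve average -/
def Ar (n : ℤ) (f : V d → ℝ) (x : V d) : ℝ := ∫ s in Set.Ioc (0:ℝ) 1, f (x - gam n s)

lemma Ar_int {f : V d → ℝ} (hf : Nice f) (n : ℤ) (x : V d) : Integrable (fun s => f (x - gam n s)) (volume.restrict (Set.Ioc (0:ℝ) 1)) := by
  obtain ⟨B, hB⟩ := hf.bd
  exact Integrable.of_bound (C := B) (hf.sm.comp_measurable (by fun_prop)).aestronglyMeasurable (ae_of_all _ fun s => hB _)

lemma sc_K (n m : ℤ) {f : V d → ℝ} (hf : Nice f) (x : V d) :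
    sc (K n m) f x = ∫ s in Set.Ioc (0:ℝ) 1, ∫ z, chi m z * f (x - gam n s - z) := by
  unfold sc K
  have e : ∀ y, (∫ s in Set.Ioc (0:ℝ) 1, chi m (x - y - gam n s)) * f y = ∫ s in Set.Ioc (0:ℝ) 1, chi m (x - y - gam n s) * f y :=
    fun y => (integral_mul_const _ _).symm
  simp_rw [e]
  rw [integral_integral_swap]
  · refine integral_congr_ae (ae_of_all _ fun s => ?_)
    simp only
    rw [← integral_sub_left_eq_self (fun z => chi m z * f (x - gam n s - z)) volume (x - gam n s)]
    refine integral_congr_ae (ae_of_all _ fun y => ?_)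
    simp only [sub_sub_cancel]
    congr 2
    abel
  · have h1 : Integrable (fun p : V d × ℝ => f p.1) (volume.prod (volume.restrict (Set.Ioc (0:ℝ) 1))) := hf.int.comp_fst _
    refine Integrable.bdd_mul (c := (vl d m)⁻¹) h1 ?_ (ae_of_all _ fun p => ?_)
    · exact ((chi_meas m).comp (by fun_prop)).aestronglyMeasurable
    · rw [Real.norm_of_nonneg (chi_nonneg m _)]; exact chi_le m _

lemma chi_mul_int (m : ℤ) {f : V d → ℝ} (hf : Nice f) (y : V d) : Integrable fun z => chi m z * f (y - z) := by
  obtain ⟨B, hB⟩ := hf.bd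
  exact (chi_nice m).int.mul_bdd (c := B) (hf.sm.comp_measurable (by fun_prop)).aestronglyMeasurable (ae_of_all _ fun y => hB _)

lemma sc_K_sub (n m : ℤ) {f : V d → ℝ} (hf : Nice f) (x : V d) :
    ‖sc (K n m) f x - Ar n f x‖ₑ ≤ ∫⁻ s in Set.Ioc (0:ℝ) 1, ∫⁻ z, ‖chi m z‖ₑ * ‖f (x - gam n s - z) - f (x - gam n s)‖ₑ := by
  obtain ⟨B, hB⟩ := hf.bd
  have hi : Integrable (fun s => ∫ z, chi m z * f (x - gam n s - z)) (volume.restrict (Set.Ioc (0:ℝ) 1)) := by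
    refine Integrable.of_bound (C := B) ?_ (ae_of_all _ fun s => ?_)
    · refine (StronglyMeasurable.integral_prod_right' (f := fun p : ℝ × V d => chi m p.2 * f (x - gam n p.1 - p.2)) ?_).aestronglyMeasurable
      exact ((chi_nice m).sm.comp_measurable (by fun_prop)).mul (hf.sm.comp_measurable (by fun_prop))
    · refine (norm_integral_le_of_norm_le ((chi_nice m).int.mul_const B) (ae_of_all _ fun z => ?_)).trans ?_
      · rw [norm_mul, Real.norm_of_nonneg (chi_nonneg m z)]
        exact mul_le_mul_of_nonneg_left (hB _) (chi_nonneg m z)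
      · rw [integral_mul_const, chi_integral, one_mul]
  rw [sc_K n m hf, Ar, ← integral_sub hi (Ar_int hf n x)]
  refine (enorm_integral_le_lintegral_enorm _).trans (lintegral_mono fun s => ?_)
  have e : f (x - gam n s) = ∫ z : V d, chi m z * f (x - gam n s) := by rw [integral_mul_const, chi_integral, one_mul]
  rw [e, ← integral_sub (chi_mul_int m hf _) ((chi_nice m).int.mul_const _)]
  refine (enorm_integral_le_lintegral_enorm _).trans (lintegral_mono fun z => ?_)
  rw [← e, ← mul_sub, enorm_mul]

lemma sc_K_L1 (n m : ℤ) {f : V d → ℝ} (hf : Nice f) :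
    ∫⁻ x, ‖sc (K n m) f x - Ar n f x‖ₑ ≤ ∫⁻ z, ‖chi m z‖ₑ * ∫⁻ x, ‖f (x - z) - f x‖ₑ := by
  have hfm := hf.sm.measurable
  have hcm := chi_meas (d := d) m
  have hM : Measurable fun p : V d × V d => ‖f (p.1 - p.2) - f p.1‖ₑ :=
    ((hfm.comp (by fun_prop)).sub (hfm.comp (by fun_prop))).enorm
  have hM3 : Measurable fun p : (V d × ℝ) × V d => ‖chi m p.2‖ₑ * ‖f (p.1.1 - gam n p.1.2 - p.2) - f (p.1.1 - gam n p.1.2)‖ₑ :=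
    (hcm.comp (by fun_prop)).enorm.mul (((hfm.comp (by fun_prop)).sub (hfm.comp (by fun_prop))).enorm)
  calc _ ≤ _ := lintegral_mono fun x => sc_K_sub n m hf x
    _ = ∫⁻ s in Set.Ioc (0:ℝ) 1, ∫⁻ x, ∫⁻ z, ‖chi m z‖ₑ * ‖f (x - gam n s - z) - f (x - gam n s)‖ₑ := by
        rw [lintegral_lintegral_swap]
        exact (Measurable.lintegral_prod_right' hM3).aemeasurable
    _ = ∫⁻ s in Set.Ioc (0:ℝ) 1, ∫⁻ z, ‖chi m z‖ₑ * ∫⁻ x, ‖f (x - z) - f x‖ₑ := by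
        refine lintegral_congr fun s => ?_
        rw [lintegral_sub_right_eq_self (fun x => ∫⁻ z, ‖chi m z‖ₑ * ‖f (x - z) - f x‖ₑ) (gam n s)]
        rw [lintegral_lintegral_swap]
        · refine lintegral_congr fun z => ?_
          have hme : Measurable fun x : V d => ‖f (x - z) - f x‖ₑ := hM.comp (by fun_prop : Measurable fun x : V d => (x, z))
          rw [lintegral_const_mul _ hme]
        · exact ((hcm.comp measurable_snd).enorm.mul hM).aemeasurable
    _ = _ := by simp

lemma scl_tendsto (i : Fin d) : Tendsto (fun J : ℕ => scl (-(J:ℤ)) i) atTop (𝓝 0) := by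
  refine squeeze_zero (fun J => (scl_pos _ _).le) (g := fun J : ℕ => ((1:ℝ)/2) ^ J) (fun J => ?_) (tendsto_pow_atTop_nhds_zero_of_lt_one (by norm_num) (by norm_num))
  have h := scl_ratio (m := -(J:ℤ)) (m' := 0) (by omega) i
  have e : scl 0 i = 1 := by simp [scl]
  rw [e] at h
  simpa [zpow_neg] using h

lemma sc_K_tendsto (n : ℤ) {f : V d → ℝ} (hf : Nice f) :
    Tendsto (fun J : ℕ => ∫⁻ x, ‖sc (K n (n - J)) f x - Ar n f x‖ₑ) atTop (𝓝 0) := by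
  rw [ENNReal.tendsto_nhds_zero]
  intro ε hε
  have h1 := (ENNReal.tendsto_nhds_zero.1 (trans_cont hf.int)) ε hε
  rw [Metric.eventually_nhds_iff] at h1
  obtain ⟨δ, hδ, h1⟩ := h1
  have h2 : Tendsto (fun J : ℕ => (WithLp.toLp 2 fun i => scl (n - J) i : V d)) atTop (𝓝 0) := by
    have : Tendsto (fun J : ℕ => (fun i : Fin d => scl (n - J) i)) atTop (𝓝 0) := by
      rw [tendsto_pi_nhds]
      intro i
      have := (scl_tendsto i).const_mul (scl n i)
      simp only [← scl_add, mul_zero, ← sub_eq_add_neg] at this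
      exact this
    have h3 := ((PiLp.continuous_toLp 2 (fun _ : Fin d => ℝ)).tendsto 0).comp this
    rw [WithLp.toLp_zero] at h3
    exact h3
  rw [Metric.tendsto_nhds] at h2
  filter_upwards [h2 δ hδ] with J hJ
  refine (sc_K_L1 n (n - J) hf).trans ?_
  calc _ ≤ ∫⁻ z : V d, ‖chi (n - J) z‖ₑ * ε := by
        refine lintegral_mono fun z => ?_
        by_cases hz : z ∈ Qs (n - (J:ℤ))
        · refine mul_le_mul_right (h1 ?_) _
          refine lt_of_le_of_lt ?_ hJ
          rw [dist_zero_right, dist_zero_right, EuclideanSpace.norm_eq, EuclideanSpace.norm_eq]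
          refine Real.sqrt_le_sqrt (Finset.sum_le_sum fun i _ => ?_)
          have := hz i
          refine pow_le_pow_left₀ (norm_nonneg _) ?_ 2
          rw [Real.norm_of_nonneg this.1, Real.norm_of_nonneg (scl_pos _ _).le]
          exact this.2.le
        · have : chi (n - (J:ℤ)) z = 0 := by unfold chi; simp [hz]
          simp [this]
    _ = ε := by rw [lintegral_mul_const _ (chi_meas _).enorm, chi_lint, one_mul]

lemma fatou_le {α : Type*} [MeasurableSpace α] {μ : Measure α} {Φ : ℕ → α → ℝ≥0∞} {Ψ : α → ℝ≥0∞} {B : ℝ≥0∞}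
    (hm : ∀ k, Measurable (Φ k)) (ht : ∀ᵐ x ∂μ, Tendsto (fun k => Φ k x) atTop (𝓝 (Ψ x))) (hB : ∀ k, ∫⁻ x, Φ k x ∂μ ≤ B) :
    ∫⁻ x, Ψ x ∂μ ≤ B := by
  calc _ = ∫⁻ x, liminf (fun k => Φ k x) atTop ∂μ := lintegral_congr_ae (ht.mono fun x hx => hx.liminf_eq.symm)
    _ ≤ liminf (fun k => ∫⁻ x, Φ k x ∂μ) atTop := lintegral_liminf_le hm
    _ ≤ B := liminf_le_of_frequently_le' (Frequently.of_forall hB)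

lemma limit_lemma {ι : Type*} [Fintype ι] {u : ι → ℕ → V d → ℝ} {v : ι → V d → ℝ} (hu : ∀ i J, Measurable (u i J))
    (hv : ∀ i, Measurable (v i))
    (ht : ∀ i, Tendsto (fun J => ∫⁻ x, ‖u i J x - v i x‖ₑ) atTop (𝓝 0)) {Φ : (ι → ℝ) → ℝ≥0∞} (hΦ : Continuous Φ) {B : ℝ≥0∞}
    (hB : ∀ J, ∫⁻ x, Φ (fun i => u i J x) ≤ B) : ∫⁻ x, Φ (fun i => v i x) ≤ B := by
  have hs : Tendsto (fun J => ∑ i, ∫⁻ x, ‖u i J x - v i x‖ₑ) atTop (𝓝 0) := by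
    have := tendsto_finsetSum Finset.univ fun i _ => ht i
    simpa using this
  have hch : ∀ k : ℕ, ∃ J, ∑ i, ∫⁻ x, ‖u i J x - v i x‖ₑ ≤ (2⁻¹ : ℝ≥0∞) ^ k := fun k =>
    ((ENNReal.tendsto_nhds_zero.1 hs) _ (ENNReal.pow_pos (by simp) k)).exists
  choose J hJ using hch
  refine fatou_le (Φ := fun k x => Φ (fun i => u i (J k) x)) (fun k => hΦ.measurable.comp (measurable_pi_lambda _ fun i => hu i _)) ?_ (fun k => hB _)
  have hsum : ∀ i, ∀ᵐ x, ∑' k, ‖u i (J k) x - v i x‖ₑ ≠ ∞ := by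
    intro i
    refine (ae_lt_top (Measurable.ennreal_tsum fun k => ((hu i (J k)).sub (hv i)).enorm) ?_).mono fun x hx => hx.ne
    rw [lintegral_tsum fun k => ((hu i (J k)).sub (hv i)).enorm.aemeasurable]
    refine ne_top_of_le_ne_top (b := ∑' k : ℕ, (2⁻¹ : ℝ≥0∞) ^ k) (by rw [ENNReal.tsum_geometric]; simp) ?_
    refine ENNReal.tsum_le_tsum fun k => le_trans ?_ (hJ k)
    exact Finset.single_le_sum (f := fun i => ∫⁻ x, ‖u i (J k) x - v i x‖ₑ) (fun _ _ => zero_le) (Finset.mem_univ i)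
  filter_upwards [ae_all_iff.2 hsum] with x hx
  refine (hΦ.tendsto _).comp (tendsto_pi_nhds.2 fun i => ?_)
  have := ENNReal.tendsto_atTop_zero_of_tsum_ne_top (hx i)
  rw [tendsto_iff_edist_tendsto_0]
  simpa only [edist_eq_enorm_sub] using this
end lim
end Radon

namespace Radon
open MeasureTheory Filter Topology

section av
variable {d : ℕ}

def Av (n : ℤ) (F : V d → ℝ≥0∞) (x : V d) : ℝ≥0∞ := ∫⁻ s in Set.Ioc (0:ℝ) 1, F (x - gam n s)

@[fun_prop]
lemma Av_meas (n : ℤ) {F : V d → ℝ≥0∞} (hF : Measurable F) : Measurable (Av n F) := by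
  unfold Av
  exact Measurable.lintegral_prod_right' (f := fun p : V d × ℝ => F (p.1 - gam n p.2)) (hF.comp (by fun_prop))

lemma Ar_sm (n : ℤ) {f : V d → ℝ} (hf : Nice f) : StronglyMeasurable (Ar n f) := by
  unfold Ar
  exact StronglyMeasurable.integral_prod_right' (f := fun p : V d × ℝ => f (p.1 - gam n p.2)) (hf.sm.comp_measurable (by fun_prop))

lemma Ar_enorm (n : ℤ) {f : V d → ℝ} (hf : Nice f) (h0 : ∀ x, 0 ≤ f x) (x : V d) : ‖Ar n f x‖ₑ = Av n (fun y => ‖f y‖ₑ) x := by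
  unfold Ar Av
  rw [Real.enorm_of_nonneg (integral_nonneg fun s => h0 _), ofReal_integral_eq_lintegral_ofReal (Ar_int hf n x) (ae_of_all _ fun s => h0 _)]
  simp only [Real.enorm_of_nonneg (h0 _)]

lemma Ar_nonneg (n : ℤ) {f : V d → ℝ} (h0 : ∀ x, 0 ≤ f x) (x : V d) : 0 ≤ Ar n f x := integral_nonneg fun s => h0 _

def cut (k : ℕ) (F : V d → ℝ≥0∞) (x : V d) : ℝ≥0∞ := (Metric.closedBall 0 k).indicator (fun x => min (F x) k) x

lemma cut_meas (k : ℕ) {F : V d → ℝ≥0∞} (hF : Measurable F) : Measurable (cut k F) :=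
  (hF.min measurable_const).indicator Metric.isClosed_closedBall.measurableSet

lemma cut_le (k : ℕ) (F : V d → ℝ≥0∞) (x : V d) : cut k F x ≤ F x :=
  (Set.indicator_le_self' (fun _ _ => zero_le) x).trans (min_le_left _ _)

lemma cut_le' (k : ℕ) (F : V d → ℝ≥0∞) (x : V d) : cut k F x ≤ k :=
  (Set.indicator_le_self' (fun _ _ => zero_le) x).trans (min_le_right _ _)

lemma cut_ne (k : ℕ) (F : V d → ℝ≥0∞) (x : V d) : cut k F x ≠ ∞ := ne_top_of_le_ne_top (by simp) (cut_le' k F x)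

lemma cut_le_ball (k : ℕ) (F : V d → ℝ≥0∞) (x : V d) : cut k F x ≤ (Metric.closedBall (0 : V d) k).indicator (fun _ => (k : ℝ≥0∞)) x :=
  Set.indicator_le_indicator (min_le_right _ _)

lemma cut_mono (F : V d → ℝ≥0∞) (x : V d) : Monotone fun k => cut k F x := by
  intro a b hab
  have hab' : (a:ℝ≥0∞) ≤ b := by exact_mod_cast hab
  have hsub : Metric.closedBall (0 : V d) a ⊆ Metric.closedBall 0 b := Metric.closedBall_subset_closedBall (by exact_mod_cast hab)
  refine (Set.indicator_le_indicator (f := fun y => min (F y) a) (g := fun y => min (F y) b) (min_le_min le_rfl hab')).trans ?_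
  exact Set.indicator_le_indicator_of_subset hsub (fun _ => zero_le) x

lemma cut_tendsto (F : V d → ℝ≥0∞) (x : V d) : Tendsto (fun k => cut k F x) atTop (𝓝 (F x)) := by
  have h1 : Tendsto (fun k : ℕ => min (F x) (k : ℝ≥0∞)) atTop (𝓝 (min (F x) ∞)) :=
    tendsto_const_nhds.min ENNReal.tendsto_nat_nhds_top
  rw [min_eq_left le_top] at h1
  refine h1.congr' ?_
  obtain ⟨N, hN⟩ := exists_nat_ge ‖x‖
  filter_upwards [eventually_ge_atTop N] with k hk
  have : x ∈ Metric.closedBall (0 : V d) k := by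
    rw [mem_closedBall_zero_iff]; exact hN.trans (by exact_mod_cast hk)
  unfold cut
  rw [Set.indicator_of_mem this]

lemma cut_lint (k : ℕ) (F : V d → ℝ≥0∞) : ∫⁻ x, cut k F x ≠ ∞ := by
  refine ne_top_of_le_ne_top (b := ∫⁻ x, (Metric.closedBall (0 : V d) k).indicator (fun _ => (k : ℝ≥0∞)) x) ?_ (lintegral_mono fun x => cut_le_ball k F x)
  rw [lintegral_indicator Metric.isClosed_closedBall.measurableSet, setLIntegral_const]
  exact ENNReal.mul_ne_top (by simp) measure_closedBall_lt_top.ne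

lemma cut_nice (k : ℕ) {F : V d → ℝ≥0∞} (hF : Measurable F) : Nice fun x => (cut k F x).toReal := by
  refine ⟨(cut_meas k hF).ennreal_toReal.stronglyMeasurable, integrable_toReal_of_lintegral_ne_top (cut_meas k hF).aemeasurable (cut_lint k F), k, fun x => ?_⟩
  rw [Real.norm_of_nonneg ENNReal.toReal_nonneg]
  exact ENNReal.toReal_le_of_le_ofReal (by positivity) (by simpa using cut_le' k F x)

lemma cut_enorm (k : ℕ) (F : V d → ℝ≥0∞) (x : V d) : ‖(cut k F x).toReal‖ₑ = cut k F x := by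
  rw [Real.enorm_of_nonneg ENNReal.toReal_nonneg, ENNReal.ofReal_toReal (cut_ne k F x)]

lemma Av_cut_tendsto (n : ℤ) {F : V d → ℝ≥0∞} (hF : Measurable F) (x : V d) :
    Tendsto (fun k => Av n (cut k F) x) atTop (𝓝 (Av n F x)) := by
  unfold Av
  refine lintegral_tendsto_of_tendsto_of_monotone (fun k => ((cut_meas k hF).comp (by fun_prop)).aemeasurable) (ae_of_all _ fun s => ?_) (ae_of_all _ fun s => ?_)
  · exact cut_mono F _
  · exact cut_tendsto F _

lemma rp_tendsto {T : Type*} [Fintype T] {a : T → ℕ → ℝ≥0∞} {b : T → ℝ≥0∞} (h : ∀ t, Tendsto (a t) atTop (𝓝 (b t))) (r : ℝ) :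
    Tendsto (fun k => (∑ t, a t k ^ 2) ^ r) atTop (𝓝 ((∑ t, b t ^ 2) ^ r)) :=
  (ENNReal.continuous_rpow_const.tendsto _).comp (tendsto_finsetSum _ fun t _ => ((ENNReal.continuous_pow 2).tendsto _).comp (h t))

lemma sup_tendsto {ι : Type*} (S : Finset ι) {a : ι → ℕ → ℝ≥0∞} {b : ι → ℝ≥0∞} (h : ∀ n, Tendsto (a n) atTop (𝓝 (b n))) :
    Tendsto (fun k => S.sup fun n => a n k) atTop (𝓝 (S.sup b)) :=
  Filter.Tendsto.finset_sup_nhds_apply fun n _ => h n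

/-- the `L^p(ℓ²)` quantity -/
def LS {T : Type*} [Fintype T] {X : Type*} [MeasurableSpace X] (μ : Measure X) (p : ℝ) (F : T → X → ℝ≥0∞) : ℝ≥0∞ :=
  ∫⁻ x, (∑ t, F t x ^ 2) ^ (p / 2) ∂μ

lemma LS_mono {T : Type*} [Fintype T] {X : Type*} [MeasurableSpace X] {μ : Measure X} {p : ℝ} (hp : 0 ≤ p) {F G : T → X → ℝ≥0∞}
    (h : ∀ t x, F t x ≤ G t x) : LS μ p F ≤ LS μ p G :=
  lintegral_mono fun x => ENNReal.rpow_le_rpow (Finset.sum_le_sum fun t _ => pow_le_pow_left' (h t x) 2) (by positivity)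

lemma LS_meas {T : Type*} [Fintype T] {X : Type*} [MeasurableSpace X] {F : T → X → ℝ≥0∞} (hF : ∀ t, Measurable (F t)) (r : ℝ) :
    Measurable fun x => (∑ t, F t x ^ 2) ^ r :=
  (Finset.measurable_fun_sum _ fun t _ => (hF t).pow_const 2).pow_const r

def FwdOK (d : ℕ) (p : ℝ) (C : ℝ≥0∞) : Prop := ∀ (T : Type) [Fintype T] (S : Finset ℤ) (F : T → V d → ℝ≥0∞), (∀ t, Measurable (F t)) →
  LS volume p (fun t x => S.sup fun n => Av n (F t) x) ≤ C * LS volume p F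

def DualOK (d : ℕ) (p : ℝ) (C : ℝ≥0∞) : Prop := ∀ (T : Type) [Fintype T] (S : Finset ℤ) (G : T → ℤ → V d → ℝ≥0∞), (∀ t n, Measurable (G t n)) →
  LS volume p (fun t x => ∑ n ∈ S, Av n (G t n) x) ≤ C * LS volume p (fun t x => ∑ n ∈ S, G t n x)

lemma fwd_cut (hd : 0 < d) {p C ρ : ℝ} (hp1 : 1 < p) (hp2 : p ≤ 2) (hC : 0 < C) (h0 : 0 < ρ)
    (hs : ∀ (j : ℕ) (S : Finset ℤ) (ξ : V d), ∑ n ∈ S, ‖ft (Dk n (j+1)) ξ‖ ^ 2 ≤ C * ρ ^ j)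
    {T : Type} [Fintype T] (S : Finset ℤ) {F : T → V d → ℝ≥0∞} (hF : ∀ t, Measurable (F t)) (k : ℕ) :
    LS volume p (fun t x => S.sup fun n => Av n (cut k (F t)) x) ≤ ctot d p (a0 d) C ρ ^ p * LS volume p F := by
  have hn : ∀ t, Nice fun x => (cut k (F t) x).toReal := fun t => cut_nice k (hF t)
  have hfw := fun J => fwd_p hd hp1 hp2 hC h0 hs S J hn
  have hfw' : ∀ J : ℕ, _ ≤ ctot d p (a0 d) C ρ ^ p * LS volume p F := fun J => (hfw J).trans (mul_le_mul_right (by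
    simp only [cut_enorm]; exact LS_mono (by linarith) fun t x => cut_le k _ x) _)
  have key := limit_lemma (ι := T × S) (u := fun i J => sc (K i.2 (i.2 - J)) (fun x => (cut k (F i.1) x).toReal))
    (v := fun i => Ar i.2 (fun x => (cut k (F i.1) x).toReal)) (fun i J => (sc_sm (K_nice _ _) (hn _)).measurable)
    (fun i => (Ar_sm _ (hn _)).measurable) (fun i => sc_K_tendsto _ (hn _))
    (Φ := fun w => (∑ t, (S.attach.sup fun n => ‖w (t, n)‖ₑ) ^ 2) ^ (p / 2)) ?_ (B := ctot d p (a0 d) C ρ ^ p * LS volume p F) ?_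
  · refine le_trans (le_of_eq ?_) key
    unfold LS
    refine lintegral_congr fun x => ?_
    congr 1
    refine Finset.sum_congr rfl fun t _ => ?_
    congr 1
    rw [Finset.sup_attach S (fun n => ‖Ar n (fun x => (cut k (F t) x).toReal) x‖ₑ)]
    refine Finset.sup_congr rfl fun n _ => ?_
    rw [Ar_enorm n (hn t) (fun _ => ENNReal.toReal_nonneg)]
    simp only [cut_enorm]
  · refine ENNReal.continuous_rpow_const.comp (continuous_finsetSum _ fun t _ => (ENNReal.continuous_pow 2).comp ?_)
    exact Continuous.finset_sup_apply fun n _ => (continuous_apply _).enorm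
  · intro J
    refine le_trans (le_of_eq ?_) (hfw' J)
    refine lintegral_congr fun x => ?_
    congr 1
    refine Finset.sum_congr rfl fun t _ => ?_
    congr 1
    exact Finset.sup_attach S (fun n => ‖sc (K n (n - J)) (fun x => (cut k (F t) x).toReal) x‖ₑ)

lemma dual_cut (hd : 0 < d) {p C ρ : ℝ} (hp1 : 1 < p) (hp2 : p ≤ 2) (hC : 0 < C) (h0 : 0 < ρ)
    (hs : ∀ (j : ℕ) (S : Finset ℤ) (ξ : V d), ∑ n ∈ S, ‖ft (Dk n (j+1)) ξ‖ ^ 2 ≤ C * ρ ^ j)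
    {T : Type} [Fintype T] (S : Finset ℤ) {G : T → ℤ → V d → ℝ≥0∞} (hG : ∀ t n, Measurable (G t n)) (k : ℕ) :
    LS volume p (fun t x => ∑ n ∈ S, Av n (cut k (G t n)) x) ≤ ctot d p (a0 d) C ρ ^ p * LS volume p (fun t x => ∑ n ∈ S, G t n x) := by
  have hn : ∀ t n, Nice fun x => (cut k (G t n) x).toReal := fun t n => cut_nice k (hG t n)
  have hfw := fun J => dual_p hd hp1 hp2 hC h0 hs S J hn
  have hfw' : ∀ J : ℕ, _ ≤ ctot d p (a0 d) C ρ ^ p * LS volume p (fun t x => ∑ n ∈ S, G t n x) := fun J => (hfw J).trans (mul_le_mul_right (by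
    simp only [cut_enorm]; exact LS_mono (by linarith) fun t x => Finset.sum_le_sum fun n _ => cut_le k _ x) _)
  have key := limit_lemma (ι := T × S) (u := fun i J => sc (K i.2 (i.2 - J)) (fun x => (cut k (G i.1 i.2) x).toReal))
    (v := fun i => Ar i.2 (fun x => (cut k (G i.1 i.2) x).toReal)) (fun i J => (sc_sm (K_nice _ _) (hn _ _)).measurable)
    (fun i => (Ar_sm _ (hn _ _)).measurable) (fun i => sc_K_tendsto _ (hn _ _))
    (Φ := fun w => (∑ t, ‖∑ n ∈ S.attach, w (t, n)‖ₑ ^ 2) ^ (p / 2)) ?_ (B := ctot d p (a0 d) C ρ ^ p * LS volume p (fun t x => ∑ n ∈ S, G t n x)) ?_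
  · refine le_trans (le_of_eq ?_) key
    unfold LS
    refine lintegral_congr fun x => ?_
    congr 1
    refine Finset.sum_congr rfl fun t _ => ?_
    congr 1
    rw [Finset.sum_attach S (fun n => Ar n (fun x => (cut k (G t n) x).toReal) x),
      Real.enorm_of_nonneg (Finset.sum_nonneg fun n _ => Ar_nonneg n (fun _ => ENNReal.toReal_nonneg) x), ENNReal.ofReal_sum_of_nonneg fun n _ => Ar_nonneg n (fun _ => ENNReal.toReal_nonneg) x]
    refine Finset.sum_congr rfl fun n _ => ?_
    rw [← Real.enorm_of_nonneg (Ar_nonneg n (fun _ => ENNReal.toReal_nonneg) x), Ar_enorm n (hn t n) (fun _ => ENNReal.toReal_nonneg)]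
    simp only [cut_enorm]
  · refine ENNReal.continuous_rpow_const.comp (continuous_finsetSum _ fun t _ => (ENNReal.continuous_pow 2).comp ?_)
    exact (continuous_finsetSum S.attach fun n _ => continuous_apply (t, n)).enorm
  · intro J
    refine le_trans (le_of_eq ?_) (hfw' J)
    refine lintegral_congr fun x => ?_
    congr 1
    refine Finset.sum_congr rfl fun t _ => ?_
    congr 2
    exact Finset.sum_attach S (fun n => sc (K n (n - J)) (fun x => (cut k (G t n) x).toReal) x)

theorem le2 (hd : 1 ≤ d) {p : ℝ} (hp1 : 1 < p) (hp2 : p ≤ 2) : ∃ C : ℝ≥0∞, C ≠ ∞ ∧ FwdOK d p C ∧ DualOK d p C := by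
  obtain ⟨C, hC, ρ, h0, h1, hs⟩ := symbol hd
  refine ⟨ctot d p (a0 d) C ρ ^ p, ENNReal.rpow_ne_top_of_nonneg (by linarith) (ctot_ne d hp1 hp2 (a0_pos d) hC h0 h1), ?_, ?_⟩
  · intro T _ S F hF
    refine fatou_le (fun k => ?_) (ae_of_all _ fun x => ?_) (fun k => fwd_cut hd hp1 hp2 hC h0 hs S hF k)
    · exact LS_meas (fun t => meas_sup S (fun n => Av n (cut k (F t))) fun n => Av_meas n (cut_meas k (hF t))) _
    · exact rp_tendsto (fun t => sup_tendsto S fun n => Av_cut_tendsto n (hF t) x) _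
  · intro T _ S F hF
    refine fatou_le (fun k => ?_) (ae_of_all _ fun x => ?_) (fun k => dual_cut hd hp1 hp2 hC h0 hs S hF k)
    · exact LS_meas (fun t => Finset.measurable_fun_sum S fun n _ => Av_meas n (cut_meas k (hF t n))) _
    · exact rp_tendsto (fun t => tendsto_finsetSum S fun n _ => Av_cut_tendsto n (hF t n) x) _
end av
end Radon

namespace Radon
open MeasureTheory Filter Topology

section ge2
variable {d : ℕ}

lemma holder_LS {T : Type*} [Fintype T] {X : Type*} [MeasurableSpace X] {μ : Measure X} {p q : ℝ} (hpq : p.HolderConjugate q)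
    {F H : T → X → ℝ≥0∞} (hF : ∀ t, Measurable (F t)) (hH : ∀ t, Measurable (H t)) :
    ∑ t, ∫⁻ x, F t x * H t x ∂μ ≤ LS μ p F ^ (1 / p) * LS μ q H ^ (1 / q) := by
  have hFH : ∀ t, Measurable fun x => F t x * H t x := fun t => (hF t).mul (hH t)
  rw [← lintegral_finsetSum _ fun t _ => hFH t]
  have h := ENNReal.lintegral_mul_le_Lp_mul_Lq μ hpq (LS_meas hF (1/2)).aemeasurable (LS_meas hH (1/2)).aemeasurable
  refine le_trans (lintegral_mono fun x => ?_) (h.trans (le_of_eq ?_))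
  · have h1 := cs_sum Finset.univ (fun t => F t x) (fun t => H t x)
    have h2 := ENNReal.rpow_le_rpow h1 (z := 1/2) (by norm_num)
    rw [← ENNReal.rpow_natCast, ← ENNReal.rpow_mul, ENNReal.mul_rpow_of_nonneg _ _ (by norm_num)] at h2
    norm_num at h2
    simpa using h2
  · unfold LS
    congr 2 <;> refine lintegral_congr fun x => ?_ <;> rw [← ENNReal.rpow_mul] <;> congr 1 <;> ring

def Avr (n : ℤ) (F : V d → ℝ≥0∞) (x : V d) : ℝ≥0∞ := ∫⁻ s in Set.Ioc (0:ℝ) 1, F (x + gam n s)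

@[fun_prop]
lemma Avr_meas (n : ℤ) {F : V d → ℝ≥0∞} (hF : Measurable F) : Measurable (Avr n F) := by
  unfold Avr
  exact Measurable.lintegral_prod_right' (f := fun p : V d × ℝ => F (p.1 + gam n p.2)) (hF.comp (by fun_prop))

lemma Av_adj (n : ℤ) {F H : V d → ℝ≥0∞} (hF : Measurable F) (hH : Measurable H) :
    ∫⁻ x, Av n F x * H x = ∫⁻ x, F x * Avr n H x := by
  have e1 : ∀ x, Av n F x * H x = ∫⁻ s in Set.Ioc (0:ℝ) 1, F (x - gam n s) * H x := fun x => by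
    unfold Av
    have hm : Measurable fun s => F (x - gam n s) := hF.comp (by fun_prop)
    rw [lintegral_mul_const _ hm]
  have e2 : ∀ x, F x * Avr n H x = ∫⁻ s in Set.Ioc (0:ℝ) 1, F x * H (x + gam n s) := fun x => by
    unfold Avr
    have hm : Measurable fun s => H (x + gam n s) := hH.comp (by fun_prop)
    rw [lintegral_const_mul _ hm]
  simp_rw [e1, e2]
  have m1 : Measurable fun z : V d × ℝ => F (z.1 - gam n z.2) * H z.1 := by fun_prop
  have m2 : Measurable fun z : V d × ℝ => F z.1 * H (z.1 + gam n z.2) := by fun_prop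
  rw [lintegral_lintegral_swap (f := fun x s => F (x - gam n s) * H x) m1.aemeasurable, lintegral_lintegral_swap (f := fun x s => F x * H (x + gam n s)) m2.aemeasurable]
  refine lintegral_congr fun s => ?_
  rw [← lintegral_add_right_eq_self _ (gam n s)]
  simp

lemma Avr_refl (n : ℤ) (G : V d → ℝ≥0∞) (x : V d) : Avr n G x = Av n (fun y => G (-y)) (-x) := by
  unfold Avr Av
  refine lintegral_congr fun s => ?_
  congr 1; abel

lemma LS_neg {T : Type*} [Fintype T] {p : ℝ} (F : T → V d → ℝ≥0∞) :
    LS volume p (fun t x => F t (-x)) = LS volume p F := by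
  unfold LS
  exact lintegral_neg_eq_self (μ := volume) (fun x => (∑ t, F t x ^ 2) ^ (p/2))

lemma dual_r {q : ℝ} {C : ℝ≥0∞} (h : DualOK d q C) {T : Type} [Fintype T] (S : Finset ℤ) {G : T → ℤ → V d → ℝ≥0∞}
    (hG : ∀ t n, Measurable (G t n)) :
    LS volume q (fun t x => ∑ n ∈ S, Avr n (G t n) x) ≤ C * LS volume q (fun t x => ∑ n ∈ S, G t n x) := by
  have h1 := h T S (fun t n y => G t n (-y)) (fun t n => (hG t n).comp measurable_neg)
  rw [LS_neg (fun t x => ∑ n ∈ S, G t n x), ← LS_neg] at h1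
  simp_rw [Avr_refl]
  exact h1

lemma boot_p {p q : ℝ} (hpq : p.HolderConjugate q) {X A C : ℝ≥0∞} (hX : X ≠ ∞) (h : X ≤ A ^ (1/p) * (C * X) ^ (1/q)) :
    X ≤ C ^ (p/q) * A := by
  have hp := hpq.pos
  have hq := hpq.symm.pos
  by_cases h0 : X = 0
  · simp [h0]
  have hs : (1/p) + (1/q) = 1 := by simpa using hpq.inv_add_inv_eq_one
  have e : X = X ^ (1/p) * X ^ (1/q) := by rw [← ENNReal.rpow_add _ _ h0 hX, hs, ENNReal.rpow_one]
  have hz : X ^ (1/q) ≠ 0 := by simp [h0, hX]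
  have hz' : X ^ (1/q) ≠ ∞ := ENNReal.rpow_ne_top_of_nonneg (by positivity) hX
  rw [ENNReal.mul_rpow_of_nonneg _ _ (by positivity), ← mul_assoc] at h
  nth_rewrite 1 [e] at h
  have h2 := (ENNReal.mul_le_mul_iff_left hz hz').1 h
  have h3 := ENNReal.rpow_le_rpow h2 hp.le
  rw [ENNReal.mul_rpow_of_nonneg _ _ hp.le, ← ENNReal.rpow_mul, ← ENNReal.rpow_mul, ← ENNReal.rpow_mul] at h3
  rw [one_div_mul_cancel hp.ne', ENNReal.rpow_one, ENNReal.rpow_one, mul_comm] at h3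
  convert h3 using 3
  field_simp

lemma cut_LS_ne {p : ℝ} (hp : 0 < p) {T : Type} [Fintype T] (S : Finset ℤ) (a : T → ℤ → V d → ℝ≥0∞) (k : ℕ) :
    LS volume p (fun t x => S.sup fun n => cut k (a t n) x) ≠ ∞ := by
  refine ne_top_of_le_ne_top (b := ∫⁻ x, (Metric.closedBall (0 : V d) k).indicator (fun _ => ((Fintype.card T : ℝ≥0∞) * (k : ℝ≥0∞) ^ 2) ^ (p/2)) x) ?_ (lintegral_mono fun x => ?_)
  · rw [lintegral_indicator Metric.isClosed_closedBall.measurableSet, setLIntegral_const]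
    refine ENNReal.mul_ne_top (ENNReal.rpow_ne_top_of_nonneg (by positivity) ?_) measure_closedBall_lt_top.ne
    exact ENNReal.mul_ne_top (by simp) (by simp)
  · have h1 : ∀ t, (S.sup fun n => cut k (a t n) x) ≤ (Metric.closedBall (0 : V d) k).indicator (fun _ => (k : ℝ≥0∞)) x :=
      fun t => Finset.sup_le fun n _ => cut_le_ball k _ x
    refine (ENNReal.rpow_le_rpow (Finset.sum_le_sum fun t _ => pow_le_pow_left' (h1 t) 2) (by positivity)).trans ?_
    by_cases hx : x ∈ Metric.closedBall (0 : V d) k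
    · rw [Set.indicator_of_mem hx, Set.indicator_of_mem hx]; simp
    · rw [Set.indicator_of_notMem hx, Set.indicator_of_notMem hx]; simp [hp]

lemma ge2_cut {p q : ℝ} (hpq : p.HolderConjugate q) (hp : 2 ≤ p) {C : ℝ≥0∞} (h : DualOK d q C)
    {T : Type} [Fintype T] (S : Finset ℤ) {F : T → V d → ℝ≥0∞} (hF : ∀ t, Measurable (F t)) (k : ℕ) :
    LS volume p (fun t x => S.sup fun n => cut k (Av n (F t)) x) ≤ C ^ (p/q) * LS volume p F := by
  have hq := hpq.symm.pos
  refine boot_p hpq (cut_LS_ne (by linarith) S (fun t n => Av n (F t)) k) ?_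
  have ham : ∀ t n, Measurable (cut k (Av n (F t))) := fun t n => cut_meas k (Av_meas n (hF t))
  choose w hw hw1 hw2 using fun t => selection S (fun n => cut k (Av n (F t))) (ham t)
  set M : T → V d → ℝ≥0∞ := fun t x => S.sup fun n => cut k (Av n (F t)) x with hM
  have hMm : ∀ t, Measurable (M t) := fun t => meas_sup S _ (ham t)
  set R : V d → ℝ≥0∞ := fun x => (∑ t, M t x ^ 2) ^ ((p-2)/2) with hR
  have hRm : Measurable R := LS_meas hMm _
  set g : T → ℤ → V d → ℝ≥0∞ := fun t n x => w t n x * (M t x * R x) with hg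
  have hgm : ∀ t n, Measurable (g t n) := fun t n => (hw t n).mul ((hMm t).mul hRm)
  have e1 : LS volume p M ≤ ∑ t, ∫⁻ x, F t x * ∑ n ∈ S, Avr n (g t n) x := by
    calc LS volume p M ≤ ∫⁻ x, ∑ t, ∑ n ∈ S, Av n (F t) x * g t n x := by
          refine lintegral_mono fun x => ?_
          have : (∑ t, M t x ^ 2) ^ (p/2) = ∑ t, M t x * (M t x * R x) := by
            rw [show p/2 = 1 + (p-2)/2 by ring, ENNReal.rpow_add_of_nonneg _ _ (by norm_num) (by linarith), ENNReal.rpow_one, Finset.sum_mul]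
            exact Finset.sum_congr rfl fun t _ => by rw [sq, mul_assoc]
          show (∑ t, M t x ^ 2) ^ (p/2) ≤ _
          rw [this]
          refine Finset.sum_le_sum fun t _ => ?_
          nth_rewrite 1 [show M t x = ∑ n ∈ S, w t n x * cut k (Av n (F t)) x from (hw2 t x).symm]
          rw [Finset.sum_mul]
          refine Finset.sum_le_sum fun n _ => ?_
          calc w t n x * cut k (Av n (F t)) x * (M t x * R x) = cut k (Av n (F t)) x * g t n x := by simp only [hg]; ring
            _ ≤ _ := mul_le_mul_left (cut_le k _ x) _
      _ = ∑ t, ∑ n ∈ S, ∫⁻ x, Av n (F t) x * g t n x := by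
          have hm : ∀ t n, Measurable fun x => Av n (F t) x * g t n x := fun t n => (Av_meas n (hF t)).mul (hgm t n)
          rw [lintegral_finsetSum _ fun t _ => Finset.measurable_fun_sum _ fun n _ => hm t n]
          exact Finset.sum_congr rfl fun t _ => lintegral_finsetSum _ fun n _ => hm t n
      _ = _ := by
          refine Finset.sum_congr rfl fun t _ => ?_
          simp_rw [Finset.mul_sum]
          have hm : ∀ n, Measurable fun x => F t x * Avr n (g t n) x := fun n => (hF t).mul (Avr_meas n (hgm t n))
          rw [lintegral_finsetSum _ fun n _ => hm n]
          exact Finset.sum_congr rfl fun n _ => Av_adj n (hF t) (hgm t n)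
  refine e1.trans ((holder_LS hpq hF fun t => Finset.measurable_fun_sum _ fun n _ => Avr_meas n (hgm t n)).trans ?_)
  refine mul_le_mul_right (ENNReal.rpow_le_rpow ((dual_r h S hgm).trans (mul_le_mul_right ?_ _)) (by positivity)) _
  refine (LS_mono hq.le (G := fun t x => M t x * R x) fun t x => ?_).trans (le_of_eq ?_)
  · simp only [hg]
    rw [← Finset.sum_mul]
    exact mul_le_of_le_one_left' (hw1 t x)
  · unfold LS
    refine lintegral_congr fun x => ?_
    simp_rw [mul_pow]
    rw [← Finset.sum_mul]
    simp only [hR]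
    set Y := ∑ t, M t x ^ 2
    have : Y * (Y ^ ((p-2)/2))^2 = Y ^ (p-1) := by
      rw [← ENNReal.rpow_natCast, ← ENNReal.rpow_mul, show p - 1 = 1 + (p-2)/2*((2:ℕ):ℝ) by push_cast; ring, ENNReal.rpow_add_of_nonneg _ _ (by norm_num) (by push_cast; linarith), ENNReal.rpow_one]
    rw [this, ← ENNReal.rpow_mul]
    congr 1
    have := hpq.sub_one_mul_conj
    linear_combination this / 2

theorem fwd_all (hd : 1 ≤ d) {p : ℝ} (hp1 : 1 < p) : ∃ C : ℝ≥0∞, C ≠ ∞ ∧ FwdOK d p C := by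
  rcases le_total p 2 with hp | hp
  · obtain ⟨C, h1, h2, -⟩ := le2 hd hp1 hp
    exact ⟨C, h1, h2⟩
  have hpq := Real.HolderConjugate.conjExponent hp1
  set q := p.conjExponent
  have hq2 : q ≤ 2 := by
    have h1 := hpq.sub_one_mul_conj
    have h2 := hpq.symm.pos
    nlinarith
  obtain ⟨C, h1, -, h2⟩ := le2 hd hpq.symm.lt hq2
  refine ⟨C ^ (p/q), ENNReal.rpow_ne_top_of_nonneg (div_nonneg hpq.pos.le hpq.symm.pos.le) h1, ?_⟩
  intro T _ S F hF
  refine fatou_le (fun k => ?_) (ae_of_all _ fun x => ?_) (fun k => ge2_cut hpq hp h2 S hF k)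
  · exact LS_meas (fun t => meas_sup S (fun n => cut k (Av n (F t))) fun n => cut_meas k (Av_meas n (hF t))) _
  · exact rp_tendsto (fun t => sup_tendsto S fun n => cut_tendsto _ x) _
end ge2
end Radon

namespace Radon
open MeasureTheory Filter Topology

section transf
variable {d e : ℕ}

def lin (v : Fin d → V e) (u : V d) : V e := ∑ i, u i • v i

lemma lin_sub (v : Fin d → V e) (u w : V d) : lin v (u - w) = lin v u - lin v w := by
  simp [lin, sub_smul, Finset.sum_sub_distrib]

lemma lin_meas2 : Measurable fun z : (Fin d → V e) × V d => lin z.1 z.2 := by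
  unfold lin; fun_prop

lemma lin_meas (v : Fin d → V e) : Measurable (lin v) := by
  unfold lin; fun_prop

def Avl (v : Fin d → V e) (n : ℤ) (F : V e → ℝ≥0∞) (x : V e) : ℝ≥0∞ := ∫⁻ s in Set.Ioc (0:ℝ) 1, F (x - lin v (gam n s))

lemma Avl_meas2 (n : ℤ) {F : V e → ℝ≥0∞} (hF : Measurable F) :
    Measurable fun z : (Fin d → V e) × V e => Avl z.1 n F z.2 := by
  unfold Avl
  refine Measurable.lintegral_prod_right' (f := fun p : ((Fin d → V e) × V e) × ℝ => F (p.1.2 - lin p.1.1 (gam n p.2))) (hF.comp ?_)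
  have : Measurable fun p : ((Fin d → V e) × V e) × ℝ => lin p.1.1 (gam n p.2) :=
    lin_meas2.comp (f := fun p : ((Fin d → V e) × V e) × ℝ => (p.1.1, gam n p.2)) (by fun_prop)
  fun_prop

lemma Avl_meas (v : Fin d → V e) (n : ℤ) {F : V e → ℝ≥0∞} (hF : Measurable F) : Measurable (Avl v n F) :=
  (Avl_meas2 n hF).comp (f := fun x => (v, x)) (by fun_prop)

lemma gam_bdd (S : Finset ℤ) : ∃ c : ℝ, 0 < c ∧ ∀ n ∈ S, ∀ s ∈ Set.Ioc (0:ℝ) 1, ‖(gam n s : V d)‖ ≤ c := by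
  have h : ∀ n : ℤ, ∃ c, ∀ s ∈ Set.Icc (0:ℝ) 1, ‖(gam n s : V d)‖ ≤ c := fun n =>
    isCompact_Icc.exists_bound_of_continuousOn (gam_cont n).continuousOn
  choose c hc using h
  refine ⟨1 + ∑ n ∈ S, |c n|, by positivity, fun n hn s hs => (hc n s ⟨hs.1.le, hs.2⟩).trans ?_⟩
  have := Finset.single_le_sum (f := fun n => |c n|) (fun i _ => abs_nonneg _) hn
  have h2 := le_abs_self (c n)
  linarith

lemma transfer {p : ℝ} {C : ℝ≥0∞} (hp : 0 < p) (h : FwdOK d p C) (v : Fin d → V e) {T : Type} [Fintype T] (S : Finset ℤ)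
    {f : T → V e → ℝ≥0∞} (hf : ∀ t, Measurable (f t)) :
    LS volume p (fun t x => S.sup fun n => Avl v n (f t) x) ≤ (2 ^ d * C) * LS volume p f := by
  obtain ⟨c, hc, hb⟩ := gam_bdd (d := d) S
  set Q := Metric.closedBall (0 : V d) c with hQ
  set Q' := Metric.closedBall (0 : V d) (2 * c) with hQ'
  have hQm : MeasurableSet Q := Metric.isClosed_closedBall.measurableSet
  have hQm' : MeasurableSet Q' := Metric.isClosed_closedBall.measurableSet
  have hvol : volume Q' = 2 ^ d * volume Q := by
    rw [hQ, hQ', Measure.addHaar_closedBall_mul _ _ (by norm_num) hc.le]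
    simp
  have hQ0 : volume Q ≠ 0 := (Metric.measure_closedBall_pos volume _ hc).ne'
  have hQi : volume Q ≠ ∞ := measure_closedBall_lt_top.ne
  set Φ : V e → ℝ≥0∞ := fun x => (∑ t, (S.sup fun n => Avl v n (f t) x) ^ 2) ^ (p/2) with hΦ
  set φ : V e → ℝ≥0∞ := fun x => (∑ t, f t x ^ 2) ^ (p/2) with hφ
  have hΦm : Measurable Φ := LS_meas (fun t => meas_sup S _ fun n => Avl_meas v n (hf t)) _
  have hφm : Measurable φ := LS_meas hf _
  have avg : ∀ (B : Set (V d)) (ψ : V e → ℝ≥0∞), Measurable ψ → ∫⁻ x, ∫⁻ u in B, ψ (x + lin v u) = volume B * ∫⁻ x, ψ x := by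
    intro B ψ hψ
    have hm : Measurable fun z : V e × V d => ψ (z.1 + lin v z.2) := by
      have := lin_meas v
      fun_prop
    rw [lintegral_lintegral_swap (f := fun x u => ψ (x + lin v u)) hm.aemeasurable]
    simp_rw [fun u => lintegral_add_right_eq_self (μ := (volume : Measure (V e))) ψ (lin v u)]
    rw [setLIntegral_const, mul_comm]
  have key : ∀ x, ∫⁻ u in Q, Φ (x + lin v u) ≤ C * ∫⁻ u in Q', φ (x + lin v u) := by
    intro x
    set F : T → V d → ℝ≥0∞ := fun t => Q'.indicator fun u => f t (x + lin v u) with hF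
    have hFm : ∀ t, Measurable (F t) := fun t => ((hf t).comp ((lin_meas v).const_add x)).indicator hQm'
    have h1 := h T S F hFm
    refine le_trans ?_ (h1.trans (le_of_eq ?_))
    · refine le_trans ?_ (setLIntegral_le_lintegral Q _)
      refine setLIntegral_mono' hQm fun u hu => ?_
      refine le_of_eq ?_
      simp only [hΦ]
      congr 1
      refine Finset.sum_congr rfl fun t _ => ?_
      congr 1
      refine Finset.sup_congr rfl fun n hn => ?_
      unfold Avl Av
      refine setLIntegral_congr_fun measurableSet_Ioc fun s hs => ?_
      simp only [hF]
      rw [Set.indicator_of_mem, lin_sub, add_sub_assoc]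
      rw [hQ, mem_closedBall_zero_iff] at hu
      rw [hQ', mem_closedBall_zero_iff]
      refine (norm_sub_le _ _).trans ?_
      have := hb n hn s hs
      linarith
    · congr 1
      rw [← lintegral_indicator hQm']
      refine lintegral_congr fun u => ?_
      by_cases hu : u ∈ Q'
      · simp only [hF, Set.indicator_of_mem hu, hφ]
      · simp only [hF, Set.indicator_of_notMem hu]; simp [hp]
  have h2 : volume Q * ∫⁻ x, Φ x ≤ C * (volume Q' * ∫⁻ x, φ x) := by
    rw [← avg Q Φ hΦm, ← avg Q' φ hφm]
    have hm : Measurable fun x => ∫⁻ u in Q', φ (x + lin v u) :=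
      Measurable.lintegral_prod_right' (f := fun z : V e × V d => φ (z.1 + lin v z.2)) (by
        have := lin_meas v
        fun_prop)
    rw [← lintegral_const_mul _ hm]
    exact lintegral_mono key
  rw [hvol] at h2
  have h3 : volume Q * ∫⁻ x, Φ x ≤ volume Q * ((2 ^ d * C) * ∫⁻ x, φ x) := h2.trans (le_of_eq (by ring))
  exact (ENNReal.mul_le_mul_iff_right hQ0 hQi).1 h3

def Nm (v : Fin d → V e) (F : V e → ℝ≥0∞) (x : V e) : ℝ≥0∞ := ⨆ n : ℤ, Avl v n F x

lemma Nm_meas2 {F : V e → ℝ≥0∞} (hF : Measurable F) : Measurable fun z : (Fin d → V e) × V e => Nm z.1 F z.2 :=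
  Measurable.iSup fun n => Avl_meas2 n hF

lemma sup_Icc_tendsto (a : ℤ → ℝ≥0∞) : Tendsto (fun k : ℕ => (Finset.Icc (-(k:ℤ)) k).sup a) atTop (𝓝 (⨆ n, a n)) := by
  have : (⨆ n, a n) = ⨆ k : ℕ, (Finset.Icc (-(k:ℤ)) k).sup a := by
    refine le_antisymm (iSup_le fun n => ?_) (iSup_le fun k => Finset.sup_le fun n _ => le_iSup a n)
    refine le_trans ?_ (le_iSup _ n.natAbs)
    exact Finset.le_sup (f := a) (by rw [Finset.mem_Icc]; omega)
  rw [this]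
  exact tendsto_atTop_iSup fun i j hij => Finset.sup_mono (Finset.Icc_subset_Icc (by omega) (by omega))

lemma transfer_Nm {p : ℝ} {C : ℝ≥0∞} (hp : 0 < p) (h : FwdOK d p C) (v : Fin d → V e) {T : Type} [Fintype T]
    {f : T → V e → ℝ≥0∞} (hf : ∀ t, Measurable (f t)) :
    LS volume p (fun t x => Nm v (f t) x) ≤ (2 ^ d * C) * LS volume p f := by
  refine fatou_le (fun k => ?_) (ae_of_all _ fun x => ?_) (fun k : ℕ => transfer hp h v (Finset.Icc (-(k:ℤ)) k) hf)
  · exact LS_meas (fun t => meas_sup _ (fun n => Avl v n (f t)) fun n => Avl_meas v n (hf t)) _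
  · exact rp_tendsto (fun t => sup_Icc_tendsto fun n => Avl v n (f t) x) _
end transf
end Radon

namespace Radon
open MeasureTheory Filter Topology

section red
variable {d e k : ℕ}

lemma minkowski {T : Type*} [Fintype T] {Z : Type*} [MeasurableSpace Z] {μ : Measure Z} {N : T → Z → ℝ≥0∞} (hN : ∀ t, Measurable (N t)) :
    (∑ t, (∫⁻ z, N t z ∂μ) ^ 2) ^ (1/2 : ℝ) ≤ ∫⁻ z, (∑ t, N t z ^ 2) ^ (1/2 : ℝ) ∂μ := by
  set I : T → ℝ≥0∞ := fun t => ∫⁻ z, N t z ∂μ with hI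
  set s := (∑ t, I t ^ 2) ^ (1/2 : ℝ) with hs
  have hss : ∀ a : ℝ≥0∞, (a ^ (1/2 : ℝ)) ^ 2 = a := fun a => by
    rw [← ENNReal.rpow_natCast, ← ENNReal.rpow_mul]; norm_num
  by_cases hfin : ∀ t, I t ≠ ∞
  · refine boot ?_ ?_
    · refine ENNReal.rpow_ne_top_of_nonneg (by norm_num) ?_
      exact (ENNReal.sum_lt_top.2 fun t _ => (ENNReal.pow_ne_top (hfin t)).lt_top).ne
    · rw [hs, hss]
      have hm : ∀ t, Measurable fun z => I t * N t z := fun t => (hN t).const_mul _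
      calc ∑ t, I t ^ 2 = ∫⁻ z, ∑ t, I t * N t z ∂μ := by
            rw [lintegral_finsetSum _ fun t _ => hm t]
            refine Finset.sum_congr rfl fun t _ => ?_
            rw [lintegral_const_mul _ (hN t), sq]
        _ ≤ ∫⁻ z, (∑ t, N t z ^ 2) ^ (1/2 : ℝ) * s ∂μ := by
            refine lintegral_mono fun z => ?_
            have h1 := ENNReal.rpow_le_rpow (cs_sum Finset.univ I (fun t => N t z)) (z := 1/2) (by norm_num)
            rw [← ENNReal.rpow_natCast, ← ENNReal.rpow_mul, ENNReal.mul_rpow_of_nonneg _ _ (by norm_num)] at h1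
            rw [mul_comm]
            refine le_trans (le_of_eq ?_) h1
            norm_num
        _ = _ := by rw [lintegral_mul_const _ (LS_meas hN _)]
  · push Not at hfin
    obtain ⟨t, ht⟩ := hfin
    have : ∫⁻ z, (∑ t, N t z ^ 2) ^ (1/2 : ℝ) ∂μ = ∞ := by
      refine top_unique ?_
      rw [← ht]
      refine lintegral_mono fun z => ?_
      calc N t z = (N t z ^ 2) ^ (1/2 : ℝ) := by rw [← ENNReal.rpow_natCast, ← ENNReal.rpow_mul]; norm_num
        _ ≤ _ := ENNReal.rpow_le_rpow (Finset.single_le_sum (f := fun t => N t z ^ 2) (fun _ _ => zero_le) (Finset.mem_univ t)) (by norm_num)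
    rw [this]; exact le_top

lemma jensen_p {Z : Type*} [MeasurableSpace Z] {μ : Measure Z} {p : ℝ} (hp : 1 < p) {H : Z → ℝ≥0∞} (hH : Measurable H) :
    (∫⁻ z, H z ∂μ) ^ p ≤ μ Set.univ ^ (p - 1) * ∫⁻ z, H z ^ p ∂μ := by
  have hpq := Real.HolderConjugate.conjExponent hp
  have h := ENNReal.lintegral_mul_le_Lp_mul_Lq μ hpq hH.aemeasurable (aemeasurable_const (b := (1:ℝ≥0∞)))
  have h2 := ENNReal.rpow_le_rpow h hpq.pos.le
  rw [ENNReal.mul_rpow_of_nonneg _ _ hpq.pos.le, ← ENNReal.rpow_mul, ← ENNReal.rpow_mul, one_div_mul_cancel hpq.pos.ne', ENNReal.rpow_one, mul_comm] at h2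
  have e1 : 1 / p.conjExponent * p = p - 1 := by
    have h1 := hpq.sub_one_mul_conj
    have h3 := hpq.symm.pos
    field_simp
    linarith
  rw [e1] at h2
  rw [mul_comm]
  simpa using h2

lemma mink_LS {T : Type*} [Fintype T] {Z X : Type*} [MeasurableSpace Z] [MeasurableSpace X] {μ : Measure Z} {ν : Measure X} [SFinite μ] [SFinite ν]
    {p : ℝ} (hp : 1 < p) {N : T → Z → X → ℝ≥0∞} (hN : ∀ t, Measurable fun w : Z × X => N t w.1 w.2) {B : ℝ≥0∞}
    (hB : ∀ z, LS ν p (fun t x => N t z x) ≤ B) :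
    LS ν p (fun t x => ∫⁻ z, N t z x ∂μ) ≤ μ Set.univ ^ (p - 1) * (B * μ Set.univ) := by
  have hNx : ∀ t x, Measurable fun z => N t z x := fun t x => (hN t).comp (f := fun z => (z, x)) (by fun_prop)
  have hG : Measurable fun w : Z × X => (∑ t, N t w.1 w.2 ^ 2) ^ (p/2) := LS_meas (X := Z × X) hN _
  have hG' : Measurable fun x => ∫⁻ z, (∑ t, N t z x ^ 2) ^ (p/2) ∂μ :=
    Measurable.lintegral_prod_left' hG
  calc LS ν p (fun t x => ∫⁻ z, N t z x ∂μ) ≤ ∫⁻ x, μ Set.univ ^ (p-1) * ∫⁻ z, (∑ t, N t z x ^ 2) ^ (p/2) ∂μ ∂ν := by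
        refine lintegral_mono fun x => ?_
        have h1 := ENNReal.rpow_le_rpow (minkowski (μ := μ) (fun t => hNx t x)) (z := p) (by linarith)
        rw [← ENNReal.rpow_mul, show (1/2 : ℝ) * p = p/2 by ring] at h1
        refine h1.trans ((jensen_p hp (LS_meas (fun t => hNx t x) _)).trans (le_of_eq ?_))
        congr 1
        refine lintegral_congr fun z => ?_
        rw [← ENNReal.rpow_mul, show (1/2 : ℝ) * p = p/2 by ring]
    _ = μ Set.univ ^ (p-1) * ∫⁻ z, (∫⁻ x, (∑ t, N t z x ^ 2) ^ (p/2) ∂ν) ∂μ := by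
        rw [lintegral_const_mul _ hG', lintegral_lintegral_swap]
        exact (hG.comp measurable_swap).aemeasurable
    _ ≤ _ := by
        refine mul_le_mul_right ?_ _
        calc _ ≤ ∫⁻ z, B ∂μ := lintegral_mono fun z => hB z
          _ = _ := lintegral_const _



lemma hom_eval {n : ℕ} {Q : MvPolynomial (Fin k) ℝ} (hQ : Q.IsHomogeneous n) (c : ℝ) (z : Fin k → ℝ) :
    MvPolynomial.eval (fun i => c * z i) Q = c ^ n * MvPolynomial.eval z Q := by
  rw [MvPolynomial.eval_eq', MvPolynomial.eval_eq', Finset.mul_sum]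
  refine Finset.sum_congr rfl fun m hm => ?_
  have h1 : m.degree = n := by
    have := hQ (MvPolynomial.mem_support_iff.1 hm)
    rw [Finsupp.degree_eq_weight_one]; exact this
  have h2 : ∏ i, (c * z i) ^ m i = c ^ n * ∏ i, z i ^ m i := by
    simp_rw [mul_pow]
    rw [Finset.prod_mul_distrib, Finset.prod_pow_eq_pow_sum, ← h1, Finsupp.degree_eq_sum]
  rw [h2]; ring

lemma poly_exp {D : ℕ} {Q : MvPolynomial (Fin k) ℝ} (hD : Q.totalDegree ≤ D) (h0 : MvPolynomial.eval (fun _ => (0:ℝ)) Q = 0) (c : ℝ) (z : Fin k → ℝ) :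
    MvPolynomial.eval (fun i => c * z i) Q = ∑ i : Fin (D+1), c ^ ((i:ℕ)+1) * MvPolynomial.eval z (MvPolynomial.homogeneousComponent ((i:ℕ)+1) Q) := by
  have hsum : Q = ∑ i ∈ Finset.range (D+2), MvPolynomial.homogeneousComponent i Q := by
    nth_rewrite 1 [← MvPolynomial.sum_homogeneousComponent Q]
    refine Finset.sum_subset (Finset.range_mono (by omega)) fun i _ hi => ?_
    exact MvPolynomial.homogeneousComponent_eq_zero _ _ (by simpa [Nat.lt_succ_iff] using hi)
  have hz : MvPolynomial.eval z (MvPolynomial.homogeneousComponent 0 Q) = 0 := by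
    rw [MvPolynomial.homogeneousComponent_zero, MvPolynomial.eval_C, ← h0]
    rw [← MvPolynomial.constantCoeff_eq]
    exact (MvPolynomial.eval_zero' (R := ℝ) ▸ rfl)
  nth_rewrite 1 [hsum]
  rw [map_sum]
  simp_rw [hom_eval (MvPolynomial.homogeneousComponent_isHomogeneous _ Q)]
  rw [Finset.sum_range_succ', hz, mul_zero, add_zero, Finset.sum_range]

def vz (D : ℕ) (P : Fin e → MvPolynomial (Fin k) ℝ) (z : V k) : Fin (D+1) → V e :=
  fun i => WithLp.toLp 2 fun j => MvPolynomial.eval (fun l => z l) (MvPolynomial.homogeneousComponent ((i:ℕ)+1) (P j))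

lemma poly_meas (Q : MvPolynomial (Fin k) ℝ) : Measurable fun z : V k => MvPolynomial.eval (fun l => z l) Q :=
  (MvPolynomial.continuous_eval Q).measurable.comp (f := fun z : V k => fun l => z l) (by fun_prop)

lemma vz_meas (D : ℕ) (P : Fin e → MvPolynomial (Fin k) ℝ) : Measurable (vz D P) := by
  unfold vz
  refine measurable_pi_lambda _ fun i => ?_
  refine (WithLp.measurable_toLp 2 _).comp (measurable_pi_lambda _ fun j => poly_meas _)

def Pm (P : Fin e → MvPolynomial (Fin k) ℝ) (y : V k) : V e := WithLp.toLp 2 fun j => MvPolynomial.eval (fun l => y l) (P j)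

lemma Pm_meas (P : Fin e → MvPolynomial (Fin k) ℝ) : Measurable (Pm P) :=
  (WithLp.measurable_toLp 2 _).comp (measurable_pi_lambda _ fun j => poly_meas _)

lemma lin_vz {D : ℕ} {P : Fin e → MvPolynomial (Fin k) ℝ} (hD : ∀ j, (P j).totalDegree ≤ D)
    (h0 : ∀ j, MvPolynomial.eval (fun _ => (0 : ℝ)) (P j) = 0) (z : V k) (n : ℤ) (s : ℝ) :
    lin (vz D P z) (gam n s) = Pm P (((2:ℝ)^n * s) • z) := by
  ext j
  have h := poly_exp (hD j) (h0 j) ((2:ℝ)^n * s) (fun l => z l)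
  have e1 : Pm P (((2:ℝ)^n * s) • z) j = MvPolynomial.eval (fun i => (2:ℝ)^n * s * z i) (P j) := rfl
  rw [e1, h]
  have e2 : lin (vz D P z) (gam n s) j = ∑ i, (gam n s : V (D+1)) i * vz D P z i j := by
    simp [lin]
  rw [e2]
  refine Finset.sum_congr rfl fun i _ => ?_
  have e3 : (gam n s : V (D+1)) i = ((2:ℝ)^n * s) ^ ((i:ℕ)+1) := by
    simp only [gam, scl]
    rw [mul_pow, zpow_mul, ← zpow_natCast ((2:ℝ)^n)]
    push_cast; rfl
  rw [e3]; rfl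
end red
end Radon

namespace Radon
open MeasureTheory Filter Topology

section fin
variable {d e k : ℕ}

lemma lint_smul {f : V k → ℝ≥0∞} (hf : Measurable f) {ρ : ℝ} (hρ : 0 < ρ) :
    ∫⁻ z, f (ρ • z) = ENNReal.ofReal ((ρ ^ k)⁻¹) * ∫⁻ z, f z := by
  have h := Measure.map_addHaar_smul (volume : Measure (V k)) hρ.ne'
  have h1 : ∫⁻ z, f z ∂(Measure.map (fun x => ρ • x) (volume : Measure (V k))) = ∫⁻ z, f (ρ • z) :=
    lintegral_map hf (measurable_const_smul ρ)
  rw [← h1, h, lintegral_smul_measure, abs_of_pos (by positivity)]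
  simp

def bone (k : ℕ) : ℝ≥0∞ := volume (Metric.ball (0 : V k) 1)

lemma bone_pos : bone k ≠ 0 := (Metric.measure_ball_pos volume _ one_pos).ne'
lemma bone_ne : bone k ≠ ∞ := measure_ball_lt_top.ne

def cK (k : ℕ) : ℝ≥0∞ := (bone k)⁻¹ * ENNReal.ofReal (2 ^ k) * 2

lemma cK_ne : cK k ≠ ∞ := ENNReal.mul_ne_top (ENNReal.mul_ne_top (by simpa using bone_pos) (by simp)) (by simp)

lemma radial {G : V k → ℝ≥0∞} (hG : Measurable G) {r : ℝ} {n : ℤ} (hr : r ≤ (2:ℝ)^n) :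
    ENNReal.ofReal ((((2:ℝ)^n) ^ k)⁻¹) * ∫⁻ y in Metric.closedBall 0 r, G y ≤
      2 * ∫⁻ z in Metric.closedBall (0 : V k) 2, ∫⁻ s in Set.Ioc (0:ℝ) 1, G (((2:ℝ)^n * s) • z) := by
  have hm : Measurable fun w : V k × ℝ => G (((2:ℝ)^n * w.2) • w.1) := hG.comp (by fun_prop)
  rw [lintegral_lintegral_swap (f := fun z s => G (((2:ℝ)^n * s) • z)) hm.aemeasurable]
  set X := ENNReal.ofReal ((((2:ℝ)^n) ^ k)⁻¹) * ∫⁻ y in Metric.closedBall 0 r, G y with hX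
  have h2n : (0:ℝ) < 2 ^ n := by positivity
  have key : ∀ s ∈ Set.Ioc (1/2 : ℝ) 1, X ≤ ∫⁻ z in Metric.closedBall (0 : V k) 2, G (((2:ℝ)^n * s) • z) := by
    intro s hs
    have hs0 : 0 < s := by linarith [hs.1]
    set ρ := (2:ℝ)^n * s with hρ
    have hρ0 : 0 < ρ := by positivity
    have hρ1 : ρ ≤ 2^n := by rw [hρ]; nlinarith [hs.2]
    have hρ2 : r ≤ 2 * ρ := by rw [hρ]; nlinarith [hs.1]
    have e1 : ∫⁻ z in Metric.closedBall (0 : V k) 2, G (ρ • z) =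
        ∫⁻ z, (Metric.closedBall (0 : V k) (2*ρ)).indicator G (ρ • z) := by
      rw [← lintegral_indicator Metric.isClosed_closedBall.measurableSet]
      refine lintegral_congr fun z => ?_
      have hiff : z ∈ Metric.closedBall (0 : V k) 2 ↔ ρ • z ∈ Metric.closedBall (0 : V k) (2*ρ) := by
        rw [mem_closedBall_zero_iff, mem_closedBall_zero_iff, norm_smul, Real.norm_of_nonneg hρ0.le, mul_comm 2 ρ]
        exact (mul_le_mul_iff_right₀ hρ0).symm
      by_cases hz : z ∈ Metric.closedBall (0 : V k) 2
      · rw [Set.indicator_of_mem hz, Set.indicator_of_mem (hiff.1 hz)]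
      · rw [Set.indicator_of_notMem hz, Set.indicator_of_notMem fun h => hz (hiff.2 h)]
    rw [e1, lint_smul (hG.indicator Metric.isClosed_closedBall.measurableSet) hρ0, lintegral_indicator Metric.isClosed_closedBall.measurableSet]
    refine mul_le_mul' (ENNReal.ofReal_le_ofReal ?_) (lintegral_mono_set (Metric.closedBall_subset_closedBall hρ2))
    gcongr
  have h1 : X * ENNReal.ofReal (1/2) ≤ ∫⁻ s in Set.Ioc (0:ℝ) 1, ∫⁻ z in Metric.closedBall (0 : V k) 2, G (((2:ℝ)^n * s) • z) := by
    calc X * ENNReal.ofReal (1/2) = ∫⁻ s in Set.Ioc (1/2:ℝ) 1, X := by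
          rw [setLIntegral_const, Real.volume_Ioc]; norm_num
      _ ≤ ∫⁻ s in Set.Ioc (1/2:ℝ) 1, ∫⁻ z in Metric.closedBall (0 : V k) 2, G (((2:ℝ)^n * s) • z) :=
          setLIntegral_mono' measurableSet_Ioc key
      _ ≤ _ := lintegral_mono_set (Set.Ioc_subset_Ioc (by norm_num) le_rfl)
  calc X = 2 * (X * ENNReal.ofReal (1/2)) := by
        rw [mul_left_comm, show (2:ℝ≥0∞) = ENNReal.ofReal 2 by simp, ← ENNReal.ofReal_mul (by norm_num)]; norm_num
    _ ≤ _ := mul_le_mul_right h1 _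

lemma ball_avg {G : V k → ℝ≥0∞} (hG : Measurable G) {r : ℝ} {n : ℤ} (hr0 : (2:ℝ)^n / 2 ≤ r) (hr : r ≤ (2:ℝ)^n) :
    (volume (Metric.closedBall (0 : V k) r))⁻¹ * ∫⁻ y in Metric.closedBall 0 r, G y ≤
      cK k * ∫⁻ z in Metric.closedBall (0 : V k) 2, ∫⁻ s in Set.Ioc (0:ℝ) 1, G (((2:ℝ)^n * s) • z) := by
  have h2n : (0:ℝ) < 2 ^ n := by positivity
  have hr' : 0 < r := by linarith
  have h1 : (volume (Metric.closedBall (0 : V k) r))⁻¹ ≤ (bone k)⁻¹ * ENNReal.ofReal (2^k) * ENNReal.ofReal ((((2:ℝ)^n) ^ k)⁻¹) := by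
    rw [Measure.addHaar_closedBall _ _ hr'.le, ENNReal.mul_inv (Or.inr measure_ball_lt_top.ne) (Or.inl (by simp)), mul_comm, mul_assoc]
    refine mul_le_mul_right ?_ _
    rw [← ENNReal.ofReal_mul (by positivity), ← ENNReal.ofReal_inv_of_pos (by positivity)]
    refine ENNReal.ofReal_le_ofReal ?_
    have hfin : Module.finrank ℝ (V k) = k := by simp
    rw [hfin, show (2:ℝ)^k * (((2:ℝ)^n)^k)⁻¹ = ((2^n/2)^k)⁻¹ by rw [div_pow]; field_simp]
    gcongr
  calc _ ≤ (bone k)⁻¹ * ENNReal.ofReal (2^k) * ENNReal.ofReal ((((2:ℝ)^n) ^ k)⁻¹) * ∫⁻ y in Metric.closedBall 0 r, G y := mul_le_mul_left h1 _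
    _ = (bone k)⁻¹ * ENNReal.ofReal (2^k) * (ENNReal.ofReal ((((2:ℝ)^n) ^ k)⁻¹) * ∫⁻ y in Metric.closedBall 0 r, G y) := by ring
    _ ≤ _ := mul_le_mul_right (radial hG hr) _
    _ = _ := by rw [cK]; ring

def Is (D : ℕ) (P : Fin e → MvPolynomial (Fin k) ℝ) (F : V e → ℝ≥0∞) (x : V e) : ℝ≥0∞ :=
  ∫⁻ z in Metric.closedBall (0 : V k) 2, Nm (vz D P z) F x

lemma Nmz_meas (D : ℕ) (P : Fin e → MvPolynomial (Fin k) ℝ) {F : V e → ℝ≥0∞} (hF : Measurable F) :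
    Measurable fun w : V k × V e => Nm (vz D P w.1) F w.2 :=
  (Nm_meas2 hF).comp (f := fun w : V k × V e => (vz D P w.1, w.2)) (by
    have := vz_meas D P
    fun_prop)

lemma Is_meas (D : ℕ) (P : Fin e → MvPolynomial (Fin k) ℝ) {F : V e → ℝ≥0∞} (hF : Measurable F) : Measurable (Is D P F) :=
  Measurable.lintegral_prod_left' (Nmz_meas D P hF)

lemma cra_le (P : Fin e → MvPolynomial (Fin k) ℝ) {r : ℝ} (hr : 0 < r) (f : V e → ℂ) (x : V e) :
    ‖contRadonAvg k e P r f x‖ₑ ≤ (volume (Metric.closedBall (0 : V k) r))⁻¹ * ∫⁻ y in Metric.closedBall 0 r, ‖f (x - Pm P y)‖ₑ := by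
  unfold contRadonAvg
  rw [enorm_mul]
  refine mul_le_mul' (le_of_eq ?_) (enorm_integral_le_lintegral_enorm _)
  have h0 : volume (Metric.closedBall (0 : V k) r) ≠ 0 := (Metric.measure_closedBall_pos volume _ hr).ne'
  have hi : volume (Metric.closedBall (0 : V k) r) ≠ ∞ := measure_closedBall_lt_top.ne
  have hpos := ENNReal.toReal_pos h0 hi
  rw [enorm_inv (by exact_mod_cast hpos.ne')]
  congr 1
  rw [← ofReal_norm_eq_enorm, Complex.norm_real, Real.norm_of_nonneg hpos.le, ENNReal.ofReal_toReal hi]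

lemma cra_sup {D : ℕ} {P : Fin e → MvPolynomial (Fin k) ℝ} (hD : ∀ j, (P j).totalDegree ≤ D)
    (h0 : ∀ j, MvPolynomial.eval (fun _ => (0 : ℝ)) (P j) = 0) {f : V e → ℂ} (hf : Measurable f) (x : V e) :
    (⨆ (r : ℝ) (_ : 0 < r), ‖contRadonAvg k e P r f x‖ₑ) ≤ cK k * Is D P (fun y => ‖f y‖ₑ) x := by
  refine iSup₂_le fun r hr => ?_
  obtain ⟨n, hn1, hn2⟩ := exists_mem_Ioc_zpow hr (one_lt_two (α := ℝ))
  have hm : Measurable fun y => ‖f (x - Pm P y)‖ₑ := (hf.comp ((Pm_meas P).const_sub x)).enorm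
  refine (cra_le P hr f x).trans ((ball_avg hm (n := n+1) ?_ hn2).trans (mul_le_mul_right ?_ _))
  · rw [zpow_add_one₀ (by norm_num)]; linarith
  · refine lintegral_mono fun z => ?_
    refine le_trans (le_of_eq ?_) (le_iSup _ (n+1))
    unfold Avl
    refine lintegral_congr fun s => ?_
    rw [lin_vz hD h0]

theorem main {p : ℝ} (hp : 1 < p) (k e D : ℕ) : ∃ K : ℝ≥0∞, K ≠ ∞ ∧ ∀ P : Fin e → MvPolynomial (Fin k) ℝ,
    ∀ F : ℕ → V e → ℝ≥0∞, (∀ t, Measurable (F t)) →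
      ∫⁻ x, (∑' t, Is D P (F t) x ^ 2) ^ (p/2) ≤ K * ∫⁻ x, (∑' t, F t x ^ 2) ^ (p/2) := by
  obtain ⟨C, hC, h⟩ := fwd_all (d := D+1) (by omega) hp
  set b := (volume.restrict (Metric.closedBall (0 : V k) 2)) Set.univ with hb
  have hbi : b ≠ ∞ := by rw [hb, Measure.restrict_apply_univ]; exact measure_closedBall_lt_top.ne
  refine ⟨b ^ (p-1) * (2 ^ (D+1) * C * b), ?_, ?_⟩
  · exact ENNReal.mul_ne_top (ENNReal.rpow_ne_top_of_nonneg (by linarith) hbi)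
      (ENNReal.mul_ne_top (ENNReal.mul_ne_top (ENNReal.pow_ne_top (by simp)) hC) hbi)
  intro P F hF
  refine fatou_le (Φ := fun m x => (∑ t : Fin m, Is D P (F t) x ^ 2) ^ (p/2)) (fun m => ?_) (ae_of_all _ fun x => ?_) (fun m => ?_)
  · exact LS_meas (fun t : Fin m => Is_meas D P (hF t)) _
  · refine (ENNReal.continuous_rpow_const.tendsto _).comp ?_
    have := ENNReal.tendsto_nat_tsum fun t => Is D P (F t) x ^ 2
    simpa only [Finset.sum_range] using this
  · have h1 := mink_LS (μ := volume.restrict (Metric.closedBall (0 : V k) 2)) (ν := (volume : Measure (V e))) hp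
      (N := fun (t : Fin m) z x => Nm (vz D P z) (F t) x) (fun t => Nmz_meas D P (hF t))
      (fun z => transfer_Nm (by linarith) h (vz D P z) (fun t : Fin m => hF t))
    refine h1.trans ?_
    rw [← hb]
    calc b ^ (p-1) * (2 ^ (D+1) * C * LS volume p (fun t : Fin m => F t) * b) = b ^ (p-1) * (2 ^ (D+1) * C * b) * LS volume p (fun t : Fin m => F t) := by ring
      _ ≤ _ := mul_le_mul_right (lintegral_mono fun x => ENNReal.rpow_le_rpow ?_ (by linarith)) _
    rw [← Finset.sum_range (fun t => F t x ^ 2)]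
    exact ENNReal.sum_le_tsum _
end fin
end Radon

/-- **Theorem (continuous vector-valued maximal theorem for Radon averages).** -/
theorem statement18 (p : ℝ) (hp : 1 < p) (k d₀ D : ℕ) :
    ∃ C : ℝ, 0 < C ∧
      ∀ P : Fin d₀ → MvPolynomial (Fin k) ℝ,
        (∀ j, (P j).totalDegree ≤ D) →
        (∀ j, MvPolynomial.eval (fun _ => (0 : ℝ)) (P j) = 0) →
        ∀ f : ℕ → EuclideanSpace ℝ (Fin d₀) → ℂ,
          (∀ t, Measurable (f t)) →
          (∫⁻ x : EuclideanSpace ℝ (Fin d₀),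
              ((∑' t : ℕ, (‖f t x‖₊ : ℝ≥0∞) ^ (2 : ℝ)) ^ ((1 : ℝ) / 2)) ^ p) ^ (1 / p) ≠ ∞ →
          (∫⁻ x : EuclideanSpace ℝ (Fin d₀),
              ((∑' t : ℕ,
                  (⨆ (r : ℝ) (_ : 0 < r),
                    (‖contRadonAvg k d₀ P r (f t) x‖₊ : ℝ≥0∞)) ^ (2 : ℝ)) ^
                ((1 : ℝ) / 2)) ^ p) ^ (1 / p)
            ≤ ENNReal.ofReal C *
              (∫⁻ x : EuclideanSpace ℝ (Fin d₀),
                ((∑' t : ℕ, (‖f t x‖₊ : ℝ≥0∞) ^ (2 : ℝ)) ^ ((1 : ℝ) / 2)) ^ p) ^ (1 / p) := by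
  obtain ⟨K, hK, h⟩ := Radon.main hp k d₀ D
  have hp0 : 0 < p := by linarith
  set K' : ℝ≥0∞ := (Radon.cK k ^ p * K) ^ (1 / p) with hK'
  have hK'i : K' ≠ ∞ := ENNReal.rpow_ne_top_of_nonneg (by positivity)
    (ENNReal.mul_ne_top (ENNReal.rpow_ne_top_of_nonneg hp0.le Radon.cK_ne) hK)
  refine ⟨K'.toReal + 1, by positivity, fun P hD h0 f hf _ => ?_⟩
  have hle : K' ≤ ENNReal.ofReal (K'.toReal + 1) := by
    rw [ENNReal.le_ofReal_iff_toReal_le hK'i (by positivity)]; linarith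
  refine le_trans ?_ (mul_le_mul_left hle _)
  have hrw : ∀ a : ℝ≥0∞, (a ^ ((1:ℝ)/2)) ^ p = a ^ (p/2) := fun a => by
    rw [← ENNReal.rpow_mul]; congr 1; ring
  simp_rw [hrw, ENNReal.rpow_two]
  rw [hK', ← ENNReal.mul_rpow_of_nonneg _ _ (by positivity)]
  refine ENNReal.rpow_le_rpow ?_ (by positivity)
  have h1 := h P (fun t y => ‖f t y‖ₑ) (fun t => (hf t).enorm)
  have hm : Measurable fun x => (∑' t, Radon.Is D P (fun y => ‖f t y‖ₑ) x ^ 2) ^ (p/2) :=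
    (Measurable.ennreal_tsum fun t => (Radon.Is_meas D P (hf t).enorm).pow_const 2).pow_const _
  calc _ ≤ ∫⁻ x, Radon.cK k ^ p * (∑' t, Radon.Is D P (fun y => ‖f t y‖ₑ) x ^ 2) ^ (p/2) := by
        refine MeasureTheory.lintegral_mono fun x => ?_
        have h2 : (∑' t, (⨆ (r : ℝ) (_ : 0 < r), (‖contRadonAvg k d₀ P r (f t) x‖₊ : ℝ≥0∞)) ^ 2) ≤
            Radon.cK k ^ 2 * ∑' t, Radon.Is D P (fun y => ‖f t y‖ₑ) x ^ 2 := by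
          rw [← ENNReal.tsum_mul_left]
          refine ENNReal.tsum_le_tsum fun t => ?_
          rw [← mul_pow]
          exact pow_le_pow_left' (Radon.cra_sup hD h0 (hf t) x) 2
        refine (ENNReal.rpow_le_rpow h2 (by positivity)).trans (le_of_eq ?_)
        rw [ENNReal.mul_rpow_of_nonneg _ _ (by positivity), ← ENNReal.rpow_natCast, ← ENNReal.rpow_mul]
        congr 2
        push_cast; ring
    _ = Radon.cK k ^ p * ∫⁻ x, (∑' t, Radon.Is D P (fun y => ‖f t y‖ₑ) x ^ 2) ^ (p/2) := by
        rw [MeasureTheory.lintegral_const_mul _ hm]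
    _ ≤ _ := by
        rw [mul_assoc]
        exact mul_le_mul_right h1 _

end
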